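/- For every ε > 0, I_+(T) = (1/2) ∫_T^{2T} |ζ(1/2+it)| dt + O_ε(T^{1/4+ε}) as T → ∞. -/

import Mathlib

open MeasureTheory

/-- The phase factor `e^{iθ(t)} = π^{-it/2} Γ(1/4+it/2)/|Γ(1/4+it/2)|`. -/
noncomputable def eTheta (t : ℝ) : ℂ :=
  (Real.pi : ℂ) ^ (-(Complex.I * (t : ℂ)) / 2) *
    (Complex.Gamma (1 / 4 + Complex.I * (t : ℂ) / 2) /
      ‖Complex.Gamma (1 / 4 + Complex.I * (t : ℂ) / 2)‖)

/-- Hardy's function `Z(t) = e^{iθ(t)} ζ(1/2+it)` (a real number for real `t`). -/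
noncomputable def HardyZ (t : ℝ) : ℝ :=
  (eTheta t * riemannZeta (1 / 2 + Complex.I * (t : ℂ))).re

/-- `I₊(T) = ∫_{t ∈ (T,2T], Z(t)>0} Z(t) dt`. -/
noncomputable def Iplus (T : ℝ) : ℝ :=
  ∫ t in {t : ℝ | t ∈ Set.Ioc T (2 * T) ∧ 0 < HardyZ t}, HardyZ t

/-- First derivative test: an oscillatory integral with convex phase whose derivative is at least
`m` in absolute value. -/
theorem norm_integral_exp_le_of_le_abs_deriv {a b m : ℝ} {p p' p'' : ℝ → ℝ} (hab : a ≤ b)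
    (hm : 0 < m) (hp : ∀ x ∈ Set.Icc a b, HasDerivAt p (p' x) x)
    (hp' : ∀ x ∈ Set.Icc a b, HasDerivAt p' (p'' x) x) (hc : ContinuousOn p'' (Set.Icc a b))
    (hpos : ∀ x ∈ Set.Icc a b, 0 ≤ p'' x) (hle : ∀ x ∈ Set.Icc a b, m ≤ |p' x|) :
    ‖∫ x in a..b, Complex.exp (Complex.I * p x)‖ ≤ 4 / m := by
  have hne : ∀ x ∈ Set.Icc a b, p' x ≠ 0 := fun x hx h => by
    have := hle x hx; rw [h, abs_zero] at this; linarith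
  have hinv : ∀ x ∈ Set.Icc a b, |(p' x)⁻¹| ≤ m⁻¹ := fun x hx => by
    rw [abs_inv]; exact inv_anti₀ hm (hle x hx)
  have hpc : ContinuousOn p (Set.Icc a b) := fun x hx => (hp x hx).continuousAt.continuousWithinAt
  have hpc' : ContinuousOn p' (Set.Icc a b) :=
    fun x hx => (hp' x hx).continuousAt.continuousWithinAt
  have hq : ∀ x ∈ Set.uIcc a b, HasDerivAt (fun x => (p' x)⁻¹) (-(p'' x) / (p' x) ^ 2) x := by
    intro x hx
    rw [Set.uIcc_of_le hab] at hx
    exact (hp' x hx).inv (hne x hx)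
  have hqc : ContinuousOn (fun x => -(p'' x) / (p' x) ^ 2) (Set.Icc a b) :=
    hc.neg.div (hpc'.pow 2) fun x hx => pow_ne_zero _ (hne x hx)
  have hqi : IntervalIntegrable (fun x => -(p'' x) / (p' x) ^ 2) volume a b := by
    apply ContinuousOn.intervalIntegrable; rwa [Set.uIcc_of_le hab]
  have hu : ∀ x ∈ Set.uIcc a b, HasDerivAt (fun x => (((p' x)⁻¹ : ℝ) : ℂ))
      ((-(p'' x) / (p' x) ^ 2 : ℝ) : ℂ) x := fun x hx => (hq x hx).ofReal_comp
  have hv : ∀ x ∈ Set.uIcc a b, HasDerivAt (fun x => Complex.exp (Complex.I * p x))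
      (Complex.exp (Complex.I * p x) * (Complex.I * (p' x : ℂ))) x := by
    intro x hx
    rw [Set.uIcc_of_le hab] at hx
    exact ((hp x hx).ofReal_comp.const_mul Complex.I).cexp
  have hec : ContinuousOn (fun x => Complex.exp (Complex.I * p x)) (Set.Icc a b) := by
    have : ContinuousOn (fun x => (p x : ℂ)) (Set.Icc a b) :=
      Complex.continuous_ofReal.comp_continuousOn hpc
    exact (continuousOn_const.mul this).cexp
  have hvi : IntervalIntegrable (fun x => Complex.exp (Complex.I * p x) *
      (Complex.I * (p' x : ℂ))) volume a b := by
    apply ContinuousOn.intervalIntegrable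
    rw [Set.uIcc_of_le hab]
    exact hec.mul (continuousOn_const.mul (Complex.continuous_ofReal.comp_continuousOn hpc'))
  have hui : IntervalIntegrable (fun x => ((-(p'' x) / (p' x) ^ 2 : ℝ) : ℂ)) volume a b := by
    apply ContinuousOn.intervalIntegrable
    rw [Set.uIcc_of_le hab]
    exact Complex.continuous_ofReal.comp_continuousOn hqc
  have key := intervalIntegral.integral_mul_deriv_eq_deriv_mul hu hv hui hvi
  have h1 : ∫ x in a..b, (((p' x)⁻¹ : ℝ) : ℂ) * (Complex.exp (Complex.I * p x) *
      (Complex.I * (p' x : ℂ))) = Complex.I * ∫ x in a..b, Complex.exp (Complex.I * p x) := by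
    rw [← intervalIntegral.integral_const_mul]
    apply intervalIntegral.integral_congr
    intro x hx
    rw [Set.uIcc_of_le hab] at hx
    have : (p' x : ℂ) ≠ 0 := by exact_mod_cast hne x hx
    simp only [Complex.ofReal_inv]
    field_simp
  have hnorm : ∀ x, ‖Complex.exp (Complex.I * p x)‖ = 1 := fun x => by
    rw [mul_comm]; exact Complex.norm_exp_ofReal_mul_I _
  have h2 : ‖∫ x in a..b, ((-(p'' x) / (p' x) ^ 2 : ℝ) : ℂ) * Complex.exp (Complex.I * p x)‖
      ≤ 2 / m := by
    calc _ ≤ ∫ x in a..b, -(-(p'' x) / (p' x) ^ 2) := by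
            apply intervalIntegral.norm_integral_le_of_norm_le hab _ hqi.neg
            refine Filter.Eventually.of_forall fun x hx => ?_
            rw [norm_mul, hnorm, mul_one, Complex.norm_real, Real.norm_eq_abs, neg_div, abs_neg,
              Pi.neg_apply, neg_div, neg_neg, abs_of_nonneg]
            exact div_nonneg (hpos x (Set.Ioc_subset_Icc_self hx)) (sq_nonneg _)
      _ = (p' a)⁻¹ - (p' b)⁻¹ := by
            rw [intervalIntegral.integral_neg,
              intervalIntegral.integral_eq_sub_of_hasDerivAt hq hqi]; ring
      _ ≤ m⁻¹ + m⁻¹ := by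
            have ha := abs_le.1 (hinv a (Set.left_mem_Icc.2 hab))
            have hb := abs_le.1 (hinv b (Set.right_mem_Icc.2 hab))
            linarith
      _ = 2 / m := by ring
  rw [h1] at key
  have h3 : ‖∫ x in a..b, Complex.exp (Complex.I * p x)‖ =
      ‖Complex.I * ∫ x in a..b, Complex.exp (Complex.I * p x)‖ := by simp
  rw [h3, key]
  refine (norm_sub_le _ _).trans ?_
  refine (add_le_add (norm_sub_le _ _) h2).trans ?_
  simp only [norm_mul, hnorm, mul_one, Complex.norm_real, Real.norm_eq_abs]
  have ha := hinv a (Set.left_mem_Icc.2 hab)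
  have hb := hinv b (Set.right_mem_Icc.2 hab)
  have : 4 / m = m⁻¹ + m⁻¹ + 2 / m := by ring
  linarith

/-- Second derivative test for oscillatory integrals. -/
theorem norm_integral_exp_le_of_le_deriv2 {a b l : ℝ} {p p' p'' : ℝ → ℝ} (hab : a ≤ b)
    (hl : 0 < l) (hp : ∀ x ∈ Set.Icc a b, HasDerivAt p (p' x) x)
    (hp' : ∀ x ∈ Set.Icc a b, HasDerivAt p' (p'' x) x) (hc : ContinuousOn p'' (Set.Icc a b))
    (hle : ∀ x ∈ Set.Icc a b, l ≤ p'' x) :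
    ‖∫ x in a..b, Complex.exp (Complex.I * p x)‖ ≤ 10 / √l := by
  have hs : 0 < √l := Real.sqrt_pos.2 hl
  have hsl : l * (1 / √l) = √l := by
    field_simp; exact (Real.sq_sqrt hl.le).symm
  have hnorm : ∀ x, ‖Complex.exp (Complex.I * p x)‖ = 1 := fun x => by
    rw [mul_comm]; exact Complex.norm_exp_ofReal_mul_I _
  have triv : ∀ c d, c ≤ d → d - c ≤ 1 / √l →
      ‖∫ x in c..d, Complex.exp (Complex.I * p x)‖ ≤ 1 / √l := by
    intro c d hcd h
    refine (intervalIntegral.norm_integral_le_of_norm_le_const (C := 1)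
      fun x _ => (hnorm x).le).trans ?_
    rw [one_mul, abs_of_nonneg (by linarith)]; exact h
  have hec : ContinuousOn (fun x => Complex.exp (Complex.I * p x)) (Set.Icc a b) := by
    have : ContinuousOn (fun x => (p x : ℂ)) (Set.Icc a b) :=
      Complex.continuous_ofReal.comp_continuousOn
        fun x hx => (hp x hx).continuousAt.continuousWithinAt
    exact (continuousOn_const.mul this).cexp
  have hInt : ∀ c d, a ≤ c → c ≤ d → d ≤ b →
      IntervalIntegrable (fun x => Complex.exp (Complex.I * p x)) volume c d := by
    intro c d h1 h2 h3
    apply ContinuousOn.intervalIntegrable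
    rw [Set.uIcc_of_le h2]
    exact hec.mono (Set.Icc_subset_Icc h1 h3)
  have grow : ∀ c d, a ≤ c → c ≤ d → d ≤ b → l * (d - c) ≤ p' d - p' c := by
    intro c d h1 h2 h3
    have hsub := Set.Icc_subset_Icc h1 h3
    refine (convex_Icc c d).mul_sub_le_image_sub_of_le_deriv
      (fun x hx => (hp' x (hsub hx)).continuousAt.continuousWithinAt)
      (fun x hx => (hp' x (hsub (interior_subset hx))).differentiableAt.differentiableWithinAt)
      (fun x hx => ?_) c (Set.left_mem_Icc.2 h2) d (Set.right_mem_Icc.2 h2) h2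
    rw [(hp' x (hsub (interior_subset hx))).deriv]
    exact hle x (hsub (interior_subset hx))
  have first : ∀ c d, a ≤ c → c ≤ d → d ≤ b → (∀ x ∈ Set.Icc c d, √l ≤ |p' x|) →
      ‖∫ x in c..d, Complex.exp (Complex.I * p x)‖ ≤ 4 / √l := by
    intro c d h1 h2 h3 h4
    have hsub := Set.Icc_subset_Icc h1 h3
    exact norm_integral_exp_le_of_le_abs_deriv h2 hs (fun x hx => hp x (hsub hx))
      (fun x hx => hp' x (hsub hx)) (hc.mono hsub) (fun x hx => hl.le.trans (hle x (hsub hx))) h4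
  have right : ∀ c, a ≤ c → c ≤ b → 0 ≤ p' c →
      ‖∫ x in c..b, Complex.exp (Complex.I * p x)‖ ≤ 5 / √l := by
    intro c h1 h2 h3
    have e5 : 5 / √l = 1 / √l + 4 / √l := by ring
    have hd : 0 < 1 / √l := by positivity
    rcases le_total (b - c) (1 / √l) with h | h
    · have := triv c b h2 h
      have : 0 < 4 / √l := by positivity
      linarith
    · rw [← intervalIntegral.integral_add_adjacent_intervals
        (hInt c (c + 1 / √l) h1 (by linarith) (by linarith))
        (hInt (c + 1 / √l) b (by linarith) (by linarith) le_rfl), e5]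
      refine (norm_add_le _ _).trans (add_le_add (triv _ _ (by linarith) (by linarith)) ?_)
      refine first _ _ (by linarith) (by linarith) le_rfl fun x hx => ?_
      have := grow c x h1 (by linarith [hx.1]) hx.2
      have h6 : l * (1 / √l) ≤ l * (x - c) := by
        apply mul_le_mul_of_nonneg_left _ hl.le; linarith [hx.1]
      exact le_trans (by linarith) (le_abs_self _)
  have left : ∀ c, a ≤ c → c ≤ b → p' c ≤ 0 →
      ‖∫ x in a..c, Complex.exp (Complex.I * p x)‖ ≤ 5 / √l := by
    intro c h1 h2 h3
    have e5 : 5 / √l = 4 / √l + 1 / √l := by ring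
    have hd : 0 < 1 / √l := by positivity
    rcases le_total (c - a) (1 / √l) with h | h
    · have := triv a c h1 h
      have : 0 < 4 / √l := by positivity
      linarith
    · rw [← intervalIntegral.integral_add_adjacent_intervals
        (hInt a (c - 1 / √l) le_rfl (by linarith) (by linarith))
        (hInt (c - 1 / √l) c (by linarith) (by linarith) h2), e5]
      refine (norm_add_le _ _).trans (add_le_add ?_ (triv _ _ (by linarith) (by linarith)))
      refine first _ _ le_rfl (by linarith) (by linarith) fun x hx => ?_
      have := grow x c hx.1 (by linarith [hx.2]) h2
      have h6 : l * (1 / √l) ≤ l * (c - x) := by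
        apply mul_le_mul_of_nonneg_left _ hl.le; linarith [hx.2]
      rw [← abs_neg]
      exact le_trans (by linarith) (le_abs_self _)
  have h510 : 5 / √l ≤ 10 / √l := by gcongr; norm_num
  rcases le_total 0 (p' a) with h0 | h0
  · exact (right a le_rfl hab h0).trans h510
  rcases le_total (p' b) 0 with h1 | h1
  · exact (left b hab le_rfl h1).trans h510
  obtain ⟨c, hcm, hc0⟩ := intermediate_value_Icc hab
    (fun x hx => (hp' x hx).continuousAt.continuousWithinAt) (Set.mem_Icc.2 ⟨h0, h1⟩)
  rw [← intervalIntegral.integral_add_adjacent_intervals (hInt a c le_rfl hcm.1 hcm.2)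
    (hInt c b hcm.1 hcm.2 le_rfl)]
  refine (norm_add_le _ _).trans ((add_le_add (left c hcm.1 hcm.2 hc0.le)
    (right c hcm.1 hcm.2 hc0.ge)).trans ?_)
  apply le_of_eq; ring

/-- Removing a smooth weight from an integral by partial integration. -/
theorem norm_integral_weight_mul_le {a b M W W' : ℝ} {w w' : ℝ → ℝ} {f : ℝ → ℂ} (ha : 0 < a)
    (hab : a ≤ b) (hw : ∀ x ∈ Set.Icc a b, HasDerivAt w (w' x) x)
    (hc : ContinuousOn w' (Set.Icc a b))
    (hf : ContinuousOn f (Set.Ioi 0)) (hW : ∀ x ∈ Set.Icc a b, |w x| ≤ W)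
    (hW' : ∀ x ∈ Set.Icc a b, |w' x| ≤ W')
    (hM : ∀ y ∈ Set.Icc a b, ‖∫ x in a..y, f x‖ ≤ M) :
    ‖∫ x in a..b, (w x : ℂ) * f x‖ ≤ (W + (b - a) * W') * M := by
  have hM0 : 0 ≤ M := (norm_nonneg _).trans (hM b (Set.right_mem_Icc.2 hab))
  have hfi : ∀ x ∈ Set.Icc a b, IntervalIntegrable f volume a x := by
    intro x hx
    apply ContinuousOn.intervalIntegrable
    rw [Set.uIcc_of_le hx.1]
    exact hf.mono fun y hy => ha.trans_le hy.1
  have hu : ∀ x ∈ Set.uIcc a b, HasDerivAt (fun x => (w x : ℂ)) (w' x : ℂ) x := by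
    intro x hx
    rw [Set.uIcc_of_le hab] at hx
    exact (hw x hx).ofReal_comp
  have hv : ∀ x ∈ Set.uIcc a b, HasDerivAt (fun y => ∫ x in a..y, f x) (f x) x :=
by
    intro x hx
    rw [Set.uIcc_of_le hab] at hx
    have hx0 : 0 < x := ha.trans_le hx.1
    refine intervalIntegral.integral_hasDerivAt_right (hfi x hx)
      (hf.stronglyMeasurableAtFilter isOpen_Ioi x hx0) (hf.continuousAt (Ioi_mem_nhds hx0))
  have hui : IntervalIntegrable (fun x => (w' x : ℂ)) volume a b := by
    apply ContinuousOn.intervalIntegrable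
    rw [Set.uIcc_of_le hab]
    exact Complex.continuous_ofReal.comp_continuousOn hc
  rw [intervalIntegral.integral_mul_deriv_eq_deriv_mul hu hv hui
    (hfi b (Set.right_mem_Icc.2 hab))]
  simp only [intervalIntegral.integral_same, mul_zero, sub_zero]
  refine (norm_sub_le _ _).trans ?_
  rw [add_mul]
  refine add_le_add ?_ ?_
  · rw [norm_mul, Complex.norm_real]
    have hb := Set.right_mem_Icc.2 hab
    exact mul_le_mul (hW b hb) (hM b hb) (norm_nonneg _) ((abs_nonneg _).trans (hW b hb))
  · have : ∀ x ∈ Set.uIoc a b, ‖(w' x : ℂ) * ∫ x in a..x, f x‖ ≤ W' * M := by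
      intro x hx
      rw [Set.uIoc_of_le hab] at hx
      have hx := Set.Ioc_subset_Icc_self hx
      rw [norm_mul, Complex.norm_real]
      exact mul_le_mul (hW' x hx) (hM x hx) (norm_nonneg _) ((abs_nonneg _).trans (hW' x hx))
    refine (intervalIntegral.norm_integral_le_of_norm_le_const this).trans (le_of_eq ?_)
    rw [abs_of_nonneg (by linarith)]; ring

/-- The main term `(t/2) log (t/2π) - t/2` of the Riemann-Siegel theta function. -/
noncomputable def thetaMain (t : ℝ) : ℝ := t / 2 * (Real.log (t / (2 * Real.pi)) - 1)

theorem hasDerivAt_thetaMain {t : ℝ} (ht : 0 < t) :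
    HasDerivAt thetaMain (Real.log (t / (2 * Real.pi)) / 2) t := by
  have hpi := Real.pi_pos
  have h1 : HasDerivAt (fun t : ℝ => t / (2 * Real.pi)) (1 / (2 * Real.pi)) t :=
    (hasDerivAt_id t).div_const _
  have h2 := h1.log (by positivity)
  have h3 := ((hasDerivAt_id t).div_const 2).mul (h2.sub_const 1)
  refine h3.congr_deriv ?_
  simp only [id]
  field_simp
  ring

theorem hasDerivAt_half_log {t : ℝ} (ht : 0 < t) (L : ℝ) :
    HasDerivAt (fun t => Real.log (t / (2 * Real.pi)) / 2 - L) (1 / (2 * t)) t := by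
  have hpi := Real.pi_pos
  have h1 : HasDerivAt (fun t : ℝ => t / (2 * Real.pi)) (1 / (2 * Real.pi)) t :=
    (hasDerivAt_id t).div_const _
  have h2 := h1.log (by positivity)
  refine ((h2.div_const 2).sub_const L).congr_deriv ?_
  field_simp

theorem hasDerivAt_phase {t : ℝ} (ht : 0 < t) (L D : ℝ) :
    HasDerivAt (fun t => thetaMain t - t * L + D) (Real.log (t / (2 * Real.pi)) / 2 - L) t := by
  refine (((hasDerivAt_thetaMain ht).sub ((hasDerivAt_id t).mul_const L)).add_const D).congr_deriv
    ?_
  simp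

theorem continuousOn_phase (L D : ℝ) :
    ContinuousOn (fun t => Complex.exp (Complex.I * ((thetaMain t - t * L + D : ℝ) : ℂ)))
      (Set.Ioi 0) := by
  have : ContinuousOn (fun t => thetaMain t - t * L + D) (Set.Ioi 0) :=
    fun t ht => (hasDerivAt_phase ht L D).continuousAt.continuousWithinAt
  exact (continuousOn_const.mul (Complex.continuous_ofReal.comp_continuousOn this)).cexp

theorem norm_integral_phase_le {T y : ℝ} (hT : 0 < T) (hy : y ∈ Set.Icc T (2 * T)) (L D : ℝ) :
    ‖∫ t in T..y, Complex.exp (Complex.I * ((thetaMain t - t * L + D : ℝ) : ℂ))‖ ≤ 20 * √T := by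
  have hpos : ∀ x ∈ Set.Icc T y, 0 < x := fun x hx => hT.trans_le hx.1
  refine (norm_integral_exp_le_of_le_deriv2 (l := 1 / (4 * T)) hy.1 (by positivity)
    (fun x hx => hasDerivAt_phase (hpos x hx) L D) (fun x hx => hasDerivAt_half_log (hpos x hx) L)
    (fun x hx => ?_) (fun x hx => ?_)).trans (le_of_eq ?_)
  · have := hpos x hx
    apply ContinuousAt.continuousWithinAt
    exact continuousAt_const.div (by fun_prop) (by positivity)
  · have := hpos x hx
    apply one_div_le_one_div_of_le (by positivity)
    linarith [hx.2, hy.2]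
  · rw [Real.sqrt_div zero_le_one, Real.sqrt_one, Real.sqrt_mul (by norm_num)]
    have : √(4 : ℝ) = 2 := by
      rw [show (4 : ℝ) = 2 ^ 2 by norm_num]; exact Real.sqrt_sq (by norm_num)
    rw [this, one_div, div_inv_eq_mul]; ring

theorem norm_integral_phase_le_of_far {T y L m : ℝ} (hT : 0 < T) (hy : y ∈ Set.Icc T (2 * T))
    (hm : 0 < m) (h : ∀ t ∈ Set.Icc T (2 * T), m ≤ |Real.log (t / (2 * Real.pi)) / 2 - L|) (D : ℝ) :
    ‖∫ t in T..y, Complex.exp (Complex.I * ((thetaMain t - t * L + D : ℝ) : ℂ))‖ ≤ 4 / m := by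
  have hpos : ∀ x ∈ Set.Icc T y, 0 < x := fun x hx => hT.trans_le hx.1
  refine norm_integral_exp_le_of_le_abs_deriv hy.1 hm
    (fun x hx => hasDerivAt_phase (hpos x hx) L D) (fun x hx => hasDerivAt_half_log (hpos x hx) L)
    (fun x hx => ?_) (fun x hx => ?_) (fun x hx => h x ⟨hx.1, hx.2.trans hy.2⟩)
  · have := hpos x hx
    apply ContinuousAt.continuousWithinAt
    exact continuousAt_const.div (by fun_prop) (by positivity)
  · have := hpos x hx
    positivity

theorem norm_integral_rpow_mul_le {T b M : ℝ} (hT : 0 < T) (hb0 : 0 ≤ b) (hb : b ≤ 1)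
    {f : ℝ → ℂ} (hf : ContinuousOn f (Set.Ioi 0))
    (hM : ∀ y ∈ Set.Icc T (2 * T), ‖∫ x in T..y, f x‖ ≤ M) :
    ‖∫ t in T..(2 * T), ((t ^ b : ℝ) : ℂ) * f t‖ ≤ 3 * T ^ b * M := by
  have hpos : ∀ x ∈ Set.Icc T (2 * T), 0 < x := fun x hx => hT.trans_le hx.1
  have h1 : ∀ x ∈ Set.Icc T (2 * T), |x ^ b| ≤ 2 * T ^ b := by
    intro x hx
    have hx0 := hpos x hx
    rw [abs_of_nonneg (by positivity)]
    calc x ^ b ≤ (2 * T) ^ b := Real.rpow_le_rpow hx0.le hx.2 hb0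
      _ = 2 ^ b * T ^ b := Real.mul_rpow (by norm_num) hT.le
      _ ≤ 2 * T ^ b := by
        gcongr
        calc (2 : ℝ) ^ b ≤ 2 ^ (1 : ℝ) := Real.rpow_le_rpow_of_exponent_le (by norm_num) hb
          _ = 2 := Real.rpow_one _
  have h2 : ∀ x ∈ Set.Icc T (2 * T), |b * x ^ (b - 1)| ≤ T ^ (b - 1) := by
    intro x hx
    have hx0 := hpos x hx
    rw [abs_of_nonneg (by positivity)]
    calc b * x ^ (b - 1) ≤ 1 * T ^ (b - 1) := by
          exact mul_le_mul hb (Real.rpow_le_rpow_of_nonpos hT hx.1 (by linarith)) (by positivity)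
            zero_le_one
      _ = _ := one_mul _
  refine (norm_integral_weight_mul_le hT (by linarith)
    (fun x hx => Real.hasDerivAt_rpow_const (Or.inl (hpos x hx).ne')) (fun x hx => ?_) hf h1 h2
    hM).trans (le_of_eq ?_)
  · exact (continuousAt_const.mul (Real.continuousAt_rpow_const _ _
      (Or.inl (hpos x hx).ne'))).continuousWithinAt
  · have : T * T ^ (b - 1) = T ^ b := by
      rw [Real.rpow_sub_one hT.ne']; field_simp
    rw [show 2 * T - T = T by ring, this]; ring

/-- A smooth quotient of `u ^ α (u - 1)` by `log u`. -/
theorem exists_smooth_quotient_log (α : ℝ) : ∃ k k' k'' : ℝ → ℝ,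
    (∀ u > 0, HasDerivAt k (k' u) u) ∧ (∀ u > 0, HasDerivAt k' (k'' u) u) ∧
    ContinuousOn k'' (Set.Ioi 0) ∧ ∀ u > 0, k u * Real.log u = u ^ α * (u - 1) := by
  have hd : ∀ u > 0, AnalyticAt ℝ (dslope Real.log 1) u := by
    intro u hu
    by_cases h : u = 1
    · subst h
      obtain ⟨p, hp⟩ := analyticAt_log (x := 1) one_pos
      exact ⟨_, hp.has_fpower_series_dslope_fslope⟩
    · have h1 : AnalyticAt ℝ (fun x => (x - 1)⁻¹ * (Real.log x - Real.log 1)) u := by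
        refine AnalyticAt.mul (AnalyticAt.inv (by fun_prop) (sub_ne_zero.2 h)) ?_
        exact (analyticAt_log hu).sub analyticAt_const
      refine h1.congr ?_
      filter_upwards [isOpen_ne.mem_nhds h] with x hx
      rw [dslope_of_ne _ hx, slope_def_field]
      rw [div_eq_inv_mul]
  have hne : ∀ u > 0, dslope Real.log 1 u ≠ 0 := by
    intro u hu
    by_cases h : u = 1
    · subst h; simp
    · rw [dslope_of_ne _ h, slope_def_field, Real.log_one, sub_zero]
      exact div_ne_zero (Real.log_ne_zero_of_pos_of_ne_one hu h) (sub_ne_zero.2 h)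
  set k : ℝ → ℝ := fun u => u ^ α * (dslope Real.log 1 u)⁻¹ with hk
  have hkan : AnalyticOnNhd ℝ k (Set.Ioi 0) := by
    intro u hu
    have hu : 0 < u := hu
    refine AnalyticAt.mul ?_ ((hd u hu).inv (hne u hu))
    have h1 : AnalyticAt ℝ (fun x => Real.exp (Real.log x * α)) u :=
      ((analyticAt_log hu).mul analyticAt_const).rexp
    refine h1.congr ?_
    filter_upwards [isOpen_Ioi.mem_nhds hu] with x hx
    rw [Real.rpow_def_of_pos hx]
  refine ⟨k, deriv k, deriv (deriv k), fun u hu => (hkan u hu).differentiableAt.hasDerivAt,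
    fun u hu => (hkan.deriv u hu).differentiableAt.hasDerivAt, hkan.deriv.deriv.continuousOn,
    fun u hu => ?_⟩
  by_cases h : u = 1
  · subst h; simp
  · simp only [hk]
    have h1 := sub_ne_zero.2 h
    have h2 := Real.log_ne_zero_of_pos_of_ne_one hu h
    rw [dslope_of_ne _ h, slope_def_field, Real.log_one, sub_zero]
    field_simp

/-- The truncated Mellin-type integral `e^{iπx²} ∫_T^{2T} t^α e^{iϑ(t)} x^{-it} dt`. -/
noncomputable def saddleIntegral (α T x : ℝ) : ℂ :=
  ∫ t in T..(2 * T), ((t ^ α : ℝ) : ℂ) *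
    Complex.exp (Complex.I * ((thetaMain t - t * Real.log x + Real.pi * x ^ 2 : ℝ) : ℂ))

theorem norm_saddleIntegral_le {α T x : ℝ} (hT : 0 < T) (h0 : 0 ≤ α) (h1 : α ≤ 1) :
    ‖saddleIntegral α T x‖ ≤ 60 * T ^ α * √T := by
  refine (norm_integral_rpow_mul_le hT h0 h1 (continuousOn_phase _ _)
    (fun y hy => norm_integral_phase_le hT hy _ _)).trans (le_of_eq ?_)
  ring

theorem hasDerivAt_phase_right {x : ℝ} (hx : 0 < x) (c t : ℝ) :
    HasDerivAt (fun x => c - t * Real.log x + Real.pi * x ^ 2) (2 * Real.pi * x - t / x) x := by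
  have h1 := ((Real.hasDerivAt_log hx.ne').const_mul t).const_sub c
  have h2 := (hasDerivAt_pow 2 x).const_mul Real.pi
  refine (h1.add h2).congr_deriv ?_
  simp only [Nat.cast_ofNat]
  field_simp
  ring

theorem norm_cexp_I_mul (r : ℝ) : ‖Complex.exp (Complex.I * r)‖ = 1 := by
  rw [mul_comm]; exact Complex.norm_exp_ofReal_mul_I _

theorem hasDerivAt_saddleIntegral {α T x : ℝ} (hT : 0 < T) (hx : 0 < x) (h0 : 0 ≤ α) :
    HasDerivAt (saddleIntegral α T) (∫ t in T..(2 * T), ((t ^ α : ℝ) : ℂ) *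
      (Complex.exp (Complex.I * ((thetaMain t - t * Real.log x + Real.pi * x ^ 2 : ℝ) : ℂ)) *
        (Complex.I * ((2 * Real.pi * x - t / x : ℝ) : ℂ)))) x := by
  have hpi := Real.pi_pos
  have hle : T ≤ 2 * T := by linarith
  have hα : Continuous fun t : ℝ => ((t ^ α : ℝ) : ℂ) :=
    Complex.continuous_ofReal.comp (Real.continuous_rpow_const h0)
  have hsub : Set.uIcc T (2 * T) ⊆ Set.Ioi 0 := by
    rw [Set.uIcc_of_le hle]; exact fun t ht => hT.trans_le ht.1
  have hF : ∀ y : ℝ, ContinuousOn (fun t : ℝ => ((t ^ α : ℝ) : ℂ) *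
      Complex.exp (Complex.I * ((thetaMain t - t * Real.log y + Real.pi * y ^ 2 : ℝ) : ℂ)))
      (Set.Ioi 0) := fun y => hα.continuousOn.mul (continuousOn_phase _ _)
  have hF' : ContinuousOn (fun t : ℝ => ((t ^ α : ℝ) : ℂ) *
      (Complex.exp (Complex.I * ((thetaMain t - t * Real.log x + Real.pi * x ^ 2 : ℝ) : ℂ)) *
        (Complex.I * ((2 * Real.pi * x - t / x : ℝ) : ℂ)))) (Set.Ioi 0) :=
    hα.continuousOn.mul ((continuousOn_phase _ _).mul (by fun_prop))
  have hmeas : ∀ f : ℝ → ℂ, ContinuousOn f (Set.Ioi 0) →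
      IntervalIntegrable f volume T (2 * T) := fun f hf =>
    (hf.mono hsub).intervalIntegrable
  have := intervalIntegral.hasDerivAt_integral_of_dominated_loc_of_deriv_le
    (F := fun y t => ((t ^ α : ℝ) : ℂ) *
      Complex.exp (Complex.I * ((thetaMain t - t * Real.log y + Real.pi * y ^ 2 : ℝ) : ℂ)))
    (F' := fun y t => ((t ^ α : ℝ) : ℂ) *
      (Complex.exp (Complex.I * ((thetaMain t - t * Real.log y + Real.pi * y ^ 2 : ℝ) : ℂ)) *
        (Complex.I * ((2 * Real.pi * y - t / y : ℝ) : ℂ))))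
    (x₀ := x) (s := Set.Ioo (x / 2) (2 * x)) (μ := volume) (a := T) (b := 2 * T)
    (bound := fun _ => (2 * T) ^ α * (2 * Real.pi * (2 * x) + 2 * T / (x / 2)))
    (Ioo_mem_nhds (by linarith) (by linarith))
    (Filter.Eventually.of_forall fun y => (intervalIntegrable_iff.1 (hmeas _ (hF y))).1)
    (hmeas _ (hF x)) (intervalIntegrable_iff.1 (hmeas _ hF')).1
    (Filter.Eventually.of_forall fun t ht y hy => ?_) (by simp)
    (Filter.Eventually.of_forall fun t ht y hy => ?_)
  · exact this.2
  · have ht' := hsub (Set.uIoc_subset_uIcc ht)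
    rw [Set.uIoc_of_le hle] at ht
    have ht0 : 0 < t := ht'
    have hy0 : 0 < y := by linarith [hy.1]
    rw [norm_mul, norm_mul, norm_mul, norm_cexp_I_mul, Complex.norm_I, one_mul, one_mul,
      Complex.norm_real, Complex.norm_real, Real.norm_eq_abs, Real.norm_eq_abs,
      abs_of_nonneg (Real.rpow_nonneg ht0.le _)]
    apply mul_le_mul (Real.rpow_le_rpow ht0.le ht.2 h0) _ (abs_nonneg _) (by positivity)
    refine (abs_sub _ _).trans ?_
    rw [abs_of_pos (by positivity), abs_of_pos (by positivity)]
    gcongr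
    · exact hy.2.le
    · exact ht.2
    · exact hy.1.le
  · have hy0 : 0 < y := by linarith [hy.1]
    exact ((hasDerivAt_phase_right hy0 _ t).ofReal_comp.const_mul Complex.I).cexp.const_mul _

theorem integral_deriv_eq {α T x : ℝ} {k k' k'' : ℝ → ℝ} (hT : 0 < T) (hx : 0 < x)
    (hk : ∀ u > 0, HasDerivAt k (k' u) u) (hk' : ∀ u > 0, HasDerivAt k' (k'' u) u)
    (hkl : ∀ u > 0, k u * Real.log u = u ^ α * (u - 1)) (e : ℝ → ℂ)
    (he : e = fun t => Complex.exp (Complex.I *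
      ((thetaMain t - t * Real.log x + Real.pi * x ^ 2 : ℝ) : ℂ))) (κ : ℝ)
    (hκ : κ = 2 * Real.pi * x ^ 2) :
    (∫ t in T..(2 * T), ((t ^ α : ℝ) : ℂ) *
      (e t * (Complex.I * ((2 * Real.pi * x - t / x : ℝ) : ℂ)))) =
    ((-4 * Real.pi * x * κ ^ α : ℝ) : ℂ) * (k (2 * T / κ) * e (2 * T) - k (T / κ) * e T -
      (1 / κ : ℝ) * ∫ t in T..(2 * T), (k' (t / κ) : ℂ) * e t) := by
  have hpi := Real.pi_pos
  have hκ0 : 0 < κ := by rw [hκ]; positivity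
  have hle : T ≤ 2 * T := by linarith
  have hpos : ∀ t ∈ Set.uIcc T (2 * T), 0 < t := by
    rw [Set.uIcc_of_le hle]; exact fun t ht => hT.trans_le ht.1
  have hu : ∀ t ∈ Set.uIcc T (2 * T), HasDerivAt (fun t => (k (t / κ) : ℂ))
      ((k' (t / κ) * (1 / κ) : ℝ) : ℂ) t := by
    intro t ht
    have := hpos t ht
    exact ((hk (t / κ) (by positivity)).comp t ((hasDerivAt_id t).div_const κ)).ofReal_comp
  have hv : ∀ t ∈ Set.uIcc T (2 * T), HasDerivAt e
      (e t * (Complex.I * ((Real.log (t / (2 * Real.pi)) / 2 - Real.log x : ℝ) : ℂ))) t := by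
    intro t ht
    rw [he]
    exact ((hasDerivAt_phase (hpos t ht) _ _).ofReal_comp.const_mul Complex.I).cexp
  have hec : ContinuousOn e (Set.uIcc T (2 * T)) :=
    fun t ht => (hv t ht).continuousAt.continuousWithinAt
  have hvi : IntervalIntegrable (fun t => e t * (Complex.I *
      ((Real.log (t / (2 * Real.pi)) / 2 - Real.log x : ℝ) : ℂ))) volume T (2 * T) := by
    apply ContinuousOn.intervalIntegrable
    refine hec.mul (continuousOn_const.mul (Complex.continuous_ofReal.comp_continuousOn ?_))
    exact fun t ht => (hasDerivAt_half_log (hpos t ht) _).continuousAt.continuousWithinAt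
  have hui : IntervalIntegrable (fun t => ((k' (t / κ) * (1 / κ) : ℝ) : ℂ)) volume T (2 * T) := by
    apply ContinuousOn.intervalIntegrable
    refine Complex.continuous_ofReal.comp_continuousOn (ContinuousOn.mul ?_ continuousOn_const)
    intro t ht
    have := hpos t ht
    exact ((hk' (t / κ) (by positivity)).comp t
      ((hasDerivAt_id t).div_const κ)).continuousAt.continuousWithinAt
  have key := intervalIntegral.integral_mul_deriv_eq_deriv_mul hu hv hui hvi
  have h1 : (∫ t in T..(2 * T), ((t ^ α : ℝ) : ℂ) *
      (e t * (Complex.I * ((2 * Real.pi * x - t / x : ℝ) : ℂ)))) =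
      ((-4 * Real.pi * x * κ ^ α : ℝ) : ℂ) * ∫ t in T..(2 * T), (k (t / κ) : ℂ) *
        (e t * (Complex.I * ((Real.log (t / (2 * Real.pi)) / 2 - Real.log x : ℝ) : ℂ))) := by
    rw [← intervalIntegral.integral_const_mul]
    apply intervalIntegral.integral_congr
    intro t ht
    have ht0 := hpos t ht
    have e1 : Real.log (t / (2 * Real.pi)) / 2 - Real.log x = Real.log (t / κ) / 2 := by
      have e0 : t / κ = t / (2 * Real.pi) / x ^ 2 := by rw [hκ, div_div]
      rw [e0, Real.log_div (x := t / (2 * Real.pi)) (by positivity) (by positivity), Real.log_pow]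
      push_cast; ring
    have e2 : t ^ α = κ ^ α * (t / κ) ^ α := by
      rw [← Real.mul_rpow hκ0.le (by positivity)]; congr 1; field_simp
    have e3 : t ^ α * (2 * Real.pi * x - t / x) = -4 * Real.pi * x * κ ^ α *
        (k (t / κ) * (Real.log (t / κ) / 2)) := by
      have e4 : 2 * Real.pi * x - t / x = - (2 * Real.pi * x) * (t / κ - 1) := by
        rw [hκ]; field_simp; ring
      rw [e4, e2]
      linear_combination (2 * Real.pi * x * κ ^ α) * (hkl (t / κ) (by positivity))
    beta_reduce
    rw [e1]
    have e5 : ((t ^ α : ℝ) : ℂ) * ((2 * Real.pi * x - t / x : ℝ) : ℂ) =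
        ((-4 * Real.pi * x * κ ^ α : ℝ) : ℂ) * ((k (t / κ) : ℂ) *
          ((Real.log (t / κ) / 2 : ℝ) : ℂ)) := by exact_mod_cast e3
    linear_combination (Complex.I * e t) * e5
  rw [h1, key]
  congr 2
  rw [← intervalIntegral.integral_const_mul]
  apply intervalIntegral.integral_congr
  intro t ht
  simp only
  push_cast
  ring

theorem norm_integral_unit_phase_le {n τ v y c : ℝ} (hn : 0 < n) (hv : 0 ≤ v)
    (hτ : τ = 2 * Real.pi * v ^ 2) (hy : y ∈ Set.Icc n (n + 1)) :
    ‖∫ x in n..y, Complex.exp (Complex.I * ((c - τ * Real.log x + Real.pi * x ^ 2 : ℝ) : ℂ))‖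
      ≤ 4 / (1 + |n - v|) := by
  have hpi := Real.pi_pos
  have hτ0 : 0 ≤ τ := by rw [hτ]; positivity
  have hpos : ∀ x ∈ Set.Icc n y, 0 < x := fun x hx => hn.trans_le hx.1
  rcases le_or_gt (|n - v|) 3 with h | h
  · refine (intervalIntegral.norm_integral_le_of_norm_le_const (C := 1)
      fun x _ => (norm_cexp_I_mul _).le).trans ?_
    rw [one_mul, abs_of_nonneg (by linarith [hy.1])]
    rw [le_div_iff₀ (by positivity)]
    have : y - n ≤ 1 := by linarith [hy.2]
    have h0 : 0 ≤ y - n := by linarith [hy.1]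
    nlinarith [abs_nonneg (n - v)]
  · have hm : 1 + |n - v| ≤ Real.pi * (1 + |n - v|) := by
      nlinarith [Real.pi_gt_three, abs_nonneg (n - v)]
    have h4 : 0 < 1 + |n - v| := by positivity
    refine (norm_integral_exp_le_of_le_abs_deriv (m := 1 + |n - v|) hy.1 (by positivity)
      (p' := fun x => 2 * Real.pi * x - τ / x) (p'' := fun x => 2 * Real.pi + τ / x ^ 2)
      (fun x hx => hasDerivAt_phase_right (hpos x hx) c τ) (fun x hx => ?_) (fun x hx => ?_)
      (fun x hx => ?_) (fun x hx => ?_))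
    · have h1 := (hasDerivAt_id x).const_mul (2 * Real.pi)
      have h2 := (hasDerivAt_inv (hpos x hx).ne').const_mul τ
      refine (h1.sub h2).congr_deriv ?_
      ring
    · have := hpos x hx
      apply ContinuousAt.continuousWithinAt
      exact continuousAt_const.add (continuousAt_const.div (by fun_prop) (by positivity))
    · have := hpos x hx
      positivity
    · have hx0 := hpos x hx
      have e : 2 * Real.pi * x - τ / x = 2 * Real.pi * ((x - v) * ((x + v) / x)) := by
        rw [hτ]; field_simp; ring
      simp only [e]
      rw [abs_mul (2 * Real.pi), abs_mul (x - v),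
        abs_of_pos (by positivity : (0:ℝ) < 2 * Real.pi),
        abs_of_pos (by positivity : (0:ℝ) < (x + v) / x)]
      have h5 : 1 ≤ (x + v) / x := by rw [le_div_iff₀ hx0]; linarith
      have h6 : |n - v| - 1 ≤ |x - v| := by
        have : |n - x| ≤ 1 := by rw [abs_le]; constructor <;> linarith [hx.1, hx.2, hy.2]
        have := abs_sub_le n x v
        linarith
      have h7 : (1 + |n - v|) / 2 ≤ |x - v| := by linarith
      have h8 : |x - v| ≤ |x - v| * ((x + v) / x) := le_mul_of_one_le_right (abs_nonneg _) h5
      nlinarith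

theorem norm_sub_le_of_hasDerivAt_add {f E B : ℝ → ℂ} {a b C : ℝ} (ha : 0 < a) (hab : a ≤ b)
    (hf : ∀ x ∈ Set.Icc a b, HasDerivAt f (E x + B x) x) (hB : ContinuousOn B (Set.Ioi 0))
    (hE : ∀ x ∈ Set.Icc a b, ‖E x‖ ≤ C) :
    ‖f b - f a‖ ≤ C * (b - a) + ‖∫ x in a..b, B x‖ := by
  have hd : ∀ x ∈ Set.Icc a b, HasDerivWithinAt (fun x => f x - ∫ y in a..x, B y) (E x)
      (Set.Icc a b) x := by
    intro x hx
    have hx0 : 0 < x := ha.trans_le hx.1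
    have h1 : HasDerivAt (fun x => ∫ y in a..x, B y) (B x) x := by
      apply intervalIntegral.integral_hasDerivAt_right
      · apply ContinuousOn.intervalIntegrable
        rw [Set.uIcc_of_le hx.1]
        exact hB.mono fun y hy => ha.trans_le hy.1
      · exact hB.stronglyMeasurableAtFilter isOpen_Ioi x hx0
      · exact hB.continuousAt (isOpen_Ioi.mem_nhds hx0)
    refine (((hf x hx).sub h1).congr_deriv ?_).hasDerivWithinAt
    ring
  have := (convex_Icc a b).norm_image_sub_le_of_norm_hasDerivWithin_le hd hE
    (Set.left_mem_Icc.2 hab) (Set.right_mem_Icc.2 hab)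
  rw [intervalIntegral.integral_same, sub_zero, Real.norm_eq_abs,
    abs_of_nonneg (sub_nonneg.2 hab)] at this
  have e : f b - f a = (f b - (∫ y in a..b, B y) - f a) + ∫ y in a..b, B y := by ring
  rw [e]
  exact (norm_add_le _ _).trans (add_le_add_left this _)

theorem norm_integral_sqrt_mul_le {n τ v c K : ℝ} {k k' : ℝ → ℝ} (hn : 1 ≤ n) (hv : 0 ≤ v)
    (hτ : τ = 2 * Real.pi * v ^ 2)
    (hk : ∀ u > 0, HasDerivAt k (k' u) u) (hk' : ContinuousOn k' (Set.Ioi 0))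
    (hτ0 : 0 < τ) (hle : ∀ x ∈ Set.Icc n (n + 1), τ / (2 * Real.pi * x ^ 2) ≤ 4)
    (hK : ∀ x ∈ Set.Icc n (n + 1), |k (τ / (2 * Real.pi * x ^ 2))| ≤ K)
    (hK' : ∀ x ∈ Set.Icc n (n + 1), |k' (τ / (2 * Real.pi * x ^ 2))| ≤ K) :
    ‖∫ x in n..(n + 1), ((√x * k (τ / (2 * Real.pi * x ^ 2)) : ℝ) : ℂ) *
      Complex.exp (Complex.I * ((c - τ * Real.log x + Real.pi * x ^ 2 : ℝ) : ℂ))‖ ≤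
      40 * K * √(n + 1) / (1 + |n - v|) := by
  have hpi := Real.pi_pos
  have hK0 : 0 ≤ K := (abs_nonneg _).trans (hK n ⟨le_rfl, by linarith⟩)
  have hpos : ∀ x ∈ Set.Icc n (n + 1), 1 ≤ x := fun x hx => hn.trans hx.1
  have hs1 : 1 ≤ √(n + 1) := by rw [Real.one_le_sqrt]; linarith
  have hu : ∀ x : ℝ, 0 < x → HasDerivAt (fun x : ℝ => τ / (2 * Real.pi * x ^ 2))
      (τ / (2 * Real.pi * x ^ 2) * (-2 / x)) x := by
    intro x hx
    have h1 := ((hasDerivAt_pow 2 x).const_mul (2 * Real.pi))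
    refine ((hasDerivAt_const x τ).div h1 (by positivity)).congr_deriv ?_
    field_simp
    ring
  have hfc : ContinuousOn (fun x : ℝ => Complex.exp (Complex.I *
      ((c - τ * Real.log x + Real.pi * x ^ 2 : ℝ) : ℂ))) (Set.Ioi 0) := by
    have : ContinuousOn (fun x : ℝ => c - τ * Real.log x + Real.pi * x ^ 2) (Set.Ioi 0) :=
      fun x hx => (hasDerivAt_phase_right hx c τ).continuousAt.continuousWithinAt
    exact (continuousOn_const.mul (Complex.continuous_ofReal.comp_continuousOn this)).cexp
  have hcu : ContinuousOn (fun x : ℝ => τ / (2 * Real.pi * x ^ 2)) (Set.Icc n (n + 1)) :=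
    fun x hx => (hu x (by linarith [hpos x hx])).continuousAt.continuousWithinAt
  have hmaps : Set.MapsTo (fun x : ℝ => τ / (2 * Real.pi * x ^ 2)) (Set.Icc n (n + 1))
      (Set.Ioi 0) := fun x hx => by
    have := hpos x hx
    show 0 < τ / (2 * Real.pi * x ^ 2)
    positivity
  have hkc : ContinuousOn k (Set.Ioi 0) := fun u hu => (hk u hu).continuousAt.continuousWithinAt
  refine (norm_integral_weight_mul_le (a := n) (b := n + 1) (W := √(n + 1) * K) (W' := 9 * K)
    (M := 4 / (1 + |n - v|))
    (w' := fun x => 1 / (2 * √x) * k (τ / (2 * Real.pi * x ^ 2)) +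
      √x * (k' (τ / (2 * Real.pi * x ^ 2)) * (τ / (2 * Real.pi * x ^ 2) * (-2 / x))))
    (by linarith) (by linarith) (fun x hx => ?_) ?_ hfc (fun x hx => ?_) (fun x hx => ?_)
    (fun y hy => norm_integral_unit_phase_le (by linarith) hv hτ hy)).trans ?_
  · have hx0 : 0 < x := by linarith [hpos x hx]
    exact (Real.hasDerivAt_sqrt hx0.ne').mul ((hk _ (by positivity)).comp x (hu x hx0))
  · have hid : ∀ x ∈ Set.Icc n (n + 1), x ≠ 0 := fun x hx => by linarith [hpos x hx]
    refine ContinuousOn.add ?_ ?_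
    · refine ContinuousOn.mul ?_ (hkc.comp hcu hmaps)
      refine continuousOn_const.div (by fun_prop) fun x hx => ?_
      have := hpos x hx
      positivity
    · refine ContinuousOn.mul (by fun_prop) ((hk'.comp hcu hmaps).mul (hcu.mul ?_))
      exact continuousOn_const.div continuousOn_id hid
  · rw [abs_mul, abs_of_nonneg (Real.sqrt_nonneg _)]
    exact mul_le_mul (Real.sqrt_le_sqrt hx.2) (hK x hx) (abs_nonneg _) (Real.sqrt_nonneg _)
  · have hx1 := hpos x hx
    have hx0 : 0 < x := by linarith
    have hsx : 1 ≤ √x := by rw [Real.one_le_sqrt]; exact hx1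
    have h1 : |1 / (2 * √x) * k (τ / (2 * Real.pi * x ^ 2))| ≤ 1 * K := by
      rw [abs_mul, abs_of_pos (by positivity)]
      refine mul_le_mul ?_ (hK x hx) (abs_nonneg _) zero_le_one
      rw [div_le_one (by positivity)]; linarith
    have h2 : |√x * (k' (τ / (2 * Real.pi * x ^ 2)) * (τ / (2 * Real.pi * x ^ 2) * (-2 / x)))| ≤
        8 * K := by
      have e : √x * (k' (τ / (2 * Real.pi * x ^ 2)) * (τ / (2 * Real.pi * x ^ 2) * (-2 / x))) =
          -(2 * (√x / x)) * (k' (τ / (2 * Real.pi * x ^ 2)) * (τ / (2 * Real.pi * x ^ 2))) := by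
        ring
      rw [e, abs_mul, abs_neg, abs_mul (k' _), abs_of_pos (by positivity),
        abs_of_pos (by positivity : 0 < τ / (2 * Real.pi * x ^ 2))]
      have h3 : √x / x ≤ 1 := by
        rw [div_le_one hx0, Real.sqrt_le_iff]; constructor <;> nlinarith
      calc 2 * (√x / x) * (|k' (τ / (2 * Real.pi * x ^ 2))| * (τ / (2 * Real.pi * x ^ 2)))
          ≤ 2 * 1 * (K * 4) := by
            gcongr
            · exact hK' x hx
            · exact hle x hx
        _ = 8 * K := by ring
    calc _ ≤ _ := abs_add_le _ _
      _ ≤ 1 * K + 8 * K := add_le_add h1 h2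
      _ = 9 * K := by ring
  · have h4 : 0 < 1 + |n - v| := by positivity
    rw [mul_div_assoc', div_le_div_iff_of_pos_right h4]
    nlinarith [mul_nonneg hK0 (sub_nonneg.2 hs1)]

theorem rpow_neg_mul_rpow_two_pi {α x : ℝ} (hx : 0 < x) :
    x ^ (-(2 * α + 1 / 2)) * (4 * Real.pi * x * (2 * Real.pi * x ^ 2) ^ α) =
      4 * Real.pi * (2 * Real.pi) ^ α * √x := by
  have hpi := Real.pi_pos
  rw [Real.mul_rpow (by positivity) (by positivity), Real.sqrt_eq_rpow,
    ← Real.rpow_natCast x 2, ← Real.rpow_mul hx.le]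
  have : x ^ (1 / 2 : ℝ) = x ^ (-(2 * α + 1 / 2)) * (x ^ (1 : ℝ) * x ^ (((2 : ℕ) : ℝ) * α)) := by
    rw [← Real.rpow_add hx, ← Real.rpow_add hx]; congr 1; push_cast; ring
  rw [this, Real.rpow_one]; ring

theorem hasDerivAt_rpow_mul_saddleIntegral {α T x : ℝ} {k k' k'' : ℝ → ℝ} (h0 : 0 ≤ α)
    (hT : 0 < T) (hx : 0 < x)
    (hk : ∀ u > 0, HasDerivAt k (k' u) u) (hk' : ∀ u > 0, HasDerivAt k' (k'' u) u)
    (hkl : ∀ u > 0, k u * Real.log u = u ^ α * (u - 1)) :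
    HasDerivAt (fun x => ((x ^ (-(2 * α + 1 / 2)) : ℝ) : ℂ) * saddleIntegral α T x)
      (((((-(2 * α + 1 / 2)) * x ^ (-(2 * α + 1 / 2) - 1) : ℝ) : ℂ) * saddleIntegral α T x +
        ((4 * Real.pi * (2 * Real.pi) ^ α * √x / (2 * Real.pi * x ^ 2) : ℝ) : ℂ) *
        ∫ t in T..(2 * T), (k' (t / (2 * Real.pi * x ^ 2)) : ℂ) * Complex.exp (Complex.I *
          ((thetaMain t - t * Real.log x + Real.pi * x ^ 2 : ℝ) : ℂ))) +
      ((-(4 * Real.pi * (2 * Real.pi) ^ α) : ℝ) : ℂ) *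
        (((√x * k (2 * T / (2 * Real.pi * x ^ 2)) : ℝ) : ℂ) * Complex.exp (Complex.I *
          ((thetaMain (2 * T) - 2 * T * Real.log x + Real.pi * x ^ 2 : ℝ) : ℂ)) -
        ((√x * k (T / (2 * Real.pi * x ^ 2)) : ℝ) : ℂ) * Complex.exp (Complex.I *
          ((thetaMain T - T * Real.log x + Real.pi * x ^ 2 : ℝ) : ℂ)))) x := by
  have h1 := (Real.hasDerivAt_rpow_const (p := -(2 * α + 1 / 2)) (Or.inl hx.ne')).ofReal_comp
  have h2 := hasDerivAt_saddleIntegral (α := α) hT hx h0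
  refine (h1.mul h2).congr_deriv ?_
  have h3 := integral_deriv_eq hT hx hk hk' hkl _ rfl _ rfl
  beta_reduce at h3
  rw [h3]
  have h4 : ((x ^ (-(2 * α + 1 / 2)) : ℝ) : ℂ) *
      ((-4 * Real.pi * x * (2 * Real.pi * x ^ 2) ^ α : ℝ) : ℂ) =
      -((4 * Real.pi * (2 * Real.pi) ^ α * √x : ℝ) : ℂ) := by
    rw [← rpow_neg_mul_rpow_two_pi hx]; push_cast; ring
  rw [add_assoc, ← mul_assoc ((x ^ (-(2 * α + 1 / 2)) : ℝ) : ℂ), h4]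
  push_cast
  ring

theorem exists_norm_sub_saddleIntegral_le {α : ℝ} (h0 : 0 ≤ α) (h1 : α ≤ 1) :
    ∃ C > 0, ∀ T ≥ (1 : ℝ), ∀ n ≥ (1 : ℝ), T ≤ 4 * Real.pi * n ^ 2 → (n + 1) ^ 2 ≤ 4 * T →
      ‖(((n + 1) ^ (-(2 * α + 1 / 2)) : ℝ) : ℂ) * saddleIntegral α T (n + 1) -
        ((n ^ (-(2 * α + 1 / 2)) : ℝ) : ℂ) * saddleIntegral α T n‖ ≤
      C * (T ^ (-(1 / 4) : ℝ) + T ^ (1 / 4 : ℝ) * (1 / (1 + |n - √(2 * T / (2 * Real.pi))|) +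
        1 / (1 + |n - √(T / (2 * Real.pi))|))) := by
  have hpi := Real.pi_pos
  have hpi3 := Real.pi_gt_three
  have hpi4 := Real.pi_lt_four
  obtain ⟨k, k', k'', hk, hk', hk'', hkl⟩ := exists_smooth_quotient_log α
  have hsub : Set.Icc (1 / 32 : ℝ) 4 ⊆ Set.Ioi 0 := fun u hu => by
    have := hu.1; show 0 < u; linarith
  have hkc : ContinuousOn k (Set.Ioi 0) := fun u hu => (hk u hu).continuousAt.continuousWithinAt
  have hkc' : ContinuousOn k' (Set.Ioi 0) :=
    fun u hu => (hk' u hu).continuousAt.continuousWithinAt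
  obtain ⟨K1, hK1⟩ := isCompact_Icc.exists_bound_of_continuousOn (hkc.mono hsub)
  obtain ⟨K2, hK2⟩ := isCompact_Icc.exists_bound_of_continuousOn (hkc'.mono hsub)
  obtain ⟨K3, hK3⟩ := isCompact_Icc.exists_bound_of_continuousOn (hk''.mono hsub)
  set K := |K1| + |K2| + |K3| with hKdef
  have hb1 : ∀ u ∈ Set.Icc (1 / 32 : ℝ) 4, |k u| ≤ K := fun u hu =>
    (hK1 u hu).trans (by linarith [le_abs_self K1, abs_nonneg K2, abs_nonneg K3])
  have hb2 : ∀ u ∈ Set.Icc (1 / 32 : ℝ) 4, |k' u| ≤ K := fun u hu =>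
    (hK2 u hu).trans (by linarith [le_abs_self K2, abs_nonneg K1, abs_nonneg K3])
  have hb3 : ∀ u ∈ Set.Icc (1 / 32 : ℝ) 4, |k'' u| ≤ K := fun u hu =>
    (hK3 u hu).trans (by linarith [le_abs_self K3, abs_nonneg K2, abs_nonneg K1])
  have hK0 : 0 ≤ K := by positivity
  set G := 4 * Real.pi * (2 * Real.pi) ^ α with hG
  have hG0 : 0 < G := by positivity
  set c := 2 * α + 1 / 2 with hc
  have hc0 : 0 < c := by positivity
  set C1 := c * (4 * Real.pi) ^ ((c + 1) / 2) * 60 + G * 2 * 2 * (60 * K) with hC1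
  set C2 := G * (40 * K * 2) with hC2
  refine ⟨C1 + C2, by positivity, fun T hT n hn hn1 hn2 => ?_⟩
  have hT0 : 0 < T := by linarith
  have hn0 : 0 < n := by linarith
  have hpos : ∀ x ∈ Set.Icc n (n + 1), 0 < x := fun x hx => hn0.trans_le hx.1
  have hkap : ∀ x ∈ Set.Icc n (n + 1), T / 2 ≤ 2 * Real.pi * x ^ 2 ∧
      2 * Real.pi * x ^ 2 ≤ 32 * T := by
    intro x hx
    have h2 : n ^ 2 ≤ x ^ 2 := by have := hx.1; gcongr
    have h3 : x ^ 2 ≤ (n + 1) ^ 2 := by have := hx.2; have := hpos x hx; gcongr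
    constructor
    · nlinarith
    · nlinarith
  have hu : ∀ x ∈ Set.Icc n (n + 1), ∀ t ∈ Set.Icc T (2 * T),
      t / (2 * Real.pi * x ^ 2) ∈ Set.Icc (1 / 32 : ℝ) 4 := by
    intro x hx t ht
    obtain ⟨h2, h3⟩ := hkap x hx
    have hx0 := hpos x hx
    constructor
    · rw [le_div_iff₀ (by positivity)]; linarith [ht.1]
    · rw [div_le_iff₀ (by positivity)]; linarith [ht.2]
  -- sizes of square roots
  have hq : √(2 * √T) ≤ 2 * T ^ (1 / 4 : ℝ) := by
    rw [Real.sqrt_mul (by norm_num), Real.sqrt_eq_rpow (√T), Real.sqrt_eq_rpow T,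
      ← Real.rpow_mul hT0.le]
    norm_num
    gcongr
    rw [Real.sqrt_le_iff]; norm_num
  have hsn : n + 1 ≤ 2 * √T := by
    have : (2 * √T) ^ 2 = 4 * T := by rw [mul_pow, Real.sq_sqrt hT0.le]; norm_num
    exact le_of_sq_le_sq (by rw [this]; exact hn2) (by positivity)
  have hsx : ∀ x ≤ n + 1, √x ≤ 2 * T ^ (1 / 4 : ℝ) := fun x hx =>
    (Real.sqrt_le_sqrt (hx.trans hsn)).trans hq
  have hcphase : ∀ τ c' : ℝ, ContinuousOn (fun x : ℝ => Complex.exp (Complex.I *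
      ((c' - τ * Real.log x + Real.pi * x ^ 2 : ℝ) : ℂ))) (Set.Ioi 0) := by
    intro τ c'
    have : ContinuousOn (fun x : ℝ => c' - τ * Real.log x + Real.pi * x ^ 2) (Set.Ioi 0) :=
      fun x hx => (hasDerivAt_phase_right hx c' τ).continuousAt.continuousWithinAt
    exact (continuousOn_const.mul (Complex.continuous_ofReal.comp_continuousOn this)).cexp
  have hcw : ∀ τ > 0, ContinuousOn (fun x : ℝ =>
      ((√x * k (τ / (2 * Real.pi * x ^ 2)) : ℝ) : ℂ)) (Set.Ioi 0) := by
    intro τ hτ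
    refine Complex.continuous_ofReal.comp_continuousOn ?_
    refine (Real.continuous_sqrt.continuousOn).mul (hkc.comp ?_ ?_)
    · refine continuousOn_const.div (by fun_prop) fun x hx => ?_
      have : 0 < x := hx
      positivity
    · intro x hx
      have : 0 < x := hx
      show 0 < τ / (2 * Real.pi * x ^ 2)
      positivity
  have hcB : ∀ τ > 0, ∀ c', ContinuousOn (fun x : ℝ =>
      ((√x * k (τ / (2 * Real.pi * x ^ 2)) : ℝ) : ℂ) * Complex.exp (Complex.I *
      ((c' - τ * Real.log x + Real.pi * x ^ 2 : ℝ) : ℂ))) (Set.Ioi 0) :=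
    fun τ hτ c' => (hcw τ hτ).mul (hcphase τ c')
  have hIcc : Set.uIcc n (n + 1) ⊆ Set.Ioi 0 := by
    rw [Set.uIcc_of_le (by linarith)]; exact hpos
  have hbd : ∀ τ ∈ Set.Icc T (2 * T), ∀ c', ‖∫ x in n..(n + 1),
      ((√x * k (τ / (2 * Real.pi * x ^ 2)) : ℝ) : ℂ) * Complex.exp (Complex.I *
      ((c' - τ * Real.log x + Real.pi * x ^ 2 : ℝ) : ℂ))‖ ≤
      40 * K * (2 * T ^ (1 / 4 : ℝ)) * (1 / (1 + |n - √(τ / (2 * Real.pi))|)) := by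
    intro τ hτ c'
    have hτ0 : 0 < τ := hT0.trans_le hτ.1
    have h2 := norm_integral_sqrt_mul_le (c := c') (K := K) hn
      (Real.sqrt_nonneg (τ / (2 * Real.pi)))
      (by rw [Real.sq_sqrt (by positivity)]; field_simp) hk hkc' hτ0
      (fun x hx => (hu x hx τ hτ).2) (fun x hx => hb1 _ (hu x hx τ hτ))
      (fun x hx => hb2 _ (hu x hx τ hτ))
    refine h2.trans ?_
    rw [mul_one_div]
    gcongr
    exact hsx _ le_rfl
  refine (norm_sub_le_of_hasDerivAt_add (C := C1 * T ^ (-(1 / 4) : ℝ)) hn0 (by linarith : n ≤ n + 1)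
    (fun x hx => hasDerivAt_rpow_mul_saddleIntegral h0 hT0 (hpos x hx) hk hk' hkl)
    (continuousOn_const.mul ((hcB _ (by positivity) _).sub (hcB _ hT0 _)))
    (fun x hx => ?_)).trans ?_
  · have hx0 := hpos x hx
    have hkx := (hkap x hx).1
    have hkx0 : 0 < 2 * Real.pi * x ^ 2 := by positivity
    have hJ : ‖∫ t in T..(2 * T), (k' (t / (2 * Real.pi * x ^ 2)) : ℂ) * Complex.exp (Complex.I *
        ((thetaMain t - t * Real.log x + Real.pi * x ^ 2 : ℝ) : ℂ))‖ ≤ 60 * K * √T := by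
      refine (norm_integral_weight_mul_le (W := K) (W' := K * (2 / T)) (M := 20 * √T)
        (w' := fun t => k'' (t / (2 * Real.pi * x ^ 2)) * (1 / (2 * Real.pi * x ^ 2)))
        hT0 (by linarith) (fun t ht => ?_) ?_ (continuousOn_phase _ _) (fun t ht => ?_)
        (fun t ht => ?_) (fun y hy => norm_integral_phase_le hT0 hy _ _)).trans (le_of_eq ?_)
      · have ht0 : 0 < t := hT0.trans_le ht.1
        exact (hk' _ (by positivity)).comp t ((hasDerivAt_id t).div_const _)
      · refine ContinuousOn.mul (hk''.comp (by fun_prop) fun t ht => ?_) continuousOn_const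
        have ht0 : 0 < t := hT0.trans_le ht.1
        show 0 < t / (2 * Real.pi * x ^ 2)
        positivity
      · exact hb2 _ (hu x hx t ht)
      · rw [abs_mul, abs_of_pos (by positivity : 0 < 1 / (2 * Real.pi * x ^ 2))]
        refine mul_le_mul (hb3 _ (hu x hx t ht)) ?_ (by positivity) hK0
        rw [div_le_div_iff₀ hkx0 hT0]; linarith
      · field_simp; ring
    have hA := norm_saddleIntegral_le (x := x) hT0 h0 h1
    refine (norm_add_le _ _).trans ?_
    rw [norm_mul, norm_mul, Complex.norm_real, Complex.norm_real, Real.norm_eq_abs,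
      Real.norm_eq_abs, abs_mul, abs_neg, abs_of_pos hc0,
      abs_of_pos (by positivity : 0 < x ^ (-c - 1)), abs_of_pos (by positivity)]
    have e1 : x ^ (-c - 1) ≤ (4 * Real.pi) ^ ((c + 1) / 2) * T ^ (-((c + 1) / 2)) := by
      have h2 : T / (4 * Real.pi) ≤ x ^ 2 := by
        rw [div_le_iff₀ (by positivity)]; linarith
      have h3 : x ^ (-c - 1) = (x ^ 2) ^ (-((c + 1) / 2)) := by
        rw [← Real.rpow_natCast, ← Real.rpow_mul hx0.le]; congr 1; push_cast; ring
      rw [h3]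
      refine (Real.rpow_le_rpow_of_nonpos (by positivity) h2 (by linarith)).trans (le_of_eq ?_)
      rw [Real.div_rpow hT0.le (by positivity), Real.rpow_neg (x := 4 * Real.pi) (by positivity)]
      field_simp
    have e2 : T ^ (-((c + 1) / 2)) * (T ^ α * √T) = T ^ (-(1 / 4) : ℝ) := by
      rw [Real.sqrt_eq_rpow, ← Real.rpow_add hT0, ← Real.rpow_add hT0]; congr 1; rw [hc]; ring
    have e3 : T ^ (1 / 4 : ℝ) * √T / T = T ^ (-(1 / 4) : ℝ) := by
      rw [Real.sqrt_eq_rpow, ← Real.rpow_add hT0, ← Real.rpow_sub_one hT0.ne']; norm_num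
    calc _ ≤ c * ((4 * Real.pi) ^ ((c + 1) / 2) * T ^ (-((c + 1) / 2))) * (60 * T ^ α * √T) +
          G * (2 * T ^ (1 / 4 : ℝ)) / (T / 2) * (60 * K * √T) := by
          gcongr
          exact hsx x hx.2
      _ = c * (4 * Real.pi) ^ ((c + 1) / 2) * 60 * (T ^ (-((c + 1) / 2)) * (T ^ α * √T)) +
          G * 2 * 2 * (60 * K) * (T ^ (1 / 4 : ℝ) * √T / T) := by
          field_simp
      _ = _ := by rw [e2, e3, hC1]; ring
  · rw [intervalIntegral.integral_const_mul, norm_mul, Complex.norm_real, Real.norm_eq_abs, abs_neg,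
      abs_of_pos hG0, intervalIntegral.integral_sub
        ((hcB _ (by positivity) _).mono hIcc).intervalIntegrable
        ((hcB _ hT0 _).mono hIcc).intervalIntegrable]
    have hA := hbd (2 * T) ⟨by linarith, le_rfl⟩ (thetaMain (2 * T))
    have hB := hbd T ⟨le_rfl, by linarith⟩ (thetaMain T)
    have hsum := (norm_sub_le _ _).trans (add_le_add hA hB)
    have hC1p : 0 ≤ C1 := by positivity
    have hC2p : 0 ≤ C2 := by positivity
    have hT4 : 0 ≤ T ^ (-(1 / 4) : ℝ) := by positivity
    set R := T ^ (1 / 4 : ℝ) * (1 / (1 + |n - √(2 * T / (2 * Real.pi))|) +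
        1 / (1 + |n - √(T / (2 * Real.pi))|)) with hR
    have hR0 : 0 ≤ R := by positivity
    calc _ ≤ C1 * T ^ (-(1 / 4) : ℝ) * (n + 1 - n) + G * _ :=
          add_le_add le_rfl (mul_le_mul_of_nonneg_left hsum hG0.le)
      _ = C1 * T ^ (-(1 / 4) : ℝ) + C2 * R := by rw [hC2, hR]; ring
      _ ≤ _ := by nlinarith [mul_nonneg hC1p hR0, mul_nonneg hC2p hT4]

theorem two_mul_sum_neg_one_pow_mul (a : ℕ → ℂ) {m M : ℕ} (h : m ≤ M) :
    2 * ∑ n ∈ Finset.Ico m M, (-1) ^ n * a n =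
      ∑ n ∈ Finset.Ico m M, (-1) ^ n * (a n - a (n + 1)) + (-1) ^ m * a m - (-1) ^ M * a M := by
  induction M, h using Nat.le_induction with
  | base => simp
  | succ k hk ih =>
    rw [Finset.sum_Ico_succ_top hk, Finset.sum_Ico_succ_top hk, mul_add, ih]
    ring

theorem norm_sum_neg_one_pow_mul_le {a : ℕ → ℂ} {d : ℕ → ℝ} {B : ℝ} {m M : ℕ} (h : m ≤ M)
    (hd : ∀ n ∈ Finset.Ico m M, ‖a (n + 1) - a n‖ ≤ d n) (hm : ‖a m‖ ≤ B) (hM : ‖a M‖ ≤ B) :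
    ‖∑ n ∈ Finset.Ico m M, (-1) ^ n * a n‖ ≤ ∑ n ∈ Finset.Ico m M, d n + 2 * B := by
  have h1 : ‖∑ n ∈ Finset.Ico m M, (-1) ^ n * (a n - a (n + 1))‖ ≤ ∑ n ∈ Finset.Ico m M, d n := by
    refine (norm_sum_le _ _).trans (Finset.sum_le_sum fun n hn => ?_)
    rw [norm_mul, norm_pow, norm_neg, norm_one, one_pow, one_mul, norm_sub_rev]
    exact hd n hn
  have h2 : ‖(2 : ℂ) * ∑ n ∈ Finset.Ico m M, (-1) ^ n * a n‖ ≤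
      ∑ n ∈ Finset.Ico m M, d n + 2 * B := by
    rw [two_mul_sum_neg_one_pow_mul a h]
    refine (norm_sub_le _ _).trans ?_
    have h3 := norm_add_le (∑ n ∈ Finset.Ico m M, (-1) ^ n * (a n - a (n + 1))) ((-1) ^ m * a m)
    simp only [norm_mul ((-1 : ℂ) ^ _), norm_pow, norm_neg, norm_one, one_pow, one_mul] at h3 ⊢
    linarith
  refine le_trans ?_ h2
  rw [norm_mul, Complex.norm_ofNat]
  linarith [norm_nonneg (∑ n ∈ Finset.Ico m M, (-1) ^ n * a n)]

theorem sum_inv_one_add_abs_sub_le {v : ℝ} (hv : 0 ≤ v) (M : ℕ) {X : ℝ} (hM : (M : ℝ) ≤ X)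
    (hvX : v + 1 ≤ X) :
    ∑ n ∈ Finset.range M, 1 / (1 + |(n : ℝ) - v|) ≤ 2 * (1 + Real.log X) := by
  set j := ⌊v⌋₊ with hj
  have hj1 : (j : ℝ) ≤ v := Nat.floor_le hv
  have hj2 : v < j + 1 := Nat.lt_floor_add_one v
  have hX : 1 ≤ X := by linarith
  have hharm : ∀ N : ℕ, (N : ℝ) ≤ X → ∑ i ∈ Finset.range N, 1 / (1 + (i : ℝ)) ≤ 1 + Real.log X := by
    intro N hN
    have h1 : ∑ i ∈ Finset.range N, 1 / (1 + (i : ℝ)) = ((harmonic N : ℚ) : ℝ) := by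
      rw [harmonic]; push_cast
      exact Finset.sum_congr rfl fun i _ => by rw [one_div, add_comm]
    rw [h1]
    refine (harmonic_le_one_add_log N).trans ?_
    rcases Nat.eq_zero_or_pos N with h0 | h0
    · subst h0; simp [Real.log_nonneg hX]
    · have : (0 : ℝ) < N := by exact_mod_cast h0
      gcongr
  calc ∑ n ∈ Finset.range M, 1 / (1 + |(n : ℝ) - v|)
      ≤ ∑ n ∈ Finset.range (j + 1 + M), 1 / (1 + |(n : ℝ) - v|) :=
        Finset.sum_le_sum_of_subset_of_nonneg (Finset.range_mono (by omega))
          fun n _ _ => by positivity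
    _ = ∑ i ∈ Finset.range (j + 1), 1 / (1 + |((j + 1 - 1 - i : ℕ) : ℝ) - v|) +
        ∑ i ∈ Finset.range M, 1 / (1 + |((j + 1 + i : ℕ) : ℝ) - v|) := by
        rw [Finset.sum_range_add, Finset.sum_range_reflect
          (fun n : ℕ => 1 / (1 + |(n : ℝ) - v|)) (j + 1)]
    _ ≤ ∑ i ∈ Finset.range (j + 1), 1 / (1 + (i : ℝ)) +
        ∑ i ∈ Finset.range M, 1 / (1 + (i : ℝ)) := by
        refine add_le_add (Finset.sum_le_sum fun i hi => ?_) (Finset.sum_le_sum fun i hi => ?_)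
        · have hi' : i ≤ j := by have := Finset.mem_range.1 hi; omega
          have : (((j + 1 - 1 - i : ℕ) : ℝ)) = j - i := by
            rw [Nat.add_sub_cancel, Nat.cast_sub hi']
          rw [this]
          gcongr
          rw [abs_sub_comm]
          exact le_trans (by linarith) (le_abs_self _)
        · gcongr
          push_cast
          exact le_trans (by linarith) (le_abs_self _)
    _ ≤ (1 + Real.log X) + (1 + Real.log X) :=
        add_le_add (hharm _ (by push_cast; linarith)) (hharm _ hM)
    _ = _ := by ring

theorem saddleIntegral_natCast (α T : ℝ) (n : ℕ) :
    saddleIntegral α T n = (-1) ^ n * ∫ t in T..(2 * T), ((t ^ α : ℝ) : ℂ) *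
      Complex.exp (Complex.I * ((thetaMain t - t * Real.log n : ℝ) : ℂ)) := by
  have h1 : Complex.exp (Complex.I * ((Real.pi * (n : ℝ) ^ 2 : ℝ) : ℂ)) = (-1) ^ n := by
    have : Complex.I * ((Real.pi * (n : ℝ) ^ 2 : ℝ) : ℂ) =
        ((n ^ 2 : ℕ) : ℂ) * (Real.pi * Complex.I) := by push_cast; ring
    rw [this, Complex.exp_nat_mul, Complex.exp_pi_mul_I]
    rcases Nat.even_or_odd n with h | h
    · rw [h.neg_one_pow, (h.pow_of_ne_zero two_ne_zero).neg_one_pow]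
    · rw [h.neg_one_pow, h.pow.neg_one_pow]
  rw [saddleIntegral, ← intervalIntegral.integral_const_mul]
  apply intervalIntegral.integral_congr
  intro t _
  beta_reduce
  rw [← h1, show ((thetaMain t - t * Real.log n + Real.pi * (n : ℝ) ^ 2 : ℝ) : ℂ) =
    ((thetaMain t - t * Real.log n : ℝ) : ℂ) + ((Real.pi * (n : ℝ) ^ 2 : ℝ) : ℂ) by push_cast; rfl,
    mul_add, Complex.exp_add]
  ring

/-- The oscillatory sums arising from the approximate saddle points, bounded uniformly. -/
theorem exists_norm_sum_integral_le {α : ℝ} (h0 : 1 / 4 < α) (h1 : α ≤ 1) :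
    ∃ C > 0, ∀ T ≥ (1 : ℝ), ∀ N : ℕ,
      ‖∑ n ∈ Finset.Icc 1 N, (((n : ℝ) ^ (-(2 * α + 1 / 2)) : ℝ) : ℂ) *
        ∫ t in T..(2 * T), ((t ^ α : ℝ) : ℂ) *
          Complex.exp (Complex.I * ((thetaMain t - t * Real.log n : ℝ) : ℂ))‖ ≤
      C * T ^ α * (1 + Real.log T) := by
  have hpi := Real.pi_pos
  have hpi3 := Real.pi_gt_three
  have hpi4 := Real.pi_lt_four
  obtain ⟨C0, hC0, hdiff⟩ := exists_norm_sub_saddleIntegral_le (α := α) (by linarith) h1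
  set c := 2 * α + 1 / 2 with hc
  have hsum : Summable fun n : ℕ => (n : ℝ) ^ (-c) := Real.summable_nat_rpow.2 (by linarith)
  set S := ∑' n : ℕ, (n : ℝ) ^ (-c) with hS
  have hS0 : 0 ≤ S := tsum_nonneg fun n => by positivity
  set B := (4 * Real.pi) ^ (c / 2) * 60 with hB
  refine ⟨48 * S + (20 * C0 + 2 * B), by positivity, fun T hT N => ?_⟩
  have hT0 : 0 < T := by linarith
  have hsq : √T ^ 2 = T := Real.sq_sqrt hT0.le
  have hs1 : 1 ≤ √T := by rw [Real.one_le_sqrt]; exact hT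
  have hlog : 0 ≤ Real.log T := Real.log_nonneg hT
  set F : ℕ → ℂ := fun n => ∫ t in T..(2 * T), ((t ^ α : ℝ) : ℂ) *
          Complex.exp (Complex.I * ((thetaMain t - t * Real.log n : ℝ) : ℂ)) with hF
  set G : ℕ → ℂ := fun n => (((n : ℝ) ^ (-c) : ℝ) : ℂ) * F n with hG
  set a : ℕ → ℂ := fun n => (((n : ℝ) ^ (-c) : ℝ) : ℂ) * saddleIntegral α T n with ha
  have hGa : ∀ n, G n = (-1) ^ n * a n := by
    intro n
    simp only [hG, ha, hF, saddleIntegral_natCast]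
    have : ((-1 : ℂ) ^ n) * (-1) ^ n = 1 := by rw [← mul_pow]; norm_num
    rw [mul_left_comm ((-1 : ℂ) ^ n), ← mul_assoc ((-1 : ℂ) ^ n), this, one_mul]
  set P : ℕ → Prop := fun n => T ≤ 4 * Real.pi * (n : ℝ) ^ 2 ∧ ((n : ℝ) + 1) ^ 2 ≤ 4 * T with hP
  classical
  have hfar : ‖∑ n ∈ (Finset.Icc 1 N).filter (fun n => ¬ P n), G n‖ ≤ 48 * S * T ^ α := by
    refine (norm_sum_le _ _).trans ?_
    have hb : ∀ n ∈ (Finset.Icc 1 N).filter (fun n => ¬ P n),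
        ‖G n‖ ≤ (n : ℝ) ^ (-c) * (48 * T ^ α) := by
      intro n hn
      rw [Finset.mem_filter, Finset.mem_Icc] at hn
      have hn1 : (1 : ℝ) ≤ n := by exact_mod_cast hn.1.1
      have hn0 : (0 : ℝ) < n := by linarith
      rw [hG, norm_mul, Complex.norm_real, Real.norm_eq_abs, abs_of_nonneg (by positivity)]
      gcongr
      have hl2 : (0.5 : ℝ) ≤ Real.log 2 := by linarith [Real.log_two_gt_d9]
      have hm : ∀ t ∈ Set.Icc T (2 * T), (1 / 4 : ℝ) ≤
          |Real.log (t / (2 * Real.pi)) / 2 - Real.log n| := by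
        intro t ht
        have ht0 : 0 < t := hT0.trans_le ht.1
        have e : Real.log (t / (2 * Real.pi)) / 2 - Real.log n =
            Real.log (t / (2 * Real.pi * n ^ 2)) / 2 := by
          have e0 : t / (2 * Real.pi * n ^ 2) = t / (2 * Real.pi) / n ^ 2 := by rw [div_div]
          rw [e0, Real.log_div (x := t / (2 * Real.pi)) (by positivity) (by positivity),
            Real.log_pow]
          push_cast; ring
        rw [e]
        by_cases h : T ≤ 4 * Real.pi * (n : ℝ) ^ 2
        · have h2 : 4 * T < ((n : ℝ) + 1) ^ 2 := by
            by_contra h3; exact hn.2 ⟨h, not_lt.1 h3⟩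
          have h3 : √T ≤ n := by
            by_contra h4
            nlinarith
          have h4 : T ≤ n ^ 2 := by nlinarith
          have h5 : t / (2 * Real.pi * n ^ 2) ≤ 2⁻¹ := by
            rw [div_le_iff₀ (by positivity)]; nlinarith [ht.2]
          have h6 := Real.log_le_log (by positivity) h5
          rw [Real.log_inv] at h6
          exact le_trans (by linarith) (neg_le_abs _)
        · have h5 : 2 ≤ t / (2 * Real.pi * n ^ 2) := by
            rw [le_div_iff₀ (by positivity)]; nlinarith [ht.1, not_le.1 h]
          have h6 := Real.log_le_log (by positivity) h5
          exact le_trans (by linarith) (le_abs_self _)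
      have hcont := continuousOn_phase (Real.log n) 0
      have hmain := fun y hy => norm_integral_phase_le_of_far (y := y) hT0 hy (by norm_num) hm 0
      simp only [add_zero] at hcont hmain
      refine (norm_integral_rpow_mul_le hT0 (by linarith) h1 hcont hmain).trans (le_of_eq ?_)
      ring
    refine (Finset.sum_le_sum hb).trans ?_
    rw [← Finset.sum_mul]
    have : ∑ n ∈ (Finset.Icc 1 N).filter (fun n => ¬ P n), (n : ℝ) ^ (-c) ≤ S :=
      hsum.sum_le_tsum _ fun n _ => by positivity
    calc _ ≤ S * (48 * T ^ α) := by gcongr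
      _ = _ := by ring
  have hT14 : T ^ (1 / 4 : ℝ) ≤ T ^ α := Real.rpow_le_rpow_of_exponent_le hT h0.le
  have hmid : ‖∑ n ∈ (Finset.Icc 1 N).filter P, G n‖ ≤
      (20 * C0 + 2 * B) * T ^ (1 / 4 : ℝ) * (1 + Real.log T) := by
    set m := ⌈√(T / (4 * Real.pi))⌉₊ with hm
    set M := min (N + 1) ⌊2 * √T⌋₊ with hM
    have hms : √(T / (4 * Real.pi)) ≤ m := Nat.le_ceil _
    have hm1 : 1 ≤ m := Nat.one_le_iff_ne_zero.2 (Nat.ceil_pos.2 (by positivity)).ne'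
    have hPm : ∀ n : ℕ, T ≤ 4 * Real.pi * (n : ℝ) ^ 2 ↔ m ≤ n := by
      intro n
      rw [hm, Nat.ceil_le, Real.sqrt_le_left (by positivity), div_le_iff₀ (by positivity), mul_comm]
    have hPM : ∀ n : ℕ, ((n : ℝ) + 1) ^ 2 ≤ 4 * T ↔ n + 1 ≤ ⌊2 * √T⌋₊ := by
      intro n
      rw [Nat.le_floor_iff (by positivity),
        show 4 * T = (2 * √T) ^ 2 by rw [mul_pow, hsq]; norm_num,
        sq_le_sq₀ (by positivity) (by positivity)]
      push_cast; rfl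
    have hset : (Finset.Icc 1 N).filter P = Finset.Ico m M := by
      ext n
      rw [Finset.mem_filter, Finset.mem_Icc, Finset.mem_Ico]
      show (1 ≤ n ∧ n ≤ N) ∧ (T ≤ 4 * Real.pi * (n : ℝ) ^ 2 ∧ ((n : ℝ) + 1) ^ 2 ≤ 4 * T) ↔ _
      rw [hPm, hPM]
      omega
    have hRpos : 0 ≤ (20 * C0 + 2 * B) * T ^ (1 / 4 : ℝ) * (1 + Real.log T) := by positivity
    rw [hset]
    rcases lt_or_ge M m with hlt | hle
    · rw [Finset.Ico_eq_empty (by omega), Finset.sum_empty, norm_zero]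
      exact hRpos
    have hMs : (M : ℝ) ≤ 2 * √T :=
      (Nat.cast_le.2 (min_le_right _ _)).trans (Nat.floor_le (by positivity))
    have hsT : √T ≤ T := by nlinarith
    rw [Finset.sum_congr rfl fun n _ => hGa n]
    have hnb : ∀ n : ℕ, m ≤ n → ‖a n‖ ≤ B * T ^ (1 / 4 : ℝ) := by
      intro n hn
      have hn0 : (0 : ℝ) < n := by exact_mod_cast (by omega : 0 < n)
      have hn2 : T / (4 * Real.pi) ≤ (n : ℝ) ^ 2 := by
        rw [div_le_iff₀ (by positivity), mul_comm]; exact (hPm n).2 hn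
      rw [ha, norm_mul, Complex.norm_real, Real.norm_eq_abs, abs_of_nonneg (by positivity)]
      have e1 : (n : ℝ) ^ (-c) ≤ (4 * Real.pi) ^ (c / 2) * T ^ (-(c / 2)) := by
        have h3 : (n : ℝ) ^ (-c) = ((n : ℝ) ^ 2) ^ (-(c / 2)) := by
          rw [← Real.rpow_natCast, ← Real.rpow_mul hn0.le]; congr 1; push_cast; ring
        rw [h3]
        refine (Real.rpow_le_rpow_of_nonpos (by positivity) hn2 (by linarith)).trans (le_of_eq ?_)
        rw [Real.div_rpow hT0.le (by positivity), Real.rpow_neg (x := 4 * Real.pi) (by positivity)]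
        field_simp
      have e2 : T ^ (-(c / 2)) * (T ^ α * √T) = T ^ (1 / 4 : ℝ) := by
        rw [Real.sqrt_eq_rpow, ← Real.rpow_add hT0, ← Real.rpow_add hT0]; congr 1; rw [hc]; ring
      calc _ ≤ (4 * Real.pi) ^ (c / 2) * T ^ (-(c / 2)) * (60 * T ^ α * √T) :=
            mul_le_mul e1 (norm_saddleIntegral_le hT0 (by linarith) h1) (norm_nonneg _)
              (by positivity)
        _ = B * (T ^ (-(c / 2)) * (T ^ α * √T)) := by rw [hB]; ring
        _ = _ := by rw [e2]
    refine (norm_sum_neg_one_pow_mul_le hle (d := fun n => C0 * (T ^ (-(1 / 4) : ℝ) +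
      T ^ (1 / 4 : ℝ) * (1 / (1 + |(n : ℝ) - √(2 * T / (2 * Real.pi))|) +
        1 / (1 + |(n : ℝ) - √(T / (2 * Real.pi))|)))) (fun n hn => ?_) (hnb m le_rfl)
      (hnb M hle)).trans ?_
    · rw [← hset, Finset.mem_filter, Finset.mem_Icc] at hn
      have := hdiff T hT n (by exact_mod_cast hn.1.1) hn.2.1 hn.2.2
      simpa [ha] using this
    · have hX : ∀ v : ℝ, 0 ≤ v → v ≤ √T →
          ∑ n ∈ Finset.Ico m M, 1 / (1 + |(n : ℝ) - v|) ≤ 2 * (2 + Real.log T) := by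
        intro v hv hvT
        have h2 := sum_inv_one_add_abs_sub_le hv M (X := 2 * T) (by linarith) (by linarith)
        have h3 : Real.log (2 * T) ≤ 1 + Real.log T := by
          rw [Real.log_mul two_ne_zero hT0.ne']; linarith [Real.log_two_lt_d9]
        refine le_trans (Finset.sum_le_sum_of_subset_of_nonneg (fun n hn => ?_)
          fun n _ _ => by positivity) (h2.trans (by linarith))
        exact Finset.mem_range.2 (Finset.mem_Ico.1 hn).2
      have hv1 := hX √(2 * T / (2 * Real.pi)) (Real.sqrt_nonneg _) (Real.sqrt_le_sqrt (by
        rw [div_le_iff₀ (by positivity)]; nlinarith))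
      have hv2 := hX √(T / (2 * Real.pi)) (Real.sqrt_nonneg _) (Real.sqrt_le_sqrt (by
        rw [div_le_iff₀ (by positivity)]; nlinarith))
      rw [← Finset.mul_sum, Finset.sum_add_distrib, ← Finset.mul_sum, Finset.sum_add_distrib,
        Finset.sum_const, Nat.card_Ico, nsmul_eq_mul]
      have hcard : ((M - m : ℕ) : ℝ) * T ^ (-(1 / 4) : ℝ) ≤ 2 * T ^ (1 / 4 : ℝ) := by
        have h2 : ((M - m : ℕ) : ℝ) ≤ 2 * √T := (Nat.cast_le.2 (Nat.sub_le _ _)).trans hMs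
        calc _ ≤ 2 * √T * T ^ (-(1 / 4) : ℝ) := by gcongr
          _ = 2 * T ^ (1 / 4 : ℝ) := by
            rw [mul_assoc, Real.sqrt_eq_rpow, ← Real.rpow_add hT0]; norm_num
      calc _ ≤ C0 * (2 * T ^ (1 / 4 : ℝ) + T ^ (1 / 4 : ℝ) * (2 * (2 + Real.log T) +
            2 * (2 + Real.log T))) + 2 * (B * T ^ (1 / 4 : ℝ)) := by gcongr
        _ = T ^ (1 / 4 : ℝ) * (C0 * (10 + 4 * Real.log T) + 2 * B) := by ring
        _ ≤ T ^ (1 / 4 : ℝ) * ((20 * C0 + 2 * B) * (1 + Real.log T)) := by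
          gcongr
          have hB0 : 0 ≤ B := by positivity
          nlinarith [mul_nonneg hC0.le hlog, mul_nonneg hB0 hlog]
        _ = _ := by ring
  rw [← Finset.sum_filter_add_sum_filter_not _ P]
  refine (norm_add_le _ _).trans ((add_le_add hmid hfar).trans ?_)
  have hQ : 0 ≤ 20 * C0 + 2 * B := by positivity
  have hone : 48 * S * T ^ α ≤ 48 * S * T ^ α * (1 + Real.log T) :=
    le_mul_of_one_le_right (by positivity) (by linarith)
  calc _ ≤ (20 * C0 + 2 * B) * T ^ α * (1 + Real.log T) + 48 * S * T ^ α * (1 + Real.log T) := by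
        refine add_le_add ?_ hone
        gcongr
    _ = _ := by ring

theorem abs_half_log_sub_le {y : ℝ} (hy : |y| ≤ 1 / 2) :
    |(Real.log (1 + y) - Real.log (1 - y)) / 2 - y| ≤ 2 * |y| ^ 3 := by
  have h1 := Real.abs_log_sub_add_sum_range_le (x := y) (by linarith) 2
  have h2 := Real.abs_log_sub_add_sum_range_le (x := -y) (by rw [abs_neg]; linarith) 2
  rw [abs_neg] at h2
  norm_num [Finset.sum_range_succ] at h1 h2
  have h3 : |y| ^ 3 / (1 - |y|) ≤ 2 * |y| ^ 3 := by
    rw [div_le_iff₀ (by linarith)]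
    have : 0 ≤ |y| ^ 3 := by positivity
    nlinarith
  rw [abs_le] at h1 h2 ⊢
  constructor <;> linarith [h1.1, h1.2, h2.1, h2.2]

theorem abs_midpoint_log_sub_le {x u : ℝ} (hx : 0 < x) (hu : 1 ≤ u) :
    |Real.log ((x + 1 / 2) ^ 2 + u ^ 2) / 2 - Real.log ((x - 1 / 2) ^ 2 + u ^ 2) / 2 -
      x / (x ^ 2 + u ^ 2)| ≤ 17 / (x + u) ^ 3 := by
  set Q := x ^ 2 + u ^ 2 with hQ
  set A := Q + 1 / 4 with hA
  have hQ0 : 0 < Q := by positivity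
  have hA0 : 0 < A := by positivity
  have hs : 0 < x + u := by linarith
  have hQs : (x + u) ^ 2 ≤ 2 * Q := by nlinarith [sq_nonneg (x - u)]
  have hy1 : x / A ≤ x / Q := by gcongr; linarith
  have hy2 : x / Q ≤ 2 / (x + u) := by
    rw [div_le_div_iff₀ hQ0 hs]; nlinarith
  have hy3 : x / Q ≤ 1 / 2 := by
    rw [div_le_iff₀ hQ0]; nlinarith [sq_nonneg (x - 1)]
  have hy0 : 0 < x / A := by positivity
  have hyabs : |x / A| = x / A := abs_of_pos hy0
  have h1 := abs_half_log_sub_le (y := x / A) (by rw [hyabs]; linarith)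
  have h2 : Real.log ((x + 1 / 2) ^ 2 + u ^ 2) - Real.log ((x - 1 / 2) ^ 2 + u ^ 2) =
      Real.log (1 + x / A) - Real.log (1 - x / A) := by
    have e1 : (x + 1 / 2) ^ 2 + u ^ 2 = A * (1 + x / A) := by field_simp; rw [hA, hQ]; ring
    have e2 : (x - 1 / 2) ^ 2 + u ^ 2 = A * (1 - x / A) := by field_simp; rw [hA, hQ]; ring
    rw [e1, e2, Real.log_mul hA0.ne' (by linarith), Real.log_mul hA0.ne' (by linarith)]
    ring
  have h3 : |x / A - x / Q| ≤ 1 / (x + u) ^ 3 := by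
    have : x / A - x / Q = -(x / Q * (1 / (4 * A))) := by
      field_simp; rw [hA]; ring
    rw [this, abs_neg, abs_of_pos (by positivity)]
    calc x / Q * (1 / (4 * A)) ≤ 2 / (x + u) * (1 / (2 * (x + u) ^ 2)) := by
          refine mul_le_mul hy2 (one_div_le_one_div_of_le (by positivity) ?_) (by positivity)
            (by positivity)
          linarith
      _ = _ := by field_simp
  have h4 : 2 * |x / A| ^ 3 ≤ 16 / (x + u) ^ 3 := by
    rw [hyabs]
    calc 2 * (x / A) ^ 3 ≤ 2 * (2 / (x + u)) ^ 3 :=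
          mul_le_mul_of_nonneg_left (pow_le_pow_left₀ hy0.le (hy1.trans hy2) 3) zero_le_two
      _ = _ := by rw [div_pow]; ring
  have h5 : Real.log ((x + 1 / 2) ^ 2 + u ^ 2) / 2 -
      Real.log ((x - 1 / 2) ^ 2 + u ^ 2) / 2 - x / Q =
      ((Real.log (1 + x / A) - Real.log (1 - x / A)) / 2 - x / A) + (x / A - x / Q) := by
    rw [← h2]; ring
  rw [h5]
  calc _ ≤ _ := abs_add_le _ _
    _ ≤ 16 / (x + u) ^ 3 + 1 / (x + u) ^ 3 := add_le_add (h1.trans h4) h3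
    _ = _ := by ring

theorem sum_inv_cube_le {w : ℝ} (hw : 1 < w) (n : ℕ) :
    ∑ j ∈ Finset.range n, 1 / ((j : ℝ) + w) ^ 3 ≤ 1 / (2 * (w - 1) ^ 2) := by
  have h : ∀ n : ℕ, ∑ j ∈ Finset.range n, 1 / ((j : ℝ) + w) ^ 3 ≤
      1 / (2 * (w - 1) ^ 2) - 1 / (2 * (n + w - 1) ^ 2) := by
    intro n
    induction n with
    | zero => simp
    | succ k ih =>
      rw [Finset.sum_range_succ]
      have hk : (0 : ℝ) ≤ k := Nat.cast_nonneg k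
      set y := (k : ℝ) + w with hy
      have hy1 : 1 < y := by linarith
      have h1 : 1 / y ^ 3 ≤ 1 / (2 * (y - 1) ^ 2) - 1 / (2 * y ^ 2) := by
        have h0 : 0 < y - 1 := by linarith
        rw [div_sub_div _ _ (by positivity) (by positivity), div_le_div_iff₀ (by positivity)
          (by positivity)]
        have : 0 ≤ y ^ 2 * (3 * y - 2) := by have : 0 < 3 * y - 2 := by linarith
                                             positivity
        nlinarith
      push_cast
      have e : (k : ℝ) + 1 + w - 1 = y := by rw [hy]; ring
      rw [e]
      linarith
  have := h n
  have hn : (0 : ℝ) ≤ n := Nat.cast_nonneg n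
  have h2 : (0 : ℝ) ≤ 1 / (2 * (n + w - 1) ^ 2) := by positivity
  linarith

theorem abs_log_sub_sum_le {u : ℝ} (hu : 2 ≤ u) (n : ℕ) :
    |Real.log (((n : ℝ) + 3 / 4) ^ 2 + u ^ 2) / 2 - Real.log u -
      ∑ j ∈ Finset.range (n + 1), ((j : ℝ) + 1 / 4) / (((j : ℝ) + 1 / 4) ^ 2 + u ^ 2)| ≤
      35 / u ^ 2 := by
  have h1 : ∑ j ∈ Finset.range (n + 1), (Real.log (((j : ℝ) + 1 / 4 + 1 / 2) ^ 2 + u ^ 2) / 2 -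
      Real.log (((j : ℝ) + 1 / 4 - 1 / 2) ^ 2 + u ^ 2) / 2) =
      Real.log (((n : ℝ) + 3 / 4) ^ 2 + u ^ 2) / 2 - Real.log (1 / 16 + u ^ 2) / 2 := by
    have h := Finset.sum_range_sub (fun j : ℕ => Real.log (((j : ℝ) - 1 / 4) ^ 2 + u ^ 2) / 2)
      (n + 1)
    rw [show ((0 : ℕ) : ℝ) = 0 from Nat.cast_zero] at h
    have e1 : ((0 : ℝ) - 1 / 4) ^ 2 = 1 / 16 := by norm_num
    have e2 : (((n + 1 : ℕ) : ℝ) - 1 / 4) = n + 3 / 4 := by push_cast; ring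
    rw [e1, e2] at h
    rw [← h]
    refine Finset.sum_congr rfl fun j _ => ?_
    congr 5
    · push_cast; ring
    · ring
  have h2 : |∑ j ∈ Finset.range (n + 1), (Real.log (((j : ℝ) + 1 / 4 + 1 / 2) ^ 2 + u ^ 2) / 2 -
      Real.log (((j : ℝ) + 1 / 4 - 1 / 2) ^ 2 + u ^ 2) / 2) -
      ∑ j ∈ Finset.range (n + 1), ((j : ℝ) + 1 / 4) / (((j : ℝ) + 1 / 4) ^ 2 + u ^ 2)| ≤
      34 / u ^ 2 := by
    rw [← Finset.sum_sub_distrib]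
    refine (Finset.abs_sum_le_sum_abs _ _).trans ?_
    calc _ ≤ ∑ j ∈ Finset.range (n + 1), 17 * (1 / ((j : ℝ) + (1 / 4 + u)) ^ 3) := by
          refine Finset.sum_le_sum fun j _ => ?_
          refine (abs_midpoint_log_sub_le (by positivity) (by linarith)).trans (le_of_eq ?_)
          rw [mul_one_div, add_assoc]
      _ ≤ 17 * (1 / (2 * (1 / 4 + u - 1) ^ 2)) := by
          rw [← Finset.mul_sum]
          gcongr
          exact sum_inv_cube_le (by linarith) _
      _ ≤ 17 * (1 / (2 * (u / 2) ^ 2)) := by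
          gcongr
          linarith
      _ = 34 / u ^ 2 := by field_simp; norm_num
  have h3 : |Real.log (1 / 16 + u ^ 2) / 2 - Real.log u| ≤ 1 / u ^ 2 := by
    have e : Real.log (1 / 16 + u ^ 2) / 2 - Real.log u = Real.log (1 + 1 / (16 * u ^ 2)) / 2 := by
      have : 1 / 16 + u ^ 2 = u ^ 2 * (1 + 1 / (16 * u ^ 2)) := by field_simp; ring
      rw [this, Real.log_mul (by positivity) (by positivity), Real.log_pow]
      push_cast; ring
    have h4 : 0 < 1 / (16 * u ^ 2) := by positivity
    have h5 : 0 ≤ Real.log (1 + 1 / (16 * u ^ 2)) := Real.log_nonneg (by linarith)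
    have h6 := Real.log_le_sub_one_of_pos (x := 1 + 1 / (16 * u ^ 2)) (by positivity)
    have h7 : 1 / (16 * u ^ 2) ≤ 1 / u ^ 2 := by
      gcongr
      nlinarith
    rw [e, abs_of_nonneg (by linarith)]
    linarith
  rw [h1] at h2
  have h8 : (35 : ℝ) / u ^ 2 = 34 / u ^ 2 + 1 / u ^ 2 := by ring
  rw [h8]
  rw [abs_le] at h2 h3 ⊢
  constructor <;> linarith [h2.1, h2.2, h3.1, h3.2]

/-- The argument of `π^{-it/2} GammaSeq (1/4 + it/2) n`. -/
noncomputable def phaseSeq (n : ℕ) (t : ℝ) : ℝ :=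
  t / 2 * Real.log n - t / 2 * Real.log Real.pi -
    ∑ j ∈ Finset.range (n + 1), Real.arctan (t / 2 / (j + 1 / 4))

theorem exists_pos_mul_cexp_arctan {a : ℝ} (ha : 0 < a) (u : ℝ) :
    ∃ r > (0 : ℝ), (a : ℂ) + Complex.I * u =
      r * Complex.exp (Complex.I * (Real.arctan (u / a) : ℝ)) := by
  have hs : 0 < √(1 + (u / a) ^ 2) := Real.sqrt_pos.2 (by positivity)
  refine ⟨a * √(1 + (u / a) ^ 2), by positivity, ?_⟩
  rw [mul_comm Complex.I ((Real.arctan (u / a) : ℝ) : ℂ), Complex.exp_mul_I, ← Complex.ofReal_cos,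
    ← Complex.ofReal_sin, Real.cos_arctan, Real.sin_arctan]
  have h1 : a * √(1 + (u / a) ^ 2) * (1 / √(1 + (u / a) ^ 2)) = a := by field_simp
  have h2 : a * √(1 + (u / a) ^ 2) * (u / a / √(1 + (u / a) ^ 2)) = u := by field_simp
  have h1' : ((a * √(1 + (u / a) ^ 2) : ℝ) : ℂ) * ((1 / √(1 + (u / a) ^ 2) : ℝ) : ℂ) = a := by
    exact_mod_cast h1
  have h2' : ((a * √(1 + (u / a) ^ 2) : ℝ) : ℂ) * ((u / a / √(1 + (u / a) ^ 2) : ℝ) : ℂ) = u := by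
    exact_mod_cast h2
  rw [mul_add, h1', ← mul_assoc, h2']
  ring

theorem eTheta_approx_eq {n : ℕ} (hn : 0 < n) (t : ℝ) :
    (Real.pi : ℂ) ^ (-(Complex.I * (t : ℂ)) / 2) *
      (Complex.GammaSeq (1 / 4 + Complex.I * (t : ℂ) / 2) n /
        ‖Complex.GammaSeq (1 / 4 + Complex.I * (t : ℂ) / 2) n‖) =
      Complex.exp (Complex.I * (phaseSeq n t : ℝ)) := by
  have hpi := Real.pi_pos
  have hn0 : (0 : ℝ) < n := by exact_mod_cast hn
  have hfac : ∀ j : ℕ, ∃ r > (0 : ℝ), (1 / 4 + Complex.I * (t : ℂ) / 2) + j =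
      r * Complex.exp (Complex.I * (Real.arctan (t / 2 / (j + 1 / 4)) : ℝ)) := by
    intro j
    obtain ⟨r, hr, h⟩ := exists_pos_mul_cexp_arctan (a := (j : ℝ) + 1 / 4) (by positivity) (t / 2)
    refine ⟨r, hr, ?_⟩
    rw [← h]; push_cast; ring
  choose r hr hrr using hfac
  have hprod : ∏ j ∈ Finset.range (n + 1), ((1 / 4 + Complex.I * (t : ℂ) / 2) + j) =
      ((∏ j ∈ Finset.range (n + 1), r j : ℝ) : ℂ) * Complex.exp (Complex.I *
        ((∑ j ∈ Finset.range (n + 1), Real.arctan (t / 2 / (j + 1 / 4)) : ℝ) : ℂ)) := by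
    rw [Finset.prod_congr rfl fun j _ => hrr j, Finset.prod_mul_distrib, ← Complex.exp_sum]
    push_cast
    rw [Finset.mul_sum]
  have hP : 0 < ∏ j ∈ Finset.range (n + 1), r j := Finset.prod_pos fun j _ => hr j
  set P := ∏ j ∈ Finset.range (n + 1), r j with hPdef
  set S := ∑ j ∈ Finset.range (n + 1), Real.arctan (t / 2 / (j + 1 / 4)) with hS
  set R := (n : ℝ) ^ (1 / 4 : ℝ) * (n.factorial : ℝ) / P with hR
  have hR0 : 0 < R := by positivity
  have hcpow : (n : ℂ) ^ (1 / 4 + Complex.I * (t : ℂ) / 2) =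
      (((n : ℝ) ^ (1 / 4 : ℝ) : ℝ) : ℂ) *
        Complex.exp (Complex.I * ((t / 2 * Real.log n : ℝ) : ℂ)) := by
    rw [Complex.cpow_add _ _ (by exact_mod_cast hn.ne'), Complex.ofReal_cpow hn0.le]
    congr 1
    · push_cast; rfl
    · rw [Complex.cpow_def_of_ne_zero (by exact_mod_cast hn.ne'), ← Complex.natCast_log]
      congr 1; push_cast; ring
  have hG : Complex.GammaSeq (1 / 4 + Complex.I * (t : ℂ) / 2) n =
      R * Complex.exp (Complex.I * ((t / 2 * Real.log n - S : ℝ) : ℂ)) := by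
    rw [Complex.GammaSeq, hprod, hcpow, Complex.ofReal_sub, mul_sub, Complex.exp_sub, hR]
    push_cast
    have := Complex.exp_ne_zero (Complex.I * S)
    have hP' : (P : ℂ) ≠ 0 := by exact_mod_cast hP.ne'
    field_simp
  have hpw : (Real.pi : ℂ) ^ (-(Complex.I * (t : ℂ)) / 2) =
      Complex.exp (Complex.I * ((-(t / 2 * Real.log Real.pi) : ℝ) : ℂ)) := by
    rw [Complex.cpow_def_of_ne_zero (by exact_mod_cast hpi.ne'), ← Complex.ofReal_log hpi.le]
    congr 1; push_cast; ring
  have hRC : (R : ℂ) ≠ 0 := by exact_mod_cast hR0.ne'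
  rw [hG, norm_mul, norm_cexp_I_mul, mul_one, Complex.norm_real, Real.norm_eq_abs, abs_of_pos hR0,
    mul_div_cancel_left₀ _ hRC, hpw, ← Complex.exp_add, ← mul_add, phaseSeq, ← hS]
  congr 2
  push_cast
  ring

theorem Gamma_quarter_ne_zero (t : ℝ) :
    Complex.Gamma (1 / 4 + Complex.I * (t : ℂ) / 2) ≠ 0 := by
  apply Complex.Gamma_ne_zero_of_re_pos
  simp

theorem tendsto_cexp_phaseSeq (t : ℝ) :
    Filter.Tendsto (fun n => Complex.exp (Complex.I * (phaseSeq n t : ℝ))) Filter.atTop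
      (nhds (eTheta t)) := by
  have h1 := Complex.GammaSeq_tendsto_Gamma (1 / 4 + Complex.I * (t : ℂ) / 2)
  have h0 := Gamma_quarter_ne_zero t
  have h2 : Filter.Tendsto (fun n =>
      ((‖Complex.GammaSeq (1 / 4 + Complex.I * (t : ℂ) / 2) n‖ : ℝ) : ℂ))
      Filter.atTop (nhds ((‖Complex.Gamma (1 / 4 + Complex.I * (t : ℂ) / 2)‖ : ℝ) : ℂ)) :=
    (Complex.continuous_ofReal.tendsto _).comp h1.norm
  have h3 := (h1.div h2 (by simpa using h0)).const_mul
    ((Real.pi : ℂ) ^ (-(Complex.I * (t : ℂ)) / 2))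
  refine h3.congr' ?_
  filter_upwards [Filter.eventually_gt_atTop 0] with n hn
  exact eTheta_approx_eq hn t

theorem norm_eTheta (t : ℝ) : ‖eTheta t‖ = 1 := by
  have h := (tendsto_cexp_phaseSeq t).norm
  simp only [norm_cexp_I_mul] at h
  exact tendsto_nhds_unique h tendsto_const_nhds

theorem hasDerivAt_phaseSeq (n : ℕ) (t : ℝ) :
    HasDerivAt (phaseSeq n) (Real.log n / 2 - Real.log Real.pi / 2 -
      ∑ j ∈ Finset.range (n + 1), ((j : ℝ) + 1 / 4) /
        (((j : ℝ) + 1 / 4) ^ 2 + (t / 2) ^ 2) / 2) t := by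
  have hid := hasDerivAt_id t
  have h1 := (hid.div_const 2).mul_const (Real.log n)
  have h2 := (hid.div_const 2).mul_const (Real.log Real.pi)
  have h3 : HasDerivAt (fun t : ℝ => ∑ j ∈ Finset.range (n + 1), Real.arctan (t / 2 / (j + 1 / 4)))
      (∑ j ∈ Finset.range (n + 1), ((j : ℝ) + 1 / 4) /
        (((j : ℝ) + 1 / 4) ^ 2 + (t / 2) ^ 2) / 2) t := by
    apply HasDerivAt.fun_sum
    intro j _
    refine ((hid.div_const 2).div_const ((j : ℝ) + 1 / 4)).arctan.congr_deriv ?_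
    simp only [id]
    have : (0 : ℝ) < (j : ℝ) + 1 / 4 := by positivity
    field_simp
  refine ((h1.sub h2).sub h3).congr_deriv ?_
  ring

theorem abs_phaseSeq_sub_le {n : ℕ} (hn : 0 < n) {T t : ℝ} (hT : 4 ≤ T)
    (ht : t ∈ Set.Icc T (2 * T)) :
    |(phaseSeq n t - thetaMain t) - (phaseSeq n T - thetaMain T)| ≤
      (Real.log ((((n : ℝ) + 3 / 4) ^ 2 + T ^ 2) / n ^ 2) + 140 / T ^ 2) * T := by
  have hpi := Real.pi_pos
  have hn0 : (0 : ℝ) < n := by exact_mod_cast hn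
  have hT0 : 0 < T := by linarith
  set ε := Real.log ((((n : ℝ) + 3 / 4) ^ 2 + T ^ 2) / n ^ 2) with hε
  have hε0 : 0 ≤ ε := by
    apply Real.log_nonneg
    rw [le_div_iff₀ (by positivity)]; nlinarith
  have hder : ∀ x ∈ Set.Icc T (2 * T), HasDerivWithinAt (fun x => phaseSeq n x - thetaMain x)
      (Real.log n / 2 - Real.log Real.pi / 2 -
      ∑ j ∈ Finset.range (n + 1), ((j : ℝ) + 1 / 4) / (((j : ℝ) + 1 / 4) ^ 2 + (x / 2) ^ 2) / 2 -
      Real.log (x / (2 * Real.pi)) / 2) (Set.Icc T (2 * T)) x := fun x hx =>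
    ((hasDerivAt_phaseSeq n x).sub (hasDerivAt_thetaMain (hT0.trans_le hx.1))).hasDerivWithinAt
  have hbound : ∀ x ∈ Set.Icc T (2 * T), ‖Real.log n / 2 - Real.log Real.pi / 2 -
      ∑ j ∈ Finset.range (n + 1), ((j : ℝ) + 1 / 4) / (((j : ℝ) + 1 / 4) ^ 2 + (x / 2) ^ 2) / 2 -
      Real.log (x / (2 * Real.pi)) / 2‖ ≤ ε + 140 / T ^ 2 := by
    intro x hx
    have hx0 : 0 < x := hT0.trans_le hx.1
    have h1 := abs_log_sub_sum_le (u := x / 2) (by linarith [hx.1]) n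
    have h2 : Real.log (x / (2 * Real.pi)) = Real.log (x / 2) - Real.log Real.pi := by
      rw [← div_div, Real.log_div (by positivity) hpi.ne']
    have h3 : Real.log n ≤ Real.log (((n : ℝ) + 3 / 4) ^ 2 + (x / 2) ^ 2) / 2 := by
      have : Real.log n = Real.log ((n : ℝ) ^ 2) / 2 := by rw [Real.log_pow]; push_cast; ring
      rw [this]
      gcongr
      nlinarith
    have h4 : Real.log (((n : ℝ) + 3 / 4) ^ 2 + (x / 2) ^ 2) / 2 ≤ Real.log n + ε / 2 := by
      rw [hε, Real.log_div (by positivity) (by positivity), Real.log_pow]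
      have : Real.log (((n : ℝ) + 3 / 4) ^ 2 + (x / 2) ^ 2) ≤
          Real.log (((n : ℝ) + 3 / 4) ^ 2 + T ^ 2) := by
        gcongr
        linarith [hx.2]
      push_cast
      linarith
    have h5 : 35 / (x / 2) ^ 2 ≤ 140 / T ^ 2 := by
      rw [div_pow, div_div_eq_mul_div]
      have := hx.1
      norm_num
      gcongr
    rw [← Finset.sum_div, h2, Real.norm_eq_abs]
    rw [abs_le] at h1 ⊢
    have h6 : 0 ≤ 140 / T ^ 2 := by positivity
    constructor <;> linarith [h1.1, h1.2]
  have h := (convex_Icc T (2 * T)).norm_image_sub_le_of_norm_hasDerivWithin_le hder hbound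
    (Set.left_mem_Icc.2 (by linarith)) ht
  rw [Real.norm_eq_abs, Real.norm_eq_abs] at h
  refine h.trans ?_
  gcongr
  rw [abs_of_nonneg (by linarith [ht.1])]
  linarith [ht.2]

theorem norm_cexp_I_sub_le (a b : ℝ) :
    ‖Complex.exp (Complex.I * a) - Complex.exp (Complex.I * b)‖ ≤ |a - b| := by
  have h : Complex.exp (Complex.I * a) - Complex.exp (Complex.I * b) =
      Complex.exp (Complex.I * b) * (Complex.exp (Complex.I * ((a - b : ℝ) : ℂ)) - 1) := by
    rw [mul_sub, ← Complex.exp_add, mul_one]; congr 2; push_cast; ring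
  rw [h, norm_mul, norm_cexp_I_mul, one_mul]
  exact Real.norm_exp_I_mul_ofReal_sub_one_le

theorem tendsto_log_ratio (T : ℝ) :
    Filter.Tendsto (fun n : ℕ => Real.log ((((n : ℝ) + 3 / 4) ^ 2 + T ^ 2) / n ^ 2)) Filter.atTop
      (nhds 0) := by
  have h1 : Filter.Tendsto (fun n : ℕ => (1 + 3 / 4 * ((n : ℝ))⁻¹) ^ 2 + T ^ 2 * (((n : ℝ))⁻¹) ^ 2)
      Filter.atTop (nhds ((1 + 3 / 4 * 0) ^ 2 + T ^ 2 * 0 ^ 2)) := by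
    have h := tendsto_inv_atTop_nhds_zero_nat (𝕜 := ℝ)
    exact (((h.const_mul _).const_add _).pow 2).add ((h.pow 2).const_mul _)
  have h2 := h1.log (by norm_num)
  norm_num at h2
  refine h2.congr' ?_
  filter_upwards [Filter.eventually_gt_atTop 0] with n hn
  have hn0 : (0 : ℝ) < n := by exact_mod_cast hn
  congr 1
  field_simp

/-- Stirling's formula for the phase of the Gamma factor, in the form needed on dyadic intervals. -/
theorem norm_eTheta_mul_sub_le {T t : ℝ} (hT : 4 ≤ T) (ht : t ∈ Set.Icc T (2 * T)) :
    ‖eTheta t * Complex.exp (Complex.I * ((-thetaMain t : ℝ) : ℂ)) -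
      eTheta T * Complex.exp (Complex.I * ((-thetaMain T : ℝ) : ℂ))‖ ≤ 140 / T := by
  have hT0 : 0 < T := by linarith
  have h1 := (((tendsto_cexp_phaseSeq t).mul_const
    (Complex.exp (Complex.I * ((-thetaMain t : ℝ) : ℂ)))).sub ((tendsto_cexp_phaseSeq T).mul_const
    (Complex.exp (Complex.I * ((-thetaMain T : ℝ) : ℂ))))).norm
  have h2 := ((tendsto_log_ratio T).add_const (140 / T ^ 2)).mul_const T
  have h3 : (0 + 140 / T ^ 2) * T = 140 / T := by field_simp; ring
  rw [h3] at h2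
  refine le_of_tendsto_of_tendsto h1 h2 ?_
  filter_upwards [Filter.eventually_gt_atTop 0] with n hn
  refine le_trans ?_ (abs_phaseSeq_sub_le hn hT ht)
  refine le_trans (le_of_eq ?_) (norm_cexp_I_sub_le _ _)
  rw [← Complex.exp_add, ← Complex.exp_add, ← mul_add, ← mul_add, ← Complex.ofReal_add,
    ← Complex.ofReal_add, ← sub_eq_add_neg, ← sub_eq_add_neg]

/-- The `n`-th term of the expansion of `ζ(s) - 1 / (s - 1)` in the half-plane `0 < re s`. -/
noncomputable def zetaTerm (n : ℕ) (s : ℂ) : ℂ :=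
  ((n + 1 : ℝ) : ℂ) ^ (-s) -
    (((n + 2 : ℝ) : ℂ) ^ (1 - s) - ((n + 1 : ℝ) : ℂ) ^ (1 - s)) / (1 - s)

lemma norm_ofReal_cpow_sub_le {m x : ℝ} (hm : 0 < m) (hx : x ∈ Set.Icc m (m + 1)) {s : ℂ}
    (hs : 0 ≤ s.re) :
    ‖(m : ℂ) ^ (-s) - (x : ℂ) ^ (-s)‖ ≤ ‖s‖ * m ^ (-s.re - 1) := by
  have h : ∀ y ∈ Set.Icc m (m + 1), HasDerivWithinAt (fun y : ℝ => (y : ℂ) ^ (-s))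
      (-s * (y : ℂ) ^ (-s - 1)) (Set.Icc m (m + 1)) y := fun y hy => by
    have hy0 : 0 < y := hm.trans_le hy.1
    by_cases hs0 : s = 0
    · simpa [hs0] using hasDerivWithinAt_const y _ (1 : ℂ)
    · exact (hasDerivAt_ofReal_cpow_const hy0.ne' (neg_ne_zero.2 hs0)).hasDerivWithinAt
  have hb : ∀ y ∈ Set.Icc m (m + 1), ‖-s * (y : ℂ) ^ (-s - 1)‖ ≤ ‖s‖ * m ^ (-s.re - 1) := by
    intro y hy
    have hy0 : 0 < y := hm.trans_le hy.1
    rw [norm_mul, norm_neg, Complex.norm_cpow_eq_rpow_re_of_pos hy0]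
    refine mul_le_mul_of_nonneg_left ?_ (norm_nonneg s)
    simpa using Real.rpow_le_rpow_of_nonpos hm hy.1 (show (-s - 1).re ≤ 0 by simp; linarith)
  have := (convex_Icc m (m + 1)).norm_image_sub_le_of_norm_hasDerivWithin_le h hb hx
    (Set.left_mem_Icc.2 (by linarith))
  refine this.trans (mul_le_of_le_one_right ?_ ?_)
  · exact mul_nonneg (norm_nonneg s) (Real.rpow_nonneg hm.le _)
  · rw [Real.norm_eq_abs, abs_le]
    constructor <;> linarith [hx.1, hx.2]

lemma norm_ofReal_cpow_sub_le_two_mul {m x : ℝ} (hm : 0 < m) (hx : m ≤ x) {s : ℂ}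
    (hs : 0 ≤ s.re) :
    ‖(m : ℂ) ^ (-s) - (x : ℂ) ^ (-s)‖ ≤ 2 * m ^ (-s.re) := by
  refine (norm_sub_le _ _).trans ?_
  rw [Complex.norm_cpow_eq_rpow_re_of_pos hm, Complex.norm_cpow_eq_rpow_re_of_pos (hm.trans_le hx),
    Complex.neg_re]
  linarith [Real.rpow_le_rpow_of_nonpos hm hx (show -s.re ≤ 0 by linarith)]

lemma norm_zetaTerm_le_of_forall {n : ℕ} {s : ℂ} (hs1 : s ≠ 1) {B : ℝ}
    (hB : ∀ x ∈ Set.Icc (n + 1 : ℝ) (n + 1 + 1),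
      ‖((n + 1 : ℝ) : ℂ) ^ (-s) - (x : ℂ) ^ (-s)‖ ≤ B) :
    ‖zetaTerm n s‖ ≤ B := by
  have hm : (0 : ℝ) < n + 1 := by positivity
  have hs : (1 - s) ≠ 0 := sub_ne_zero.2 hs1.symm
  have h : ∀ y ∈ Set.Icc (n + 1 : ℝ) (n + 1 + 1), HasDerivWithinAt
      (fun y : ℝ => (y : ℂ) * ((n + 1 : ℝ) : ℂ) ^ (-s) - (y : ℂ) ^ (1 - s) / (1 - s))
      (((n + 1 : ℝ) : ℂ) ^ (-s) - (y : ℂ) ^ (-s)) (Set.Icc (n + 1 : ℝ) (n + 1 + 1)) y :=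
      fun y hy => by
    have hy0 : 0 < y := hm.trans_le hy.1
    have h1 := (hasDerivAt_ofReal_cpow_const hy0.ne' hs).div_const (1 - s)
    have h2 := (Complex.ofRealCLM.hasDerivAt (x := y)).mul_const (((n + 1 : ℝ) : ℂ) ^ (-s))
    have e : ((n + 1 : ℝ) : ℂ) ^ (-s) - (y : ℂ) ^ (-s) = Complex.ofRealCLM 1 *
        ((n + 1 : ℝ) : ℂ) ^ (-s) - (1 - s) * (y : ℂ) ^ (1 - s - 1) / (1 - s) := by
      rw [mul_div_cancel_left₀ _ hs, show 1 - s - 1 = -s by ring]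
      simp
    rw [e]
    exact (h2.sub h1).hasDerivWithinAt
  have := (convex_Icc (n + 1 : ℝ) (n + 1 + 1)).norm_image_sub_le_of_norm_hasDerivWithin_le h hB
    (Set.left_mem_Icc.2 (by linarith)) (Set.right_mem_Icc.2 (by linarith))
  convert this using 1
  · rw [zetaTerm]
    congr 1
    push_cast
    rw [add_assoc (n : ℂ) 1 1, one_add_one_eq_two]
    ring
  · simp

lemma norm_zetaTerm_le (n : ℕ) {s : ℂ} (hs1 : s ≠ 1) (hs : 0 ≤ s.re) :
    ‖zetaTerm n s‖ ≤ ‖s‖ * (n + 1 : ℝ) ^ (-s.re - 1) :=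
  norm_zetaTerm_le_of_forall hs1 fun _ hx => norm_ofReal_cpow_sub_le (by positivity) hx hs

lemma norm_zetaTerm_le_two_mul (n : ℕ) {s : ℂ} (hs1 : s ≠ 1) (hs : 0 ≤ s.re) :
    ‖zetaTerm n s‖ ≤ 2 * (n + 1 : ℝ) ^ (-s.re) :=
  norm_zetaTerm_le_of_forall hs1 fun _ hx =>
    norm_ofReal_cpow_sub_le_two_mul (by positivity) hx.1 hs

lemma summable_succ_rpow {p : ℝ} (hp : p < -1) : Summable fun n : ℕ => (n + 1 : ℝ) ^ p := by
  have := (summable_nat_add_iff 1).2 (Real.summable_nat_rpow.2 hp)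
  simpa using this

lemma differentiableOn_tsum_zetaTerm {a b : ℝ} (ha : 0 < a) :
    DifferentiableOn ℂ (fun s => ∑' n, zetaTerm n s)
      (({s : ℂ | a < s.re} ∩ {s | 0 < s.im}) ∩ Metric.ball 0 b) := by
  have hU : IsOpen (({s : ℂ | a < s.re} ∩ {s | 0 < s.im}) ∩ Metric.ball 0 b) :=
    ((isOpen_lt continuous_const Complex.continuous_re).inter
      (isOpen_lt continuous_const Complex.continuous_im)).inter Metric.isOpen_ball
  have hne : ∀ s ∈ (({s : ℂ | a < s.re} ∩ {s | 0 < s.im}) ∩ Metric.ball 0 b), s ≠ 1 := by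
    rintro s hs rfl
    simpa using hs.1.2
  refine Complex.differentiableOn_tsum_of_summable_norm (u := fun n => b * (n + 1 : ℝ) ^ (-a - 1))
    ((summable_succ_rpow (by linarith)).mul_left b) (fun n s hs => ?_) hU fun n s hs => ?_
  · have h1 : (1 - s) ≠ 0 := sub_ne_zero.2 (hne s hs).symm
    have h2 : (((n + 1 : ℝ) : ℂ)) ≠ 0 := by norm_cast
    have h3 : (((n + 2 : ℝ) : ℂ)) ≠ 0 := by norm_cast
    have e1 : DifferentiableAt ℂ (fun s : ℂ => ((n + 1 : ℝ) : ℂ) ^ (-s)) s :=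
      differentiableAt_id.neg.const_cpow (Or.inl h2)
    have e2 : DifferentiableAt ℂ (fun s : ℂ => ((n + 1 : ℝ) : ℂ) ^ (1 - s)) s :=
      (differentiableAt_id.const_sub 1).const_cpow (Or.inl h2)
    have e3 : DifferentiableAt ℂ (fun s : ℂ => ((n + 2 : ℝ) : ℂ) ^ (1 - s)) s :=
      (differentiableAt_id.const_sub 1).const_cpow (Or.inl h3)
    exact (e1.sub ((e3.sub e2).div (differentiableAt_id.const_sub 1) h1)).differentiableWithinAt
  · have ha' : a < s.re := hs.1.1
    have hb : ‖s‖ < b := by simpa using hs.2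
    refine (norm_zetaTerm_le n (hne s hs) (ha.trans ha').le).trans ?_
    refine mul_le_mul hb.le ?_ (Real.rpow_nonneg (by positivity) _) ((norm_nonneg s).trans hb.le)
    exact Real.rpow_le_rpow_of_exponent_le (by linarith [n.cast_nonneg (α := ℝ)]) (by linarith)

lemma tsum_zetaTerm_of_one_lt_re {s : ℂ} (hs : 1 < s.re) :
    ∑' n, zetaTerm n s = riemannZeta s - 1 / (s - 1) := by
  have hs1 : s - 1 ≠ 0 := by
    intro h; rw [sub_eq_zero] at h; rw [h] at hs; simp at hs
  have h1 : HasSum (fun n : ℕ => ((n + 1 : ℝ) : ℂ) ^ (-s)) (riemannZeta s) := by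
    rw [zeta_eq_tsum_one_div_nat_add_one_cpow hs]
    have : Summable fun n : ℕ => 1 / ((n : ℂ) + 1) ^ s := by
      simpa using (summable_nat_add_iff 1).2 (Complex.summable_one_div_nat_cpow.2 hs)
    convert this.hasSum using 2 with n
    rw [Complex.cpow_neg, one_div]; push_cast; rfl
  have h2 : HasSum (fun n : ℕ => ((n + 2 : ℝ) : ℂ) ^ (1 - s) - ((n + 1 : ℝ) : ℂ) ^ (1 - s))
      (0 - 1) := by
    have ht : Filter.Tendsto (fun n : ℕ => ((n + 1 : ℝ) : ℂ) ^ (1 - s)) Filter.atTop (nhds 0) := by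
      rw [tendsto_zero_iff_norm_tendsto_zero]
      have : ∀ n : ℕ, ‖((n + 1 : ℝ) : ℂ) ^ (1 - s)‖ = (n + 1 : ℝ) ^ (-(s.re - 1)) := fun n => by
        rw [Complex.norm_cpow_eq_rpow_re_of_pos (by positivity)]; simp
      simp only [this]
      exact (tendsto_rpow_neg_atTop (by linarith)).comp
        (Filter.tendsto_atTop_add_const_right _ _ tendsto_natCast_atTop_atTop)
    have hsum : Summable fun n : ℕ =>
        ((n + 2 : ℝ) : ℂ) ^ (1 - s) - ((n + 1 : ℝ) : ℂ) ^ (1 - s) := by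
      have hz : Summable fun n => zetaTerm n s :=
        Summable.of_norm_bounded ((summable_succ_rpow (by linarith)).mul_left ‖s‖)
          fun n => norm_zetaTerm_le n (sub_ne_zero.1 hs1) (by linarith)
      refine ((h1.summable.sub hz).mul_left (1 - s)).congr fun n => ?_
      have : 1 - s ≠ 0 := by rw [← neg_sub]; exact neg_ne_zero.2 hs1
      rw [zetaTerm]; field_simp; ring
    refine (hsum.hasSum_iff_tendsto_nat).2 ?_
    have : ∀ N : ℕ, ∑ n ∈ Finset.range N,
        (((n + 2 : ℝ) : ℂ) ^ (1 - s) - ((n + 1 : ℝ) : ℂ) ^ (1 - s)) =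
        ((N + 1 : ℝ) : ℂ) ^ (1 - s) - 1 := fun N => by
      have := Finset.sum_range_sub (fun n : ℕ => ((n + 1 : ℝ) : ℂ) ^ (1 - s)) N
      simp only [Nat.cast_zero, zero_add, Complex.ofReal_one, Complex.one_cpow] at this
      rw [← this]
      refine Finset.sum_congr rfl fun n _ => ?_
      push_cast; ring_nf
    simp only [this]
    exact ht.sub_const 1
  have := (h1.sub (h2.div_const (1 - s))).tsum_eq
  simp only [zetaTerm]
  rw [this, ← neg_sub s 1]
  field_simp; ring

/-- Analytic continuation of `ζ` to the half-plane `0 < re s` (upper quadrant) by comparison with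
an integral. -/
theorem riemannZeta_eq_tsum_zetaTerm {s : ℂ} (hs : 0 < s.re) (hs' : 0 < s.im) :
    riemannZeta s = 1 / (s - 1) + ∑' n, zetaTerm n s := by
  set b := ‖s‖ + ‖s + 2‖ + 1 with hb
  set a := s.re / 2 with ha
  have ha0 : 0 < a := by positivity
  set U := (({s : ℂ | a < s.re} ∩ {s | 0 < s.im}) ∩ Metric.ball 0 b) with hUdef
  have hU : IsOpen U :=
    ((isOpen_lt continuous_const Complex.continuous_re).inter
      (isOpen_lt continuous_const Complex.continuous_im)).inter Metric.isOpen_ball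
  have hUc : Convex ℝ U := ((convex_halfSpace_re_gt a).inter (convex_halfSpace_im_gt 0)).inter
    (convex_ball 0 b)
  have hne : ∀ s ∈ U, s ≠ 1 := by
    rintro s hs rfl
    simpa using hs.1.2
  have hsU : s ∈ U := ⟨⟨by simp only [Set.mem_ofPred_eq, ha]; linarith, hs'⟩, by
    simp only [Metric.mem_ball, dist_zero_right, hb]; linarith [norm_nonneg (s + 2)]⟩
  have hs2U : s + 2 ∈ U := ⟨⟨by simp [ha]; linarith, by simpa using hs'⟩, by
    simp only [Metric.mem_ball, dist_zero_right, hb]; linarith [norm_nonneg s]⟩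
  have hd1 : DifferentiableOn ℂ (fun s => ∑' n, zetaTerm n s) U :=
    differentiableOn_tsum_zetaTerm ha0
  have hd2 : DifferentiableOn ℂ (fun s => riemannZeta s - 1 / (s - 1)) U := fun z hz =>
    ((differentiableAt_riemannZeta (hne z hz)).sub ((differentiableAt_const 1).div
      (differentiableAt_id.sub_const 1) (sub_ne_zero.2 (hne z hz)))).differentiableWithinAt
  have := (hd1.analyticOnNhd hU).eqOn_of_preconnected_of_eventuallyEq (hd2.analyticOnNhd hU)
    hUc.isPreconnected hs2U (by
      have : ∀ᶠ z : ℂ in nhds (s + 2), 1 < z.re :=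
        (isOpen_lt continuous_const Complex.continuous_re).mem_nhds (by simp; linarith)
      filter_upwards [this] with z hz using tsum_zetaTerm_of_one_lt_re hz) hsU
  simp only at this
  rw [this]; ring

lemma one_div_norm_sub_one_le {s : ℂ} (hs : 1 ≤ s.im) : ‖1 / (s - 1)‖ ≤ 1 := by
  rw [norm_div, norm_one]
  refine div_le_one_of_le₀ (hs.trans ?_) (norm_nonneg _)
  simpa using (le_abs_self _).trans (Complex.abs_im_le_norm (s - 1))

/-- A bound for `ζ` that is linear in the imaginary part. -/
theorem exists_norm_riemannZeta_le_mul_norm : ∃ C > 0, ∀ s : ℂ, 1 / 2 ≤ s.re → 1 ≤ s.im →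
    ‖riemannZeta s‖ ≤ C * ‖s‖ := by
  have hsum := summable_succ_rpow (p := -(1 / 2) - 1) (by norm_num)
  have h0 : 0 ≤ ∑' n : ℕ, (n + 1 : ℝ) ^ (-(1 / 2) - 1 : ℝ) :=
    tsum_nonneg fun n => Real.rpow_nonneg (by positivity) _
  refine ⟨1 + ∑' n : ℕ, (n + 1 : ℝ) ^ (-(1 / 2) - 1 : ℝ), by linarith, fun s hs hs' => ?_⟩
  have hs1 : s ≠ 1 := by rintro rfl; norm_num at hs'
  have hn : 1 ≤ ‖s‖ := hs'.trans ((le_abs_self _).trans (Complex.abs_im_le_norm s))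
  rw [riemannZeta_eq_tsum_zetaTerm (by linarith) (by linarith), add_mul, one_mul]
  refine (norm_add_le _ _).trans (add_le_add ((one_div_norm_sub_one_le hs').trans hn) ?_)
  refine tsum_of_norm_bounded (f := fun n => zetaTerm n s) (hsum.hasSum.mul_right ‖s‖) fun n => ?_
  refine (norm_zetaTerm_le n hs1 (by linarith)).trans ?_
  rw [mul_comm]
  refine mul_le_mul_of_nonneg_right ?_ (norm_nonneg s)
  exact Real.rpow_le_rpow_of_exponent_le (by linarith [n.cast_nonneg (α := ℝ)]) (by linarith)

/-- On the line `re s = 1`, `ζ` is bounded by an arbitrarily small power of the height. -/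
theorem exists_norm_riemannZeta_one_add_le {δ : ℝ} (hδ : 0 < δ) (hδ' : δ ≤ 1) :
    ∃ C > 0, ∀ t : ℝ, 1 ≤ t → ‖riemannZeta (1 + Complex.I * t)‖ ≤ C * t ^ δ := by
  have hsum := summable_succ_rpow (p := -1 - δ) (by linarith)
  have h0 : 0 ≤ ∑' n : ℕ, (n + 1 : ℝ) ^ (-1 - δ : ℝ) :=
    tsum_nonneg fun n => Real.rpow_nonneg (by positivity) _
  refine ⟨1 + (∑' n : ℕ, (n + 1 : ℝ) ^ (-1 - δ : ℝ)) * 2, by linarith, fun t ht => ?_⟩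
  set s : ℂ := 1 + Complex.I * t with hs
  have hre : s.re = 1 := by simp [hs]
  have him : s.im = t := by simp [hs]
  have hs1 : s ≠ 1 := by intro h; rw [h] at him; simp at him; linarith
  have ht0 : 0 < t := by linarith
  have hn : ‖s‖ ≤ 2 * t := by
    refine (norm_add_le _ _).trans ?_
    simp [abs_of_pos ht0]; linarith
  rw [riemannZeta_eq_tsum_zetaTerm (by linarith) (by linarith), add_mul, one_mul]
  refine (norm_add_le _ _).trans (add_le_add ((one_div_norm_sub_one_le (by linarith)).trans
    (Real.one_le_rpow ht hδ.le)) ?_)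
  rw [mul_assoc]
  refine tsum_of_norm_bounded (f := fun n => zetaTerm n s)
    (hsum.hasSum.mul_right (2 * t ^ δ)) fun n => ?_
  have hm : (0 : ℝ) < n + 1 := by positivity
  have b1 := norm_zetaTerm_le n hs1 (by linarith)
  have b2 := norm_zetaTerm_le_two_mul n hs1 (by linarith)
  rw [hre] at b1 b2
  rcases eq_or_ne (zetaTerm n s) 0 with hz | hz
  · rw [hz, norm_zero]; positivity
  have hz' : 0 < ‖zetaTerm n s‖ := norm_pos_iff.2 hz
  have b1' : ‖zetaTerm n s‖ ≤ 2 * t * (n + 1 : ℝ) ^ (-1 - 1 : ℝ) :=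
    b1.trans (mul_le_mul_of_nonneg_right hn (by positivity))
  calc ‖zetaTerm n s‖ = ‖zetaTerm n s‖ ^ δ * ‖zetaTerm n s‖ ^ (1 - δ) := by
        rw [← Real.rpow_add hz']; simp
    _ ≤ (2 * t * (n + 1 : ℝ) ^ (-1 - 1 : ℝ)) ^ δ * (2 * (n + 1 : ℝ) ^ (-1 : ℝ)) ^ (1 - δ) := by
        refine mul_le_mul (Real.rpow_le_rpow hz'.le b1' hδ.le)
          (Real.rpow_le_rpow hz'.le b2 (by linarith)) (by positivity) (by positivity)
    _ = (n + 1 : ℝ) ^ (-1 - δ) * (2 * t ^ δ) := by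
        rw [Real.mul_rpow (by positivity) (by positivity), Real.mul_rpow (by positivity) ht0.le,
          Real.mul_rpow (by positivity) (by positivity), ← Real.rpow_mul hm.le,
          ← Real.rpow_mul hm.le]
        have e1 : (2 : ℝ) ^ δ * 2 ^ (1 - δ) = 2 := by
          rw [← Real.rpow_add two_pos]; simp
        have e2 : (n + 1 : ℝ) ^ ((-1 - 1) * δ) * (n + 1 : ℝ) ^ (-1 * (1 - δ)) =
            (n + 1 : ℝ) ^ (-1 - δ) := by
          rw [← Real.rpow_add hm]; congr 1; ring
        calc _ = ((2 : ℝ) ^ δ * 2 ^ (1 - δ)) * t ^ δ *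
              ((n + 1 : ℝ) ^ ((-1 - 1) * δ) * (n + 1 : ℝ) ^ (-1 * (1 - δ))) := by ring
          _ = _ := by rw [e1, e2]; ring

lemma norm_riemannZeta_conj (s : ℂ) :
    ‖riemannZeta (starRingEnd ℂ s)‖ = ‖riemannZeta s‖ := by
  rw [riemannZeta_conj, RCLike.norm_conj]

lemma norm_Gamma_one_add_mul_norm_cos_sq_le {t : ℝ} (ht : 0 < t) :
    (‖Complex.Gamma (1 + Complex.I * t)‖ * ‖Complex.cos (Real.pi * (1 + Complex.I * t) / 2)‖) ^ 2 ≤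
      Real.pi * t / 2 := by
  have hz : Complex.I * (t : ℂ) ≠ 0 := by simp [ht.ne']
  have hG : ‖Complex.Gamma (1 + Complex.I * t)‖ ^ 2 = t * (Real.pi / Real.sinh (Real.pi * t)) := by
    have h1 : Complex.Gamma (1 - Complex.I * t) =
        starRingEnd ℂ (Complex.Gamma (1 + Complex.I * t)) := by
      rw [← Complex.Gamma_conj]; congr 1; simp [sub_eq_add_neg]
    have h2 := Complex.Gamma_mul_Gamma_one_sub (Complex.I * t)
    have h3 : Complex.Gamma (1 + Complex.I * t) =
        Complex.I * t * Complex.Gamma (Complex.I * t) := by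
      rw [add_comm, Complex.Gamma_add_one _ hz]
    have h4 : Complex.sin (Real.pi * (Complex.I * t)) = Real.sinh (Real.pi * t) * Complex.I := by
      rw [show (Real.pi : ℂ) * (Complex.I * t) = ((Real.pi * t : ℝ) : ℂ) * Complex.I by
        push_cast; ring, Complex.sin_mul_I, Complex.ofReal_sinh]
    have h5 := congrArg norm h2
    rw [h4, h1, norm_mul, RCLike.norm_conj, norm_div, norm_mul, Complex.norm_I, mul_one,
      Complex.norm_real, Complex.norm_real, Real.norm_of_nonneg Real.pi_pos.le,
      Real.norm_of_nonneg (Real.sinh_nonneg_iff.2 (by positivity))] at h5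
    rw [← h5, sq]
    nth_rewrite 1 [h3]
    rw [norm_mul, norm_mul, Complex.norm_I, one_mul, Complex.norm_real, Real.norm_of_nonneg ht.le]
    ring
  have hC : ‖Complex.cos (Real.pi * (1 + Complex.I * t) / 2)‖ = Real.sinh (Real.pi * t / 2) := by
    rw [show (Real.pi : ℂ) * (1 + Complex.I * t) / 2 =
      ((Real.pi * t / 2 : ℝ) : ℂ) * Complex.I + (Real.pi / 2 : ℂ) by push_cast; ring,
      Complex.cos_add_pi_div_two, norm_neg, Complex.sin_mul_I, ← Complex.ofReal_sinh, norm_mul,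
      Complex.norm_I, mul_one, Complex.norm_real,
      Real.norm_of_nonneg (Real.sinh_nonneg_iff.2 (by positivity))]
  have hs : 0 < Real.sinh (Real.pi * t / 2) := Real.sinh_pos_iff.2 (by positivity)
  have hc : 0 < Real.cosh (Real.pi * t / 2) := Real.cosh_pos _
  have h2 : Real.sinh (Real.pi * t) =
      2 * Real.sinh (Real.pi * t / 2) * Real.cosh (Real.pi * t / 2) := by
    rw [← Real.sinh_two_mul]; ring_nf
  rw [mul_pow, hG, hC, h2]
  have : t * (Real.pi / (2 * Real.sinh (Real.pi * t / 2) * Real.cosh (Real.pi * t / 2))) *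
      Real.sinh (Real.pi * t / 2) ^ 2 =
      Real.pi * t / 2 * (Real.sinh (Real.pi * t / 2) / Real.cosh (Real.pi * t / 2)) := by
    field_simp
  rw [this]
  refine mul_le_of_le_one_right (by positivity) ?_
  exact div_le_one_of_le₀ (Real.sinh_lt_cosh _).le hc.le

/-- On the imaginary axis, `ζ` grows at most like the square root of the height, up to an
arbitrarily small power. -/
theorem exists_norm_riemannZeta_I_mul_le {δ : ℝ} (hδ : 0 < δ) (hδ' : δ ≤ 1) :
    ∃ C > 0, ∀ t : ℝ, 1 ≤ t → ‖riemannZeta (Complex.I * t)‖ ≤ C * t ^ (1 / 2 + δ) := by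
  obtain ⟨C, hC, h⟩ := exists_norm_riemannZeta_one_add_le hδ hδ'
  refine ⟨C, hC, fun t ht => ?_⟩
  have ht0 : 0 < t := by linarith
  set w : ℂ := 1 + Complex.I * t with hw
  have him : w.im = t := by simp [hw]
  have hre : w.re = 1 := by simp [hw]
  have hw1 : w ≠ 1 := by intro e; rw [e] at him; simp at him; linarith
  have hwn : ∀ n : ℕ, w ≠ -n := by intro n e; rw [e] at him; simp at him; linarith
  have e1 : ‖riemannZeta (Complex.I * t)‖ = ‖riemannZeta (1 - w)‖ := by
    rw [← norm_riemannZeta_conj]; congr 2; simp [hw]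
  have hG : ‖Complex.Gamma w‖ * ‖Complex.cos (Real.pi * w / 2)‖ ≤ √(Real.pi * t / 2) :=
    Real.le_sqrt_of_sq_le (norm_Gamma_one_add_mul_norm_cos_sq_le ht0)
  have h2 : ‖(2 * (Real.pi : ℂ)) ^ (-w)‖ = (2 * Real.pi)⁻¹ := by
    rw [show (2 * (Real.pi : ℂ)) = ((2 * Real.pi : ℝ) : ℂ) by push_cast; rfl,
      Complex.norm_cpow_eq_rpow_re_of_pos (by positivity), Complex.neg_re, hre, Real.rpow_neg_one]
  have h3 : 2 * (2 * Real.pi)⁻¹ * √(Real.pi * t / 2) ≤ t ^ (1 / 2 : ℝ) := by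
    rw [← Real.sqrt_eq_rpow]
    have : √(Real.pi * t / 2) ≤ √Real.pi * √t := by
      rw [← Real.sqrt_mul Real.pi_pos.le]; exact Real.sqrt_le_sqrt (half_le_self (by positivity))
    have hp : √Real.pi ≤ Real.pi := by
      rw [Real.sqrt_le_left Real.pi_pos.le]; nlinarith [Real.pi_gt_three]
    calc 2 * (2 * Real.pi)⁻¹ * √(Real.pi * t / 2) = √(Real.pi * t / 2) / Real.pi := by
          field_simp
      _ ≤ √t := by
          rw [div_le_iff₀ Real.pi_pos, mul_comm √t]
          exact this.trans (mul_le_mul_of_nonneg_right hp (Real.sqrt_nonneg t))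
  rw [e1, riemannZeta_one_sub hwn hw1, norm_mul, norm_mul, norm_mul, norm_mul, h2,
    Real.rpow_add ht0]
  calc _ = (2 * (2 * Real.pi)⁻¹ * (‖Complex.Gamma w‖ * ‖Complex.cos (Real.pi * w / 2)‖)) *
        ‖riemannZeta w‖ := by rw [Complex.norm_ofNat]; ring
    _ ≤ t ^ (1 / 2 : ℝ) * (C * t ^ δ) := by
        refine mul_le_mul ((mul_le_mul_of_nonneg_left hG (by positivity)).trans h3) (h t ht)
          (norm_nonneg _) (by positivity)
    _ = _ := by ring

lemma norm_Gamma_le_Gamma_re {s : ℂ} (hs : 0 < s.re) : ‖Complex.Gamma s‖ ≤ Real.Gamma s.re := by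
  rw [Complex.Gamma_eq_integral hs, Complex.GammaIntegral, Real.Gamma_eq_integral hs]
  refine (norm_integral_le_integral_norm _).trans (le_of_eq ?_)
  refine setIntegral_congr_fun measurableSet_Ioi fun x hx => ?_
  simp only [norm_mul]
  rw [Complex.norm_cpow_eq_rpow_re_of_pos hx, Complex.norm_real,
    Real.norm_of_nonneg (Real.exp_pos _).le]
  simp

lemma norm_cos_le_exp (z : ℂ) : ‖Complex.cos z‖ ≤ Real.exp |z.im| := by
  rw [Complex.cos, norm_div, Complex.norm_ofNat, div_le_iff₀ two_pos]
  refine (norm_add_le _ _).trans ?_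
  rw [Complex.norm_exp, Complex.norm_exp]
  have h1 : (z * Complex.I).re ≤ |z.im| := by simpa using neg_le_abs z.im
  have h2 : (-z * Complex.I).re ≤ |z.im| := by simpa using le_abs_self z.im
  linarith [Real.exp_le_exp.2 h1, Real.exp_le_exp.2 h2]

/-- A crude growth bound for `ζ` in a vertical strip. -/
theorem exists_norm_riemannZeta_le_exp : ∃ C > 0, ∀ s : ℂ, 0 ≤ s.re → s.re ≤ 2 → 1 ≤ s.im →
    ‖riemannZeta s‖ ≤ C * Real.exp (4 * s.im) := by
  obtain ⟨C, hC, h⟩ := exists_norm_riemannZeta_le_mul_norm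
  obtain ⟨M, hM⟩ := isCompact_Icc.exists_bound_of_continuousOn (f := Real.Gamma)
    (s := Set.Icc (1 / 2 : ℝ) 1) (fun x hx => by
      refine (Real.differentiableAt_Gamma fun m => ?_).continuousAt.continuousWithinAt
      have := hx.1
      have := m.cast_nonneg (α := ℝ)
      intro e; linarith)
  have hM0 : 0 ≤ M := (norm_nonneg _).trans (hM 1 (by norm_num))
  have key : ∀ s : ℂ, 1 / 2 ≤ s.re → s.re ≤ 2 → 1 ≤ s.im →
      ‖riemannZeta s‖ ≤ C * (3 * Real.exp s.im) := fun s h1 h2 h3 => by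
    refine (h s h1 h3).trans (mul_le_mul_of_nonneg_left ?_ hC.le)
    have := Complex.norm_le_abs_re_add_abs_im s
    rw [abs_of_nonneg (show (0 : ℝ) ≤ s.re by linarith),
      abs_of_nonneg (show (0 : ℝ) ≤ s.im by linarith)] at this
    linarith [Real.add_one_le_exp s.im]
  refine ⟨3 * C + 6 * C * M, by positivity, fun s h0 h2 h1 => ?_⟩
  rcases le_total (1 / 2) s.re with hs | hs
  · refine (key s hs h2 h1).trans ?_
    have : Real.exp s.im ≤ Real.exp (4 * s.im) := Real.exp_le_exp.2 (by linarith)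
    have h' : C * (3 * Real.exp s.im) ≤ 3 * C * Real.exp (4 * s.im) := by
      nlinarith
    refine h'.trans (mul_le_mul_of_nonneg_right ?_ (Real.exp_pos _).le)
    nlinarith [mul_nonneg hC.le hM0]
  · set w : ℂ := 1 - starRingEnd ℂ s with hw
    have him : w.im = s.im := by simp [hw]
    have hre : w.re = 1 - s.re := by simp [hw]
    have hw1 : w ≠ 1 := by intro e; rw [e] at him; simp at him; linarith
    have hwn : ∀ n : ℕ, w ≠ -n := by intro n e; rw [e] at him; simp at him; linarith
    have e1 : ‖riemannZeta s‖ = ‖riemannZeta (1 - w)‖ := by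
      rw [← norm_riemannZeta_conj]; congr 2; simp [hw]
    have hG : ‖Complex.Gamma w‖ ≤ M :=
      (norm_Gamma_le_Gamma_re (by linarith)).trans
        ((le_abs_self _).trans (hM _ ⟨by linarith, by linarith⟩))
    have hcos : ‖Complex.cos (Real.pi * w / 2)‖ ≤ Real.exp (2 * s.im) := by
      refine (norm_cos_le_exp _).trans (Real.exp_le_exp.2 ?_)
      have : (Real.pi * w / 2 : ℂ).im = Real.pi / 2 * s.im := by
        rw [show (Real.pi * w / 2 : ℂ) = ((Real.pi / 2 : ℝ) : ℂ) * w by push_cast; ring,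
          Complex.im_ofReal_mul, him]
      rw [this, abs_of_nonneg (by positivity)]
      exact mul_le_mul_of_nonneg_right (by linarith [Real.pi_le_four]) (by linarith)
    have h2 : ‖(2 * (Real.pi : ℂ)) ^ (-w)‖ ≤ 1 := by
      rw [show (2 * (Real.pi : ℂ)) = ((2 * Real.pi : ℝ) : ℂ) by push_cast; rfl,
        Complex.norm_cpow_eq_rpow_re_of_pos (by positivity), Complex.neg_re]
      exact Real.rpow_le_one_of_one_le_of_nonpos (by linarith [Real.pi_gt_three]) (by linarith)
    have hz := key w (by linarith) (by linarith) (by linarith)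
    rw [him] at hz
    rw [e1, riemannZeta_one_sub hwn hw1, norm_mul, norm_mul, norm_mul, norm_mul, Complex.norm_ofNat]
    calc _ ≤ 2 * 1 * M * Real.exp (2 * s.im) * (C * (3 * Real.exp s.im)) := by gcongr
      _ = 6 * C * M * (Real.exp (2 * s.im) * Real.exp s.im) := by ring
      _ ≤ 6 * C * M * Real.exp (4 * s.im) := by
          rw [← Real.exp_add]
          refine mul_le_mul_of_nonneg_left (Real.exp_le_exp.2 (by linarith)) (by positivity)
      _ ≤ _ := by
          refine mul_le_mul_of_nonneg_right ?_ (Real.exp_pos _).le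
          linarith

/-- The holomorphic extension of `t ↦ exp (I * thetaMain t)` from the critical line. -/
noncomputable def expTheta (s : ℂ) : ℂ :=
  Complex.exp (Complex.I * ((-Complex.I * (s - 1 / 2)) / 2 *
    (Complex.log ((-Complex.I * (s - 1 / 2)) / (2 * Real.pi)) - 1)))

lemma div_two_pi_mem_slitPlane {z : ℂ} (hz : 0 < z.re) :
    z / (2 * Real.pi) ∈ Complex.slitPlane := by
  refine Or.inl ?_
  rw [show (2 * Real.pi : ℂ) = ((2 * Real.pi : ℝ) : ℂ) by push_cast; rfl, Complex.div_ofReal_re]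
  positivity

lemma neg_I_mul_sub_half_re (s : ℂ) : (-Complex.I * (s - 1 / 2)).re = s.im := by
  simp

lemma differentiableAt_expTheta {s : ℂ} (hs : 0 < s.im) : DifferentiableAt ℂ expTheta s := by
  have hz : (-Complex.I * (s - 1 / 2)) / (2 * Real.pi) ∈ Complex.slitPlane :=
    div_two_pi_mem_slitPlane (by rwa [neg_I_mul_sub_half_re])
  unfold expTheta
  have h1 : DifferentiableAt ℂ (fun s : ℂ => -Complex.I * (s - 1 / 2)) s := by fun_prop
  have h2 := (h1.div_const (2 * Real.pi)).clog hz
  exact (((h1.div_const 2).mul (h2.sub_const 1)).const_mul Complex.I).cexp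

lemma exists_expTheta_eq {t a : ℝ} (ht : 0 < t) (ha : |a| ≤ 1) :
    ∃ η : ℂ, ‖η‖ ≤ 1 / (2 * t) ∧ expTheta (1 / 2 + a + Complex.I * t) =
      (((t / (2 * Real.pi)) ^ (a / 2) : ℝ) : ℂ) *
        Complex.exp (Complex.I * ((thetaMain t : ℝ) : ℂ)) * Complex.exp η := by
  have hp : (0 : ℝ) < t / (2 * Real.pi) := by positivity
  set L := Real.log (t / (2 * Real.pi)) with hL
  have hmem : ∀ b : ℝ, ((t : ℂ) - Complex.I * b) / (2 * Real.pi) ∈ Complex.slitPlane := fun b =>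
    div_two_pi_mem_slitPlane (by simpa using ht)
  have hL' : Complex.log ((t : ℂ) / (2 * Real.pi)) = L := by
    rw [hL, Complex.ofReal_log hp.le]; push_cast; rfl
  have hne : ∀ b : ℝ, (t : ℂ) - Complex.I * b ≠ 0 := fun b e => by
    have := congrArg Complex.re e
    simp at this; linarith
  have hpi : (2 * Real.pi : ℂ) ≠ 0 := by simp [Real.pi_ne_zero]
  have hd : ∀ b : ℝ, HasDerivAt (fun b : ℝ => (t : ℂ) - Complex.I * b) (-Complex.I) b := fun b => by
    simpa using ((Complex.ofRealCLM.hasDerivAt (x := b)).const_mul Complex.I).const_sub (t : ℂ)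
  have hlog : ∀ b : ℝ, HasDerivAt
      (fun b : ℝ => Complex.log (((t : ℂ) - Complex.I * b) / (2 * Real.pi)))
      (-Complex.I / ((t : ℂ) - Complex.I * b)) b := fun b => by
    have := ((hd b).div_const (2 * Real.pi : ℂ)).clog_real (hmem b)
    convert! this using 1
    field_simp
  have hlogb : ∀ b ∈ Set.Icc (-1 : ℝ) 1,
      ‖Complex.log (((t : ℂ) - Complex.I * b) / (2 * Real.pi)) - L‖ ≤ 1 / t := fun b hb => by
    have := (convex_Icc (-1 : ℝ) 1).norm_image_sub_le_of_norm_hasDerivWithin_le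
      (f := fun b : ℝ => Complex.log (((t : ℂ) - Complex.I * b) / (2 * Real.pi)))
      (C := 1 / t) (fun x _ => (hlog x).hasDerivWithinAt) (fun x _ => by
        rw [norm_div, norm_neg, Complex.norm_I]
        refine one_div_le_one_div_of_le ht ?_
        simpa using (le_abs_self _).trans (Complex.abs_re_le_norm ((t : ℂ) - Complex.I * x)))
      (x := 0) (by simp) hb
    simp only [Complex.ofReal_zero, mul_zero, sub_zero, hL', Real.norm_eq_abs] at this
    exact this.trans (mul_le_of_le_one_right (by positivity) (abs_le.2 hb))
  have hη : ∀ b : ℝ, HasDerivAt (fun b : ℝ => Complex.I * (((t : ℂ) - Complex.I * b) / 2 *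
      (Complex.log (((t : ℂ) - Complex.I * b) / (2 * Real.pi)) - 1)) - (L / 2 : ℂ) * b)
      ((Complex.log (((t : ℂ) - Complex.I * b) / (2 * Real.pi)) - L) / 2) b := fun b => by
    have h1 := ((((hd b).div_const 2).mul ((hlog b).sub_const 1)).const_mul Complex.I).sub
      ((Complex.ofRealCLM.hasDerivAt (x := b)).const_mul (L / 2 : ℂ))
    convert! h1 using 1
    have := hne b
    simp only [Complex.ofRealCLM_apply, Complex.ofReal_one, mul_one]
    field_simp
    ring_nf
    simp only [Complex.I_sq]
    ring
  have hmain := (convex_Icc (-1 : ℝ) 1).norm_image_sub_le_of_norm_hasDerivWithin_le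
      (C := 1 / (2 * t)) (fun x _ => (hη x).hasDerivWithinAt) (fun x hx => by
        rw [norm_div, Complex.norm_ofNat, div_le_iff₀ two_pos]
        refine (hlogb x hx).trans (le_of_eq ?_)
        field_simp)
      (x := 0) (by simp) (abs_le.1 ha)
  refine ⟨_, hmain.trans (mul_le_of_le_one_right (by positivity) ?_), ?_⟩
  · simpa using ha
  have e1 : -Complex.I * (1 / 2 + (a : ℂ) + Complex.I * t - 1 / 2) = (t : ℂ) - Complex.I * a := by
    ring_nf; simp only [Complex.I_sq]; ring
  have e2 : (((t / (2 * Real.pi)) ^ (a / 2) : ℝ) : ℂ) = Complex.exp ((L / 2 : ℂ) * a) := by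
    rw [Real.rpow_def_of_pos hp, Complex.ofReal_exp, ← hL]
    congr 1; push_cast; ring
  rw [expTheta, e1, e2, ← Complex.exp_add, ← Complex.exp_add]
  congr 1
  simp only [Complex.ofReal_zero, mul_zero, sub_zero, hL']
  rw [thetaMain, ← hL]
  push_cast
  ring

lemma div_two_pi_rpow_le {t a : ℝ} (ht : 0 < t) (ha : |a| ≤ 1) :
    (t / (2 * Real.pi)) ^ (a / 2) ≤ 3 * t ^ (a / 2) := by
  have hp : (1 : ℝ) ≤ 2 * Real.pi := by linarith [Real.pi_gt_three]
  rw [Real.div_rpow ht.le (by positivity), div_eq_mul_inv, ← Real.rpow_neg (by positivity),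
    mul_comm]
  refine mul_le_mul_of_nonneg_right ?_ (by positivity)
  calc (2 * Real.pi) ^ (-(a / 2)) ≤ (2 * Real.pi) ^ (1 / 2 : ℝ) :=
        Real.rpow_le_rpow_of_exponent_le hp (by linarith [(abs_le.1 ha).1])
    _ ≤ 3 := by
        rw [← Real.sqrt_eq_rpow, Real.sqrt_le_left (by norm_num)]
        linarith [Real.pi_le_four]

lemma norm_expTheta_sub_le {t a : ℝ} (ht : 1 ≤ t) (ha : |a| ≤ 1) :
    ‖expTheta (1 / 2 + a + Complex.I * t) - (((t / (2 * Real.pi)) ^ (a / 2) : ℝ) : ℂ) *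
      Complex.exp (Complex.I * ((thetaMain t : ℝ) : ℂ))‖ ≤ 3 * t ^ (a / 2 - 1) := by
  have ht0 : 0 < t := by linarith
  obtain ⟨η, h, e⟩ := exists_expTheta_eq ht0 ha
  have h1 : ‖η‖ ≤ 1 := h.trans (div_le_one_of_le₀ (by linarith) (by positivity))
  rw [e, ← mul_sub_one, norm_mul, norm_mul, Complex.norm_real, Real.norm_of_nonneg (by positivity),
    mul_comm Complex.I, Complex.norm_exp_ofReal_mul_I, mul_one]
  have h2 : ‖Complex.exp η - 1‖ ≤ 1 / t := by
    refine (Complex.norm_exp_sub_one_le h1).trans ?_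
    refine (mul_le_mul_of_nonneg_left h zero_le_two).trans (le_of_eq ?_)
    field_simp
  rw [Real.rpow_sub_one ht0.ne', show 3 * (t ^ (a / 2) / t) = 3 * t ^ (a / 2) * (1 / t) by ring]
  exact mul_le_mul (div_two_pi_rpow_le ht0 ha) h2 (norm_nonneg _) (by positivity)

lemma norm_expTheta_le {t a : ℝ} (ht : 1 ≤ t) (ha : |a| ≤ 1) :
    ‖expTheta (1 / 2 + a + Complex.I * t)‖ ≤ 9 * t ^ (a / 2) := by
  have ht0 : 0 < t := by linarith
  obtain ⟨η, h, e⟩ := exists_expTheta_eq ht0 ha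
  have h1 : ‖η‖ ≤ 1 := h.trans (div_le_one_of_le₀ (by linarith) (by positivity))
  rw [e, norm_mul, norm_mul, Complex.norm_real, Real.norm_of_nonneg (by positivity),
    mul_comm Complex.I, Complex.norm_exp_ofReal_mul_I, mul_one]
  have h2 : ‖Complex.exp η‖ ≤ 3 := by
    rw [Complex.norm_exp]
    refine (Real.exp_le_exp.2 ((Complex.re_le_norm η).trans h1)).trans ?_
    linarith [Real.exp_one_lt_d9]
  calc _ ≤ (3 * t ^ (a / 2)) * 3 :=
        mul_le_mul (div_two_pi_rpow_le ht0 ha) h2 (norm_nonneg _) (by positivity)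
    _ = _ := by ring

lemma expTheta_half_add {t : ℝ} (ht : 0 < t) :
    expTheta (1 / 2 + Complex.I * t) = Complex.exp (Complex.I * ((thetaMain t : ℝ) : ℂ)) := by
  rw [expTheta, show -Complex.I * (1 / 2 + Complex.I * (t : ℂ) - 1 / 2) = t by
    ring_nf; simp only [Complex.I_sq]; ring, thetaMain]
  push_cast [Complex.ofReal_log (show (0 : ℝ) ≤ t / (2 * Real.pi) by positivity)]
  rfl

lemma norm_expTheta_le' {s : ℂ} (h0 : 0 ≤ s.re) (h1 : s.re ≤ 3 / 2) (hs : 1 ≤ s.im) :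
    ‖expTheta s‖ ≤ 9 * s.im ^ ((s.re - 1 / 2) / 2) := by
  have := norm_expTheta_le (t := s.im) (a := s.re - 1 / 2) hs
    (abs_le.2 ⟨by linarith, by linarith⟩)
  rwa [show (1 / 2 + ((s.re - 1 / 2 : ℝ) : ℂ) + Complex.I * s.im : ℂ) = s by
    apply Complex.ext <;> simp] at this

lemma exists_norm_riemannZeta_le_of_one_lt {c : ℝ} (hc : 1 < c) :
    ∃ K > 0, ∀ s : ℂ, s.re = c → ‖riemannZeta s‖ ≤ K := by
  have hsum := summable_succ_rpow (p := -c) (by linarith)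
  have h0 : 0 ≤ ∑' n : ℕ, (n + 1 : ℝ) ^ (-c) :=
    tsum_nonneg fun n => Real.rpow_nonneg (by positivity) _
  refine ⟨1 + ∑' n : ℕ, (n + 1 : ℝ) ^ (-c), by linarith, fun s hs => ?_⟩
  rw [zeta_eq_tsum_one_div_nat_add_one_cpow (by linarith)]
  refine (tsum_of_norm_bounded hsum.hasSum fun n => ?_).trans (by linarith)
  have : ((n : ℂ) + 1) = ((n + 1 : ℝ) : ℂ) := by push_cast; rfl
  rw [norm_div, norm_one, this, Complex.norm_cpow_eq_rpow_re_of_pos (by positivity), hs,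
    Real.rpow_neg (by positivity), one_div]

lemma norm_exp_sq_sub (s : ℂ) (T : ℝ) :
    ‖Complex.exp ((s - Complex.I * T) ^ 2)‖ = Real.exp (s.re ^ 2 - (s.im - T) ^ 2) := by
  rw [Complex.norm_exp]
  congr 1
  simp [sq]

lemma three_halves_mul_rpow_le {T p : ℝ} (hT : 0 < T) (hp : p ≤ 1) :
    (3 / 2 * T) ^ p ≤ 2 * T ^ p := by
  rw [Real.mul_rpow (by norm_num) hT.le]
  refine mul_le_mul_of_nonneg_right ?_ (by positivity)
  calc ((3 : ℝ) / 2) ^ p ≤ (3 / 2) ^ (1 : ℝ) :=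
        Real.rpow_le_rpow_of_exponent_le (by norm_num) hp
    _ ≤ 2 := by norm_num

/-- The convexity bound for `ζ`, weighted by the phase factor `expTheta`, in the strip
`0 ≤ re s ≤ 1 + δ`. -/
theorem exists_norm_riemannZeta_mul_expTheta_le {δ : ℝ} (hδ : 0 < δ) (hδ' : δ ≤ 1 / 2) :
    ∃ C > 0, ∀ s : ℂ, 0 ≤ s.re → s.re ≤ 1 + δ → 4 ≤ s.im →
      ‖riemannZeta s * expTheta s‖ ≤ C * s.im ^ (1 / 4 + δ) := by
  obtain ⟨A, hA, hA'⟩ := exists_norm_riemannZeta_I_mul_le hδ (by linarith)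
  obtain ⟨K, hK, hK'⟩ := exists_norm_riemannZeta_le_of_one_lt (show 1 < 1 + δ by linarith)
  obtain ⟨B, hB, hB'⟩ := exists_norm_riemannZeta_le_exp
  set M := 18 * A + 18 * K * Real.exp 4 + 9 * B * Real.exp 68 with hM
  refine ⟨M, by positivity, fun s₀ h0 h1 hT => ?_⟩
  set T := s₀.im with hTdef
  set U : Set ℂ := Set.Ioo 0 (1 + δ) ×ℂ Set.Ioo (1 / 2 * T) (3 / 2 * T) with hU
  have hcl : closure U = Set.Icc 0 (1 + δ) ×ℂ Set.Icc (1 / 2 * T) (3 / 2 * T) := by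
    rw [hU, Complex.closure_reProdIm, closure_Ioo (by linarith), closure_Ioo (by linarith)]
  have hb : Bornology.IsBounded U := (Metric.isBounded_Ioo _ _).reProdIm (Metric.isBounded_Ioo _ _)
  have hTp : 1 ≤ T ^ (1 / 4 + δ) := Real.one_le_rpow (by linarith) (by linarith)
  have hd : DiffContOnCl ℂ
      (fun s => riemannZeta s * expTheta s * Complex.exp ((s - Complex.I * T) ^ 2)) U := by
    refine DifferentiableOn.diffContOnCl fun s hs => ?_
    rw [hcl, Complex.mem_reProdIm] at hs
    have him : 0 < s.im := by linarith [hs.2.1]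
    have hs1 : s ≠ 1 := by rintro rfl; simp at him
    have h3 : DifferentiableAt ℂ (fun s : ℂ => Complex.exp ((s - Complex.I * T) ^ 2)) s := by
      fun_prop
    exact (((differentiableAt_riemannZeta hs1).mul
      (differentiableAt_expTheta him)).mul h3).differentiableWithinAt
  have hfr : ∀ s ∈ frontier U,
      ‖riemannZeta s * expTheta s * Complex.exp ((s - Complex.I * T) ^ 2)‖ ≤
        M * T ^ (1 / 4 + δ) := by
    intro s hs
    have hopen : IsOpen U := isOpen_Ioo.reProdIm isOpen_Ioo
    rw [frontier, hopen.interior_eq, hcl] at hs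
    obtain ⟨⟨⟨hr0, hr1⟩, hi0, hi1⟩, hnot⟩ := hs
    change (0 : ℝ) ≤ s.re at hr0
    change s.re ≤ 1 + δ at hr1
    change 1 / 2 * T ≤ s.im at hi0
    change s.im ≤ 3 / 2 * T at hi1
    have hi : 1 ≤ s.im := by linarith
    have hE := norm_expTheta_le' hr0 (by linarith) hi
    rw [norm_mul, norm_mul, norm_exp_sq_sub]
    have hcases : s.re = 0 ∨ s.re = 1 + δ ∨ s.im = 1 / 2 * T ∨ s.im = 3 / 2 * T := by
      by_contra! hcon
      exact hnot ⟨⟨lt_of_le_of_ne hr0 (Ne.symm hcon.1), lt_of_le_of_ne hr1 hcon.2.1⟩,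
        ⟨lt_of_le_of_ne hi0 (Ne.symm hcon.2.2.1), lt_of_le_of_ne hi1 hcon.2.2.2⟩⟩
    have hpow : ∀ p ≤ (1 / 4 + δ), 0 ≤ p → s.im ^ p ≤ 2 * T ^ (1 / 4 + δ) := fun p hp hp0 =>
      ((Real.rpow_le_rpow (by linarith) hi1 hp0).trans
        (three_halves_mul_rpow_le (by linarith) (by linarith))).trans
        (mul_le_mul_of_nonneg_left (Real.rpow_le_rpow_of_exponent_le (by linarith) hp) zero_le_two)
    have hre2 : s.re ^ 2 ≤ 4 := by nlinarith
    rcases hcases with h | h | h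
    · have hz : ‖riemannZeta s‖ ≤ A * s.im ^ (1 / 2 + δ) := by
        convert hA' s.im hi using 3
        apply Complex.ext <;> simp [h]
      have hg : Real.exp (s.re ^ 2 - (s.im - T) ^ 2) ≤ 1 := by
        rw [h]; exact Real.exp_le_one_iff.2 (by nlinarith [sq_nonneg (s.im - T)])
      rw [h] at hE
      have hi' : 0 < s.im := by linarith
      calc _ ≤ (A * s.im ^ (1 / 2 + δ)) * (9 * s.im ^ (((0 : ℝ) - 1 / 2) / 2)) * 1 := by
            refine mul_le_mul (mul_le_mul hz hE (norm_nonneg _) (by positivity)) hg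
              (Real.exp_pos _).le (by positivity)
        _ = 9 * A * (s.im ^ (1 / 2 + δ) * s.im ^ (((0 : ℝ) - 1 / 2) / 2)) := by ring
        _ = 9 * A * s.im ^ (1 / 4 + δ) := by
            rw [← Real.rpow_add hi']; congr 2; ring
        _ ≤ 9 * A * (2 * T ^ (1 / 4 + δ)) :=
            mul_le_mul_of_nonneg_left (hpow _ le_rfl (by linarith)) (by positivity)
        _ = 18 * A * T ^ (1 / 4 + δ) := by ring
        _ ≤ _ := by
            refine mul_le_mul_of_nonneg_right ?_ (by positivity)
            rw [hM]
            have : 0 ≤ 18 * K * Real.exp 4 + 9 * B * Real.exp 68 := by positivity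
            linarith
    · have hg : Real.exp (s.re ^ 2 - (s.im - T) ^ 2) ≤ Real.exp 4 :=
        Real.exp_le_exp.2 (by nlinarith [sq_nonneg (s.im - T)])
      have hE' : ‖expTheta s‖ ≤ 9 * (2 * T ^ (1 / 4 + δ)) := by
        refine hE.trans (mul_le_mul_of_nonneg_left (hpow _ ?_ ?_) (by norm_num)) <;>
        rw [h] <;> linarith
      calc _ ≤ K * (9 * (2 * T ^ (1 / 4 + δ))) * Real.exp 4 := by
            refine mul_le_mul (mul_le_mul (hK' s h) hE' (norm_nonneg _) (by positivity)) hg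
              (Real.exp_pos _).le (by positivity)
        _ = 18 * K * Real.exp 4 * T ^ (1 / 4 + δ) := by ring
        _ ≤ _ := by
            refine mul_le_mul_of_nonneg_right ?_ (by positivity)
            rw [hM]
            have : 0 ≤ 18 * A + 9 * B * Real.exp 68 := by positivity
            linarith
    · have hsq : (s.im - T) ^ 2 = T ^ 2 / 4 := by rcases h with h | h <;> rw [h] <;> ring
      have hE' : ‖expTheta s‖ ≤ 9 * Real.exp s.im := by
        refine hE.trans (mul_le_mul_of_nonneg_left ?_ (by norm_num))
        calc s.im ^ ((s.re - 1 / 2) / 2) ≤ s.im ^ (1 : ℝ) :=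
              Real.rpow_le_rpow_of_exponent_le hi (by linarith)
          _ ≤ _ := by rw [Real.rpow_one]; linarith [Real.add_one_le_exp s.im]
      calc _ ≤ (B * Real.exp (4 * s.im)) * (9 * Real.exp s.im) *
            Real.exp (s.re ^ 2 - (s.im - T) ^ 2) := by
            refine mul_le_mul_of_nonneg_right (mul_le_mul (hB' s hr0 (by linarith) hi) hE'
              (norm_nonneg _) (by positivity)) (Real.exp_pos _).le
        _ = 9 * B * Real.exp (4 * s.im + s.im + (s.re ^ 2 - (s.im - T) ^ 2)) := by
            rw [Real.exp_add, Real.exp_add]; ring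
        _ ≤ 9 * B * Real.exp 68 := by
            refine mul_le_mul_of_nonneg_left (Real.exp_le_exp.2 ?_) (by positivity)
            rw [hsq]
            nlinarith [sq_nonneg (T - 15)]
        _ ≤ M * 1 := by
            rw [hM]
            have : 0 ≤ 18 * A + 18 * K * Real.exp 4 := by positivity
            linarith
        _ ≤ _ := mul_le_mul_of_nonneg_left hTp (by positivity)
  have hmem : s₀ ∈ closure U := by
    rw [hcl]
    exact ⟨⟨h0, h1⟩, by change 1 / 2 * T ≤ T; linarith, by change T ≤ 3 / 2 * T; linarith⟩
  have := Complex.norm_le_of_forall_mem_frontier_norm_le hb hd hfr hmem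
  rw [norm_mul _ (Complex.exp _), norm_exp_sq_sub] at this
  refine le_trans ?_ this
  refine le_mul_of_one_le_right (norm_nonneg _) (Real.one_le_exp ?_)
  simp only [← hTdef, sub_self]
  nlinarith [sq_nonneg s₀.re]

lemma differentiableAt_riemannZeta_mul_expTheta {s : ℂ} (hs : 0 < s.im) :
    DifferentiableAt ℂ (fun s => riemannZeta s * expTheta s) s :=
  (differentiableAt_riemannZeta (by rintro rfl; simp at hs)).mul (differentiableAt_expTheta hs)

lemma continuousOn_vertical {f : ℂ → ℂ} (hf : ∀ s : ℂ, 0 < s.im → DifferentiableAt ℂ f s) (c : ℝ) :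
    ContinuousOn (fun t : ℝ => f (c + Complex.I * t)) (Set.Ioi 0) := fun t ht => by
  have h1 : ContinuousAt f (c + Complex.I * t) := (hf _ (by simpa using ht)).continuousAt
  have h2 : ContinuousAt (fun t : ℝ => (c + Complex.I * t : ℂ)) t := by fun_prop
  exact (ContinuousAt.comp (f := fun t : ℝ => (c + Complex.I * t : ℂ)) h1 h2).continuousWithinAt

lemma uIcc_subset_Ioi {T : ℝ} (hT : 0 < T) : Set.uIcc T (2 * T) ⊆ Set.Ioi 0 := by
  rw [Set.uIcc_of_le (by linarith)]
  exact fun t ht => hT.trans_le ht.1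

/-- Moving the line of integration from the critical line to `re s = c`. -/
lemma norm_integral_half_sub_le {f : ℂ → ℂ} (hf : ∀ s : ℂ, 0 < s.im → DifferentiableAt ℂ f s)
    {c T B : ℝ} (hc : 1 / 2 ≤ c) (hT : 0 < T)
    (h1 : ∀ x ∈ Set.Icc (1 / 2) c, ‖f (x + T * Complex.I)‖ ≤ B)
    (h2 : ∀ x ∈ Set.Icc (1 / 2) c, ‖f (x + (2 * T : ℝ) * Complex.I)‖ ≤ B) :
    ‖(∫ t in T..(2 * T), f (1 / 2 + Complex.I * t)) - ∫ t in T..(2 * T), f (c + Complex.I * t)‖ ≤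
      2 * B * (c - 1 / 2) := by
  have H := Complex.integral_boundary_rect_eq_zero_of_differentiableOn f ⟨1 / 2, T⟩ ⟨c, 2 * T⟩
    fun s hs => (hf s ((uIcc_subset_Ioi hT) hs.2)).differentiableWithinAt
  simp only at H
  have b1 := intervalIntegral.norm_integral_le_of_norm_le_const (a := 1 / 2) (b := c)
    (f := fun x : ℝ => f (x + T * Complex.I)) (C := B) fun x hx => by
      rw [Set.uIoc_of_le hc] at hx; exact h1 x ⟨hx.1.le, hx.2⟩
  have b2 := intervalIntegral.norm_integral_le_of_norm_le_const (a := 1 / 2) (b := c)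
    (f := fun x : ℝ => f (x + (2 * T : ℝ) * Complex.I)) (C := B) fun x hx => by
      rw [Set.uIoc_of_le hc] at hx; exact h2 x ⟨hx.1.le, hx.2⟩
  rw [abs_of_nonneg (by linarith)] at b1 b2
  have e1 : ∀ t : ℝ, (1 / 2 + Complex.I * t : ℂ) = ((1 / 2 : ℝ) : ℂ) + t * Complex.I := fun t => by
    push_cast; ring
  have e2 : ∀ t : ℝ, (c + Complex.I * t : ℂ) = (c : ℂ) + t * Complex.I := fun t => by ring
  simp only [e1, e2]
  set X := ∫ t in T..(2 * T), f (((1 / 2 : ℝ) : ℂ) + t * Complex.I)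
  set Y := ∫ t in T..(2 * T), f ((c : ℂ) + t * Complex.I)
  have : ‖Complex.I • (X - Y)‖ = ‖X - Y‖ := by rw [norm_smul, Complex.norm_I, one_mul]
  rw [← this, smul_sub, show Complex.I • X - Complex.I • Y =
    (∫ x in (1 / 2 : ℝ)..c, f (x + T * Complex.I)) -
      ∫ x in (1 / 2 : ℝ)..c, f (x + (2 * T : ℝ) * Complex.I) by linear_combination -H]
  refine (norm_sub_le _ _).trans ?_
  linarith

lemma natCast_succ_cpow_neg (n : ℕ) (c t : ℝ) :
    1 / ((n : ℂ) + 1) ^ (c + Complex.I * t : ℂ) =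
      (((n + 1 : ℝ) ^ (-c) : ℝ) : ℂ) *
        Complex.exp (Complex.I * ((-(t * Real.log (n + 1)) : ℝ) : ℂ)) := by
  have hn : (0 : ℝ) < n + 1 := by positivity
  rw [show ((n : ℂ) + 1) = ((n + 1 : ℝ) : ℂ) by push_cast; rfl, one_div, ← Complex.cpow_neg,
    Complex.cpow_def_of_ne_zero (by exact_mod_cast hn.ne'), ← Complex.ofReal_log hn.le,
    Real.rpow_def_of_pos hn, Complex.ofReal_exp, ← Complex.exp_add]
  congr 1
  push_cast
  ring

/-- Integrating the Dirichlet series of `ζ` against the phase `thetaMain`, term by term. -/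
lemma hasSum_integral_riemannZeta_mul {α c T : ℝ} (hα : 0 ≤ α) (hc : 1 < c) (hT : 1 ≤ T) :
    HasSum (fun n : ℕ => (((n + 1 : ℝ) ^ (-c) : ℝ) : ℂ) * ∫ t in T..(2 * T), ((t ^ α : ℝ) : ℂ) *
        Complex.exp (Complex.I * ((thetaMain t - t * Real.log (n + 1) : ℝ) : ℂ)))
      (∫ t in T..(2 * T), riemannZeta (c + Complex.I * t) *
        (((t ^ α : ℝ) : ℂ) * Complex.exp (Complex.I * ((thetaMain t : ℝ) : ℂ)))) := by
  have hT0 : 0 < T := by linarith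
  have hsub := uIcc_subset_Ioi hT0
  have hsum := summable_succ_rpow (p := -c) (by linarith)
  have hcont : ∀ n : ℕ, ContinuousOn (fun t : ℝ => (((n + 1 : ℝ) ^ (-c) : ℝ) : ℂ) *
      (((t ^ α : ℝ) : ℂ) *
        Complex.exp (Complex.I * ((thetaMain t - t * Real.log (n + 1) : ℝ) : ℂ))))
      (Set.uIcc T (2 * T)) := fun n => by
    refine continuousOn_const.mul (ContinuousOn.mul ?_ ?_)
    · exact Complex.continuous_ofReal.comp_continuousOn
        (continuousOn_id.rpow_const fun t ht => Or.inl (ne_of_gt (hsub ht)))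
    · simpa using (continuousOn_phase (Real.log (n + 1)) 0).mono hsub
  have hioc : ∀ t ∈ Set.uIoc T (2 * T), 0 < t ∧ t ≤ 2 * T := fun t ht => by
    rw [Set.uIoc_of_le (by linarith)] at ht
    exact ⟨hT0.trans ht.1, ht.2⟩
  simp only [← intervalIntegral.integral_const_mul]
  refine intervalIntegral.hasSum_integral_of_dominated_convergence
    (fun n _ => (n + 1 : ℝ) ^ (-c) * (2 * T) ^ α)
    (fun n => ((hcont n).mono Set.uIoc_subset_uIcc).aestronglyMeasurable measurableSet_uIoc)
    (fun n => Filter.Eventually.of_forall fun t ht => ?_)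
    (Filter.Eventually.of_forall fun t _ => hsum.mul_right _)
    intervalIntegrable_const (Filter.Eventually.of_forall fun t ht => ?_)
  · obtain ⟨ht0, ht2⟩ := hioc t ht
    rw [norm_mul, norm_mul, Complex.norm_real, Complex.norm_real, norm_cexp_I_mul, mul_one,
      Real.norm_of_nonneg (by positivity), Real.norm_of_nonneg (by positivity)]
    exact mul_le_mul_of_nonneg_left (Real.rpow_le_rpow ht0.le ht2 hα) (by positivity)
  · have hre : 1 < (c + Complex.I * t : ℂ).re := by simpa using hc
    have h : HasSum (fun n : ℕ => 1 / ((n : ℂ) + 1) ^ (c + Complex.I * t : ℂ))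
        (riemannZeta (c + Complex.I * t)) := by
      rw [zeta_eq_tsum_one_div_nat_add_one_cpow hre]
      have : Summable fun n : ℕ => 1 / ((n : ℂ) + 1) ^ (c + Complex.I * t : ℂ) := by
        simpa using (summable_nat_add_iff 1).2 (Complex.summable_one_div_nat_cpow.2 hre)
      exact this.hasSum
    convert! h.mul_right (((t ^ α : ℝ) : ℂ) * Complex.exp (Complex.I * ((thetaMain t : ℝ) : ℂ)))
      using 2 with n
    rw [natCast_succ_cpow_neg]
    have : Complex.exp (Complex.I * ((thetaMain t - t * Real.log (n + 1) : ℝ) : ℂ)) =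
        Complex.exp (Complex.I * ((-(t * Real.log (n + 1)) : ℝ) : ℂ)) *
          Complex.exp (Complex.I * ((thetaMain t : ℝ) : ℂ)) := by
      rw [← Complex.exp_add]; congr 1; push_cast; ring
    rw [this]; ring

lemma exists_norm_integral_riemannZeta_mul_le {α : ℝ} (h0 : 1 / 4 < α) (h1 : α ≤ 1) :
    ∃ C > 0, ∀ T ≥ (1 : ℝ), ‖∫ t in T..(2 * T),
      riemannZeta (((2 * α + 1 / 2 : ℝ) : ℂ) + Complex.I * t) *
        (((t ^ α : ℝ) : ℂ) * Complex.exp (Complex.I * ((thetaMain t : ℝ) : ℂ)))‖ ≤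
      C * T ^ α * (1 + Real.log T) := by
  obtain ⟨C, hC, h⟩ := exists_norm_sum_integral_le h0 h1
  refine ⟨C, hC, fun T hT => ?_⟩
  refine le_of_tendsto (hasSum_integral_riemannZeta_mul (by linarith)
    (show 1 < 2 * α + 1 / 2 by linarith) hT).tendsto_sum_nat.norm
    (Filter.Eventually.of_forall fun N => ?_)
  convert! h T hT N using 2
  rw [Finset.range_eq_Ico, ← Finset.Ico_add_one_right_eq_Icc,
    ← Finset.sum_Ico_add' _ 0 N 1]
  simp

/-- Upper bounds on the critical line: pointwise, and for the integral of `ζ` against the main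
term of the phase of Hardy's function. -/
theorem exists_norm_riemannZeta_half_le {δ : ℝ} (hδ : 0 < δ) (hδ' : δ ≤ 1 / 2) :
    ∃ C > 0, (∀ t ≥ (4 : ℝ), ‖riemannZeta (1 / 2 + Complex.I * t)‖ ≤ C * t ^ (1 / 4 + δ)) ∧
      ∀ T ≥ (4 : ℝ), ‖∫ t in T..(2 * T), riemannZeta (1 / 2 + Complex.I * t) *
        Complex.exp (Complex.I * ((thetaMain t : ℝ) : ℂ))‖ ≤ C * T ^ (1 / 4 + δ) := by
  obtain ⟨A, hA, hA'⟩ := exists_norm_riemannZeta_mul_expTheta_le hδ hδ'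
  set α := 1 / 4 + δ / 2 with hα
  set c := 2 * α + 1 / 2 with hc
  have hc1 : c = 1 + δ := by rw [hc, hα]; ring
  obtain ⟨K, hK, hK'⟩ := exists_norm_riemannZeta_le_of_one_lt (show 1 < c by linarith)
  obtain ⟨D, hD, hD'⟩ := exists_norm_integral_riemannZeta_mul_le
    (show 1 / 4 < α by linarith) (by linarith)
  set P : ℝ := ((2 * Real.pi) ^ α)⁻¹ with hP
  have hP0 : 0 < P := by positivity
  set M := 4 * A + 3 * K + P * (D * (1 + 2 / δ)) with hM
  have hM0 : 0 ≤ 3 * K + P * (D * (1 + 2 / δ)) := by positivity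
  refine ⟨M, by positivity, fun t ht => ?_, fun T hT => ?_⟩
  · have h := hA' (1 / 2 + Complex.I * t) (by simp) (by simp; linarith) (by simpa using ht)
    rw [expTheta_half_add (by linarith), norm_mul, norm_cexp_I_mul, mul_one] at h
    have him : (1 / 2 + Complex.I * t : ℂ).im = t := by simp
    rw [him] at h
    refine h.trans (mul_le_mul_of_nonneg_right ?_ (Real.rpow_nonneg (by linarith) _))
    linarith
  have hT0 : 0 < T := by linarith
  have hsub := uIcc_subset_Ioi hT0
  have hTδ : T ^ α * (1 + Real.log T) ≤ (1 + 2 / δ) * T ^ (1 / 4 + δ) := by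
    have hlog : 1 + Real.log T ≤ (1 + 2 / δ) * T ^ (δ / 2) := by
      have := Real.log_le_rpow_div hT0.le (half_pos hδ)
      have h1 := Real.one_le_rpow (show 1 ≤ T by linarith) (half_pos hδ).le
      calc 1 + Real.log T ≤ T ^ (δ / 2) + T ^ (δ / 2) / (δ / 2) := add_le_add h1 this
        _ = _ := by field_simp
    calc T ^ α * (1 + Real.log T) ≤ T ^ α * ((1 + 2 / δ) * T ^ (δ / 2)) :=
          mul_le_mul_of_nonneg_left hlog (by positivity)
      _ = (1 + 2 / δ) * (T ^ α * T ^ (δ / 2)) := by ring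
      _ = _ := by rw [← Real.rpow_add hT0, hα]; congr 2; ring
  -- the shift to the line `re s = c`
  have hhor : ∀ y, T ≤ y → y ≤ 2 * T → ∀ x ∈ Set.Icc (1 / 2) c,
      ‖riemannZeta (x + y * Complex.I) * expTheta (x + y * Complex.I)‖ ≤
        A * (2 * T ^ (1 / 4 + δ)) := fun y hy1 hy2 x hx => by
    have him : (x + y * Complex.I : ℂ).im = y := by simp
    have hre : (x + y * Complex.I : ℂ).re = x := by simp
    have h := hA' (x + y * Complex.I) (by rw [hre]; linarith [hx.1])
      (by rw [hre]; linarith [hx.2]) (by rw [him]; linarith)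
    rw [him] at h
    refine h.trans (mul_le_mul_of_nonneg_left ?_ hA.le)
    calc y ^ (1 / 4 + δ) ≤ (2 * T) ^ (1 / 4 + δ) :=
          Real.rpow_le_rpow (by linarith) hy2 (by linarith)
      _ = 2 ^ (1 / 4 + δ) * T ^ (1 / 4 + δ) := Real.mul_rpow two_pos.le hT0.le
      _ ≤ 2 * T ^ (1 / 4 + δ) := by
          refine mul_le_mul_of_nonneg_right ?_ (by positivity)
          calc (2 : ℝ) ^ (1 / 4 + δ) ≤ 2 ^ (1 : ℝ) :=
                Real.rpow_le_rpow_of_exponent_le one_le_two (by linarith)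
            _ = 2 := Real.rpow_one 2
  have hshift := norm_integral_half_sub_le
    (fun s hs => differentiableAt_riemannZeta_mul_expTheta hs) (by linarith) hT0
    (hhor T le_rfl (by linarith)) (hhor (2 * T) (by linarith) le_rfl)
  -- replacing the phase by its main term on the line `re s = c`
  have hcz : ContinuousOn (fun t : ℝ => riemannZeta (c + Complex.I * t)) (Set.uIcc T (2 * T)) := by
    intro t ht
    have h1 : ContinuousAt riemannZeta (c + Complex.I * t) :=
      (differentiableAt_riemannZeta (by
        intro e
        have := congrArg Complex.re e
        simp at this; linarith)).continuousAt
    have h2 : ContinuousAt (fun t : ℝ => (c + Complex.I * t : ℂ)) t := by fun_prop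
    exact (ContinuousAt.comp (f := fun t : ℝ => (c + Complex.I * t : ℂ)) h1 h2).continuousWithinAt
  have hcm : ContinuousOn (fun t : ℝ => riemannZeta (c + Complex.I * t) *
      (((t ^ α : ℝ) : ℂ) * Complex.exp (Complex.I * ((thetaMain t : ℝ) : ℂ))))
      (Set.uIcc T (2 * T)) := by
    refine hcz.mul (ContinuousOn.mul ?_ ?_)
    · exact Complex.continuous_ofReal.comp_continuousOn
        (continuousOn_id.rpow_const fun t ht => Or.inl (ne_of_gt (hsub ht)))
    · simpa using (continuousOn_phase 0 0).mono hsub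
  have hcW := (continuousOn_vertical
    (fun s hs => differentiableAt_riemannZeta_mul_expTheta hs) c).mono hsub
  have hrep : ‖(∫ t in T..(2 * T), riemannZeta (c + Complex.I * t) * expTheta (c + Complex.I * t)) -
      (P : ℂ) * ∫ t in T..(2 * T), riemannZeta (c + Complex.I * t) *
        (((t ^ α : ℝ) : ℂ) * Complex.exp (Complex.I * ((thetaMain t : ℝ) : ℂ)))‖ ≤
      3 * K * T ^ (1 / 4 + δ) := by
    rw [← intervalIntegral.integral_const_mul, ← intervalIntegral.integral_sub
      hcW.intervalIntegrable (hcm.const_mul (P : ℂ)).intervalIntegrable]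
    have := intervalIntegral.norm_integral_le_of_norm_le_const (a := T) (b := 2 * T)
      (f := fun t : ℝ => riemannZeta (c + Complex.I * t) * expTheta (c + Complex.I * t) -
        P * (riemannZeta (c + Complex.I * t) *
        (((t ^ α : ℝ) : ℂ) * Complex.exp (Complex.I * ((thetaMain t : ℝ) : ℂ)))))
      (C := 3 * K * T ^ (α - 1)) fun t ht => by
        rw [Set.uIoc_of_le (by linarith)] at ht
        have ht0 : 0 < t := hT0.trans ht.1
        have ha : (c - 1 / 2) / 2 = α := by rw [hc]; ring
        have h := norm_expTheta_sub_le (t := t) (a := c - 1 / 2) (by linarith [ht.1])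
          (abs_le.2 ⟨by linarith, by linarith⟩)
        rw [ha, Real.div_rpow ht0.le (by positivity), div_eq_mul_inv (t ^ α), ← hP,
          show (1 / 2 + ((c - 1 / 2 : ℝ) : ℂ) + Complex.I * t : ℂ) = c + Complex.I * t by
            push_cast; ring] at h
        rw [show riemannZeta (c + Complex.I * t) * expTheta (c + Complex.I * t) -
          P * (riemannZeta (c + Complex.I * t) * (((t ^ α : ℝ) : ℂ) *
            Complex.exp (Complex.I * ((thetaMain t : ℝ) : ℂ)))) =
          riemannZeta (c + Complex.I * t) * (expTheta (c + Complex.I * t) -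
            ((t ^ α * P : ℝ) : ℂ) * Complex.exp (Complex.I * ((thetaMain t : ℝ) : ℂ))) by
            push_cast; ring, norm_mul]
        have hpow : t ^ (α - 1) ≤ T ^ (α - 1) :=
          Real.rpow_le_rpow_of_nonpos hT0 ht.1.le (by linarith)
        calc _ ≤ K * (3 * t ^ (α - 1)) :=
              mul_le_mul (hK' _ (by simp)) h (norm_nonneg _) hK.le
          _ ≤ K * (3 * T ^ (α - 1)) := by
              refine mul_le_mul_of_nonneg_left ?_ hK.le
              linarith
          _ = _ := by ring
    refine this.trans ?_
    rw [show 2 * T - T = T by ring, abs_of_pos hT0, mul_assoc, ← Real.rpow_add_one hT0.ne',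
      sub_add_cancel]
    refine mul_le_mul_of_nonneg_left ?_ (by positivity)
    exact Real.rpow_le_rpow_of_exponent_le (by linarith) (by linarith)
  have hmain : ‖(P : ℂ) * ∫ t in T..(2 * T), riemannZeta (c + Complex.I * t) *
        (((t ^ α : ℝ) : ℂ) * Complex.exp (Complex.I * ((thetaMain t : ℝ) : ℂ)))‖ ≤
      P * (D * (1 + 2 / δ)) * T ^ (1 / 4 + δ) := by
    rw [norm_mul, Complex.norm_real, Real.norm_of_nonneg hP0.le, mul_assoc]
    refine mul_le_mul_of_nonneg_left ((hD' T (by linarith)).trans ?_) hP0.le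
    rw [mul_assoc, mul_assoc]
    exact mul_le_mul_of_nonneg_left hTδ hD.le
  have hleft : ∫ t in T..(2 * T), riemannZeta (1 / 2 + Complex.I * t) *
        Complex.exp (Complex.I * ((thetaMain t : ℝ) : ℂ)) =
      ∫ t in T..(2 * T), riemannZeta (1 / 2 + Complex.I * t) *
        expTheta (1 / 2 + Complex.I * t) := by
    refine intervalIntegral.integral_congr fun t ht => ?_
    rw [expTheta_half_add (hsub ht)]
  rw [hleft]
  set X := ∫ t in T..(2 * T), riemannZeta (1 / 2 + Complex.I * t) *
        expTheta (1 / 2 + Complex.I * t)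
  set Y := ∫ t in T..(2 * T), riemannZeta (c + Complex.I * t) * expTheta (c + Complex.I * t)
  set V := (P : ℂ) * ∫ t in T..(2 * T), riemannZeta (c + Complex.I * t) *
        (((t ^ α : ℝ) : ℂ) * Complex.exp (Complex.I * ((thetaMain t : ℝ) : ℂ)))
  have hsh : ‖X - Y‖ ≤ 4 * A * T ^ (1 / 4 + δ) := by
    refine hshift.trans ?_
    have : 0 ≤ A * T ^ (1 / 4 + δ) := by positivity
    nlinarith
  calc ‖X‖ = ‖(X - Y) + (Y - V) + V‖ := by congr 1; ring
    _ ≤ ‖X - Y‖ + ‖Y - V‖ + ‖V‖ := norm_add₃_le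
    _ ≤ 4 * A * T ^ (1 / 4 + δ) + 3 * K * T ^ (1 / 4 + δ) +
        P * (D * (1 + 2 / δ)) * T ^ (1 / 4 + δ) := add_le_add (add_le_add hsh hrep) hmain
    _ = _ := by rw [hM]; ring

lemma Gammaℝ_conj_eq (s : ℂ) :
    Complex.Gammaℝ (starRingEnd ℂ s) = starRingEnd ℂ (Complex.Gammaℝ s) := by
  have h : starRingEnd ℂ s / 2 = starRingEnd ℂ (s / 2) := by
    rw [map_div₀, Complex.conj_ofNat]
  have harg : (Real.pi : ℂ).arg ≠ Real.pi := by
    rw [Complex.arg_ofReal_of_nonneg Real.pi_pos.le]; exact Real.pi_ne_zero.symm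
  rw [Complex.Gammaℝ_def, Complex.Gammaℝ_def, map_mul, neg_div, h, Complex.Gamma_conj, neg_div,
    ← map_neg, Complex.cpow_conj _ _ harg, Complex.conj_ofReal]

lemma completedRiemannZeta_eq_Gammaℝ_mul {s : ℂ} (hs : 0 < s.re) :
    completedRiemannZeta s = Complex.Gammaℝ s * riemannZeta s := by
  have h0 : s ≠ 0 := by rintro rfl; simp at hs
  rw [riemannZeta_def_of_ne_zero h0, mul_div_cancel₀ _ (Complex.Gammaℝ_ne_zero_of_re_pos hs)]

lemma conj_completedRiemannZeta_half (t : ℝ) :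
    starRingEnd ℂ (completedRiemannZeta (1 / 2 + Complex.I * t)) =
      completedRiemannZeta (1 / 2 + Complex.I * t) := by
  set s : ℂ := 1 / 2 + Complex.I * t with hs
  have hre : s.re = 1 / 2 := by simp [hs]
  have hc : starRingEnd ℂ s = 1 - s := by
    apply Complex.ext
    · rw [Complex.conj_re, Complex.sub_re, Complex.one_re, hre]; norm_num
    · simp
  have h : completedRiemannZeta (starRingEnd ℂ s) = starRingEnd ℂ (completedRiemannZeta s) := by
    rw [completedRiemannZeta_eq_Gammaℝ_mul (by rw [Complex.conj_re, hre]; norm_num),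
      completedRiemannZeta_eq_Gammaℝ_mul (by rw [hre]; norm_num), Gammaℝ_conj_eq,
      riemannZeta_conj, map_mul]
  rw [← h, hc, completedRiemannZeta_one_sub]

lemma Gammaℝ_half_eq (t : ℝ) : Complex.Gammaℝ (1 / 2 + Complex.I * t) =
    ((Real.pi ^ (-(1 / 4) : ℝ) * ‖Complex.Gamma (1 / 4 + Complex.I * (t : ℂ) / 2)‖ : ℝ) : ℂ) *
      eTheta t := by
  have hG : ((‖Complex.Gamma (1 / 4 + Complex.I * (t : ℂ) / 2)‖ : ℝ) : ℂ) ≠ 0 := by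
    simpa using Gamma_quarter_ne_zero t
  have hp : (Real.pi : ℂ) ≠ 0 := by simp [Real.pi_ne_zero]
  rw [Complex.Gammaℝ_def, eTheta, show (1 / 2 + Complex.I * (t : ℂ)) / 2 =
    1 / 4 + Complex.I * t / 2 by ring, show -(1 / 2 + Complex.I * (t : ℂ)) / 2 =
    (((-(1 / 4) : ℝ)) : ℂ) + -(Complex.I * t) / 2 by push_cast; ring, Complex.cpow_add _ _ hp,
    Complex.ofReal_mul, Complex.ofReal_cpow Real.pi_pos.le]
  generalize Complex.Gamma (1 / 4 + Complex.I * (t : ℂ) / 2) = G at hG ⊢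
  field_simp

/-- Hardy's function is real: no information is lost in taking the real part. -/
theorem ofReal_HardyZ (t : ℝ) :
    (HardyZ t : ℂ) = eTheta t * riemannZeta (1 / 2 + Complex.I * (t : ℂ)) := by
  have hre : 0 < (1 / 2 + Complex.I * (t : ℂ)).re := by simp
  have h := conj_completedRiemannZeta_half t
  set r : ℝ := Real.pi ^ (-(1 / 4) : ℝ) * ‖Complex.Gamma (1 / 4 + Complex.I * (t : ℂ) / 2)‖ with hr
  have hr0 : (r : ℂ) ≠ 0 := by
    have : 0 < r := mul_pos (by positivity) (norm_pos_iff.2 (Gamma_quarter_ne_zero t))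
    exact_mod_cast this.ne'
  rw [completedRiemannZeta_eq_Gammaℝ_mul hre, Gammaℝ_half_eq, ← hr, mul_assoc, map_mul,
    Complex.conj_ofReal] at h
  exact Complex.conj_eq_iff_re.1 (mul_left_cancel₀ hr0 h)

lemma abs_HardyZ (t : ℝ) : |HardyZ t| = ‖riemannZeta (1 / 2 + Complex.I * (t : ℂ))‖ := by
  rw [← Real.norm_eq_abs, ← Complex.norm_real, ofReal_HardyZ, norm_mul, norm_eTheta, one_mul]

lemma continuous_riemannZeta_half :
    Continuous fun t : ℝ => riemannZeta (1 / 2 + Complex.I * (t : ℂ)) := by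
  refine continuous_iff_continuousAt.2 fun t => ?_
  have h1 : ContinuousAt riemannZeta (1 / 2 + Complex.I * t) :=
    (differentiableAt_riemannZeta (by
      intro e
      have := congrArg Complex.re e
      norm_num at this)).continuousAt
  have h2 : ContinuousAt (fun t : ℝ => (1 / 2 + Complex.I * t : ℂ)) t := by fun_prop
  exact ContinuousAt.comp (f := fun t : ℝ => (1 / 2 + Complex.I * t : ℂ)) h1 h2

lemma continuous_eTheta : Continuous eTheta := by
  have hG : Continuous fun t : ℝ => Complex.Gamma (1 / 4 + Complex.I * (t : ℂ) / 2) := by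
    refine continuous_iff_continuousAt.2 fun t => ?_
    have h1 : ContinuousAt Complex.Gamma (1 / 4 + Complex.I * t / 2) :=
      (Complex.differentiableAt_Gamma _ fun m => by
        intro e
        have := congrArg Complex.re e
        have hm := m.cast_nonneg (α := ℝ)
        simp at this
        linarith).continuousAt
    have h2 : ContinuousAt (fun t : ℝ => (1 / 4 + Complex.I * t / 2 : ℂ)) t := by fun_prop
    exact ContinuousAt.comp (f := fun t : ℝ => (1 / 4 + Complex.I * t / 2 : ℂ)) h1 h2
  have hp : Continuous fun t : ℝ => (Real.pi : ℂ) ^ (-(Complex.I * (t : ℂ)) / 2) := by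
    have : Continuous fun t : ℝ => -(Complex.I * (t : ℂ)) / 2 := by fun_prop
    exact this.const_cpow (Or.inl (by simp [Real.pi_ne_zero]))
  refine hp.mul (hG.div (Complex.continuous_ofReal.comp hG.norm) fun t => ?_)
  simpa using Gamma_quarter_ne_zero t

lemma continuous_HardyZ : Continuous HardyZ :=
  Complex.continuous_re.comp (continuous_eTheta.mul continuous_riemannZeta_half)

/-- `I₊` is the mean of the integrals of `|Z|` and of `Z`. -/
lemma Iplus_eq {T : ℝ} (hT : 0 ≤ T) :
    Iplus T = (1 / 2) * (∫ t in T..(2 * T), ‖riemannZeta (1 / 2 + Complex.I * (t : ℂ))‖) +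
      (1 / 2) * ∫ t in T..(2 * T), HardyZ t := by
  have hm : MeasurableSet {t : ℝ | 0 < HardyZ t} :=
    (isOpen_lt continuous_const continuous_HardyZ).measurableSet
  have e1 : {t : ℝ | t ∈ Set.Ioc T (2 * T) ∧ 0 < HardyZ t} =
      Set.Ioc T (2 * T) ∩ {t : ℝ | 0 < HardyZ t} := rfl
  have e2 : ({t : ℝ | 0 < HardyZ t}).indicator HardyZ = fun t : ℝ =>
      (1 / 2) * ‖riemannZeta (1 / 2 + Complex.I * (t : ℂ))‖ + (1 / 2) * HardyZ t := by
    funext t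
    rw [← abs_HardyZ, Set.indicator_apply]
    split_ifs with h
    · rw [abs_of_pos h]; ring
    · rw [abs_of_nonpos (not_lt.1 h)]; ring
  rw [Iplus, e1, ← setIntegral_indicator hm, e2,
    ← intervalIntegral.integral_of_le (by linarith), intervalIntegral.integral_add,
    intervalIntegral.integral_const_mul, intervalIntegral.integral_const_mul]
  · exact (continuous_const.mul continuous_riemannZeta_half.norm).intervalIntegrable _ _
  · exact (continuous_const.mul continuous_HardyZ).intervalIntegrable _ _

/-- The integral of Hardy's function over a dyadic interval. -/
theorem exists_abs_integral_HardyZ_le {δ : ℝ} (hδ : 0 < δ) (hδ' : δ ≤ 1 / 2) :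
    ∃ C > 0, ∀ T ≥ (4 : ℝ), |∫ t in T..(2 * T), HardyZ t| ≤ C * T ^ (1 / 4 + δ) := by
  obtain ⟨C, hC, hpt, hInt⟩ := exists_norm_riemannZeta_half_le hδ hδ'
  refine ⟨281 * C, by positivity, fun T hT => ?_⟩
  have hT0 : 0 < T := by linarith
  have hsub := uIcc_subset_Ioi hT0
  set q : ℝ → ℂ := fun t => eTheta t * Complex.exp (Complex.I * ((-thetaMain t : ℝ) : ℂ)) with hq
  have hqT : ‖q T‖ = 1 := by rw [hq]; simp only [norm_mul, norm_eTheta, norm_cexp_I_mul, mul_one]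
  set g : ℝ → ℂ := fun t => riemannZeta (1 / 2 + Complex.I * t) *
    Complex.exp (Complex.I * ((thetaMain t : ℝ) : ℂ)) with hg
  have hZ : ∀ t : ℝ, (HardyZ t : ℂ) = q t * g t := fun t => by
    have : Complex.exp (Complex.I * ((-thetaMain t : ℝ) : ℂ)) *
        Complex.exp (Complex.I * ((thetaMain t : ℝ) : ℂ)) = 1 := by
      rw [← Complex.exp_add, ← mul_add]; simp
    rw [ofReal_HardyZ, hq, hg]
    linear_combination -(eTheta t * riemannZeta (1 / 2 + Complex.I * t)) * this
  have hgc : ContinuousOn g (Set.uIcc T (2 * T)) := by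
    refine continuous_riemannZeta_half.continuousOn.mul ?_
    simpa using (continuousOn_phase 0 0).mono hsub
  have hZc : Continuous fun t => (HardyZ t : ℂ) := Complex.continuous_ofReal.comp continuous_HardyZ
  have hdiff : ‖(∫ t in T..(2 * T), (HardyZ t : ℂ)) - q T * ∫ t in T..(2 * T), g t‖ ≤
      280 * C * T ^ (1 / 4 + δ) := by
    rw [← intervalIntegral.integral_const_mul, ← intervalIntegral.integral_sub
      (hZc.intervalIntegrable _ _) (hgc.const_mul (q T)).intervalIntegrable]
    have := intervalIntegral.norm_integral_le_of_norm_le_const (a := T) (b := 2 * T)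
      (f := fun t : ℝ => (HardyZ t : ℂ) - q T * g t)
      (C := 140 / T * (C * (2 * T ^ (1 / 4 + δ)))) fun t ht => by
        rw [Set.uIoc_of_le (by linarith)] at ht
        have ht0 : 0 < t := hT0.trans ht.1
        have h2 : ‖g t‖ ≤ C * (2 * T ^ (1 / 4 + δ)) := by
          rw [hg]
          simp only [norm_mul, norm_cexp_I_mul, mul_one]
          refine (hpt t (hT.le.trans ht.1.le)).trans (mul_le_mul_of_nonneg_left ?_ hC.le)
          calc t ^ (1 / 4 + δ) ≤ (2 * T) ^ (1 / 4 + δ) :=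
                Real.rpow_le_rpow ht0.le ht.2 (by linarith)
            _ = 2 ^ (1 / 4 + δ) * T ^ (1 / 4 + δ) := Real.mul_rpow two_pos.le hT0.le
            _ ≤ 2 * T ^ (1 / 4 + δ) := by
                refine mul_le_mul_of_nonneg_right ?_ (by positivity)
                calc (2 : ℝ) ^ (1 / 4 + δ) ≤ 2 ^ (1 : ℝ) :=
                      Real.rpow_le_rpow_of_exponent_le one_le_two (by linarith)
                  _ = 2 := Real.rpow_one 2
        rw [hZ, ← sub_mul, norm_mul]
        exact mul_le_mul (norm_eTheta_mul_sub_le hT ⟨ht.1.le, ht.2⟩) h2 (norm_nonneg _)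
          (by positivity)
    refine this.trans (le_of_eq ?_)
    rw [show 2 * T - T = T by ring, abs_of_pos hT0]
    field_simp
    ring
  have hmain : ‖q T * ∫ t in T..(2 * T), g t‖ ≤ C * T ^ (1 / 4 + δ) := by
    rw [norm_mul, hqT, one_mul]; exact hInt T hT
  rw [← Real.norm_eq_abs, ← Complex.norm_real, ← intervalIntegral.integral_ofReal]
  calc _ = ‖((∫ t in T..(2 * T), (HardyZ t : ℂ)) - q T * ∫ t in T..(2 * T), g t) +
        q T * ∫ t in T..(2 * T), g t‖ := by rw [sub_add_cancel]
    _ ≤ 280 * C * T ^ (1 / 4 + δ) + C * T ^ (1 / 4 + δ) :=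
        (norm_add_le _ _).trans (add_le_add hdiff hmain)
    _ = _ := by ring

theorem Iplus_asymptotic :
    ∀ ε > (0 : ℝ), ∃ C > (0 : ℝ), ∃ T₀ : ℝ, ∀ T ≥ T₀,
      |Iplus T - (1 / 2) * ∫ t in T..(2 * T), ‖riemannZeta (1 / 2 + Complex.I * (t : ℂ))‖| ≤
        C * T ^ ((1 : ℝ) / 4 + ε) := by
  intro ε hε
  obtain ⟨C, hC, h⟩ := exists_abs_integral_HardyZ_le (lt_min hε (by norm_num : (0 : ℝ) < 1 / 2))
    (min_le_right _ _)
  refine ⟨C, hC, 4, fun T hT => ?_⟩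
  rw [Iplus_eq (by linarith), add_sub_cancel_left, abs_mul,
    abs_of_pos (by norm_num : (0:ℝ) < 1 / 2)]
  have h1 : T ^ (1 / 4 + min ε (1 / 2)) ≤ T ^ ((1 : ℝ) / 4 + ε) :=
    Real.rpow_le_rpow_of_exponent_le (by linarith) (by linarith [min_le_left ε (1 / 2)])
  have h2 := (h T hT).trans (mul_le_mul_of_nonneg_left h1 hC.le)
  linarith [abs_nonneg (∫ t in T..(2 * T), HardyZ t)]
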